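/- For every k ∈ ℕ and every A ⊆ ℕ with positive upper Banach density, there exist a, d ∈ ℕ such that a, a+d, a+2d, …, a+kd, and a+Ω(d) all belong to A. -/

import Mathlib

open Filter Topology
open scoped Classical

/-- `bigOmega n` = number of prime factors of `n` counted with multiplicity. -/
def bigOmega (n : ℕ) : ℕ := (Nat.primeFactorsList n).length

/-- Upper Banach density of a set of natural numbers. -/
noncomputable def upperBanachDensity (A : Set ℕ) : ℝ :=
  Filter.limsup
    (fun N : ℕ => ⨆ M : ℕ, (((Finset.Ioc M (M + N)).filter (· ∈ A)).card : ℝ) / N)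
    Filter.atTop

namespace DensityHJ

open Combinatorics Finset
open scoped BigOperators

/-- The substitution of variable words (`none` marks the variable) into a combinatorial
subspace. -/
def liftWord {η α ι : Type*} (V : Subspace η α ι) (w : η → Option α) : ι → Option α :=
  fun i => (V.idxFun i).elim some w

/-- Composition of combinatorial subspaces. -/
def compSubspace {η α ι κ : Type*} (V : Subspace ι α κ) (W : Subspace η α ι) :
    Subspace η α κ where
  idxFun i := (V.idxFun i).elim Sum.inl W.idxFun
  proper e := by
    obtain ⟨i, hi⟩ := W.proper e
    obtain ⟨j, hj⟩ := V.proper i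
    exact ⟨j, by simp [hj, hi]⟩

lemma compSubspace_apply {η α ι κ : Type*} (V : Subspace ι α κ) (W : Subspace η α ι)
    (x : η → α) : compSubspace V W x = V (W x) := by
  funext i
  simp only [compSubspace, Subspace.apply_def]
  cases V.idxFun i <;> simp [Subspace.apply_def]

lemma liftWord_compSubspace {η α ι κ : Type*} (V : Subspace ι α κ) (W : Subspace η α ι)
    (w : η → Option α) : liftWord (compSubspace V W) w = liftWord V (liftWord W w) := by
  funext i
  simp only [compSubspace, liftWord]
  cases V.idxFun i <;> simp [liftWord]

/-- Every colouring of variable words depends, on a suitable subspace, only on the part of the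
word preceding the first occurrence of the variable. -/
lemma exists_prefix_dependent (α : Type) [Finite α] (n : ℕ) :
    ∀ (κ : Type) [Finite κ], ∃ (ι : Type) (_ : Fintype ι),
      ∀ C : (ι → Option α) → κ, ∃ V : Subspace (Fin n) α ι,
        ∀ (w w' : Fin n → Option α) (i : Fin n), w i = none → w' i = none →
          (∀ j < i, w j = w' j ∧ w j ≠ none) → C (liftWord V w) = C (liftWord V w') := by
  induction n with
  | zero =>
    intro κ _
    exact ⟨Empty, inferInstance, fun C => ⟨⟨fun i => i.elim, fun e => e.elim0⟩,
      fun _ _ i => i.elim0⟩⟩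
  | succ n ih =>
    intro κ _
    obtain ⟨ι, _, hι⟩ := ih (α → κ)
    obtain ⟨τ, _, hτ⟩ := Subspace.exists_mono_in_high_dimension (Option α) κ ι
    refine ⟨Option τ, inferInstance, fun C => ?_⟩
    obtain ⟨W, c, hW⟩ := hτ (fun σ => C (fun o => o.elim none σ))
    let tail (p : Option α) (x : ι → Option α) : Option τ → Option α :=
      fun o => o.elim p (fun t => (W.idxFun t).elim (fun a => a.elim p some) x)
    obtain ⟨V, hV⟩ := hι (fun x p => C (tail (some p) x))
    let U : Subspace (Fin (n + 1)) α (Option τ) :=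
      { idxFun := fun o => o.elim (Sum.inr 0) (fun t => (W.idxFun t).elim
          (fun a => a.elim (Sum.inr 0) Sum.inl)
          (fun e => (V.idxFun e).elim Sum.inl (fun j => Sum.inr j.succ)))
        proper := by
          intro e
          refine Fin.cases ⟨none, rfl⟩ (fun j => ?_) e
          obtain ⟨e, he⟩ := V.proper j
          obtain ⟨t, ht⟩ := W.proper e
          exact ⟨some t, by simp [ht, he]⟩ }
    have hU : ∀ w : Fin (n + 1) → Option α,
        liftWord U w = tail (w 0) (liftWord V (fun j => w j.succ)) := by
      intro w
      funext o
      cases o with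
      | none => simp [liftWord, U, tail]
      | some t =>
        simp only [liftWord, U, tail, Option.elim_some]
        rcases W.idxFun t with (_ | a) | e
        · simp
        · simp
        · simp only [Sum.elim_inr, liftWord]
          rcases V.idxFun e with a | j <;> simp
    have h0 : ∀ x, C (tail none x) = c := by
      intro x
      rw [← hW x]
      congr 1
      funext o
      cases o with
      | none => simp [tail]
      | some t =>
        simp only [tail, Option.elim_some, Subspace.apply_def]
        rcases W.idxFun t with (_ | a) | e <;> simp
    refine ⟨U, fun w w' i => ?_⟩
    rw [hU, hU]
    refine Fin.cases ?_ (fun i => ?_) i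
    · intro h h' _
      rw [h, h', h0, h0]
    · intro h h' hlt
      obtain ⟨h1, h2⟩ := hlt 0 (Fin.succ_pos i)
      rw [← h1]
      obtain ⟨p, hp⟩ := Option.ne_none_iff_exists'.1 h2
      rw [hp]
      exact congrFun (hV (fun j => w j.succ) (fun j => w' j.succ) i h h'
        (fun j hj => hlt j.succ (Fin.succ_lt_succ_iff.2 hj))) p

/-- A colouring depending only on the prefix before the first variable depends, on a suitable
subspace, only on the position of the first variable. -/
lemma exists_position_dependent (α : Type) [Finite α] (κ : Type) [Finite κ] (m : ℕ) :
    ∃ n : ℕ, ∀ C : (Fin n → Option α) → κ,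
      (∀ (w w' : Fin n → Option α) (i : Fin n), w i = none → w' i = none →
          (∀ j < i, w j = w' j ∧ w j ≠ none) → C w = C w') →
      ∃ V : Subspace (Fin m) α (Fin n),
        ∀ (w w' : Fin m → Option α) (i : Fin m), w i = none → w' i = none →
          (∀ j < i, w j ≠ none ∧ w' j ≠ none) → C (liftWord V w) = C (liftWord V w') := by
  induction m with
  | zero =>
    exact ⟨0, fun C _ => ⟨⟨fun i => i.elim0, fun e => e.elim0⟩, fun _ _ i => i.elim0⟩⟩
  | succ m ih =>
    obtain ⟨n₂, h₂⟩ := ih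
    obtain ⟨n₁, h₁⟩ := Subspace.exists_mono_in_high_dimension_fin α
      ((Fin n₂ → Option α) → κ) Unit
    refine ⟨n₁ + n₂, fun C hC => ?_⟩
    obtain ⟨l, D, hD⟩ := h₁ (fun q x => C (Fin.append (fun i => some (q i)) x))
    have hD' : ∀ p x, C (Fin.append (fun i => some (l (fun _ => p) i)) x) = D x :=
      fun p x => congrFun (hD (fun _ => p)) x
    by_cases hα : Nonempty α
    swap
    · -- without letters every word is constant
      have hn : ∀ {n : ℕ} (w w' : Fin n → Option α), w = w' := fun w w' => by
        funext i
        rcases w i with _ | a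
        · rcases w' i with _ | a
          · rfl
          · exact (hα ⟨a⟩).elim
        · exact (hα ⟨a⟩).elim
      obtain ⟨V, -⟩ := h₂ (fun x => C (Fin.append (fun _ => none) x))
        (fun w w' _ _ _ _ => by rw [hn w w'])
      obtain ⟨i₁, hi₁⟩ := l.proper ()
      refine ⟨⟨fun i => Fin.addCases (fun _ => Sum.inr 0)
        (fun j => (V.idxFun j).elim Sum.inl (fun e => Sum.inr e.succ)) i, fun e => ?_⟩,
        fun w w' _ _ _ _ => by rw [hn w w']⟩
      refine Fin.cases ⟨Fin.castAdd _ i₁, by simp⟩ (fun j => ?_) e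
      obtain ⟨i, hi⟩ := V.proper j
      exact ⟨Fin.natAdd _ i, by simp [hi]⟩
    obtain ⟨p₀⟩ := hα
    obtain ⟨V, hV⟩ := h₂ D (fun w w' i h h' hlt => by
      rw [← hD' p₀, ← hD' p₀]
      refine hC _ _ (Fin.natAdd n₁ i) (by simpa using h) (by simpa using h') (fun j => ?_)
      refine Fin.addCases (fun j _ => by simp) (fun j hj => ?_) j
      simpa using hlt j (by simpa using hj))
    let U : Subspace (Fin (m + 1)) α (Fin (n₁ + n₂)) :=
      { idxFun := Fin.append (fun i => (l.idxFun i).elim Sum.inl (fun _ => Sum.inr 0))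
          (fun j => (V.idxFun j).elim Sum.inl (fun e => Sum.inr e.succ))
        proper := by
          intro e
          refine Fin.cases ?_ (fun j => ?_) e
          · obtain ⟨i, hi⟩ := l.proper ()
            exact ⟨Fin.castAdd _ i, by simp [hi]⟩
          · obtain ⟨i, hi⟩ := V.proper j
            exact ⟨Fin.natAdd _ i, by simp [hi]⟩ }
    have hU : ∀ w : Fin (m + 1) → Option α, liftWord U w =
        Fin.append (liftWord l (fun _ => w 0)) (liftWord V (fun j => w j.succ)) := by
      intro w
      funext i
      refine Fin.addCases (fun i => ?_) (fun j => ?_) i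
      · simp only [liftWord, U, Fin.append_left]
        rcases l.idxFun i with a | e <;> simp
      · simp only [liftWord, U, Fin.append_right]
        rcases V.idxFun j with a | e <;> simp
    have hl : ∀ p : α, liftWord l (fun _ => some p) = fun i => some (l (fun _ => p) i) := by
      intro p
      funext i
      simp only [liftWord, Subspace.apply_def]
      rcases l.idxFun i with a | e <;> simp
    refine ⟨U, fun w w' i => ?_⟩
    rw [hU, hU]
    refine Fin.cases ?_ (fun i => ?_) i
    · intro h h' _
      rw [h, h']
      have hex : ∃ i, liftWord l (fun _ => none) i = none := by
        obtain ⟨i, hi⟩ := l.proper ()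
        exact ⟨i, by simp [liftWord, hi]⟩
      obtain ⟨i₁, hi₁, hmin⟩ : ∃ i₁, liftWord l (fun _ => none) i₁ = none ∧
          ∀ j < i₁, liftWord l (fun _ => none) j ≠ none :=
        ⟨_, Fin.find_spec hex, fun j hj => Fin.find_min hex hj⟩
      refine hC _ _ (Fin.castAdd n₂ i₁) (by simpa using hi₁) (by simpa using hi₁) (fun j => ?_)
      refine Fin.addCases (fun j hj => ?_) (fun j hj => ?_) j
      · simpa using hmin j (show (j : ℕ) < i₁ from hj)
      · rw [Fin.lt_def] at hj
        simp at hj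
        omega
    · intro h h' hlt
      obtain ⟨h1, h2⟩ := hlt 0 (Fin.succ_pos i)
      obtain ⟨p, hp⟩ := Option.ne_none_iff_exists'.1 h1
      obtain ⟨p', hp'⟩ := Option.ne_none_iff_exists'.1 h2
      rw [hp, hp', hl, hl, hD', hD']
      exact hV _ _ i h h' (fun j hj => hlt j.succ (Fin.succ_lt_succ_iff.2 hj))

/-- The **Graham–Rothschild theorem** for variable words with one variable. -/
lemma graham_rothschild (α : Type) [Finite α] [Nonempty α] (κ : Type) [Finite κ] (m : ℕ) :
    ∃ (ι : Type) (_ : Fintype ι), ∀ C : (ι → Option α) → κ,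
      ∃ (V : Subspace (Fin m) α ι) (c : κ),
        ∀ w : Fin m → Option α, (∃ i, w i = none) → C (liftWord V w) = c := by
  have := Fintype.ofFinite κ
  obtain ⟨M, hM⟩ : ∃ M, M = Fintype.card κ * m + 1 := ⟨_, rfl⟩
  obtain ⟨n, hn⟩ := exists_position_dependent α κ M
  obtain ⟨ι, _, hι⟩ := exists_prefix_dependent α n κ
  refine ⟨ι, inferInstance, fun C => ?_⟩
  obtain ⟨V₁, hV₁⟩ := hι C
  obtain ⟨V₂, hV₂⟩ := hn (fun w => C (liftWord V₁ w)) hV₁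
  obtain ⟨p⟩ := ‹Nonempty α›
  let col : Fin M → κ := fun i =>
    C (liftWord V₁ (liftWord V₂ (fun j => if j < i then some p else none)))
  obtain ⟨c, hc⟩ : ∃ c, m < (Finset.univ.filter (fun i => col i = c)).card := by
    by_contra! hcon
    have h1 := Finset.card_eq_sum_card_fiberwise (f := col) (s := Finset.univ)
      (t := Finset.univ) (fun _ _ => Finset.mem_coe.2 (Finset.mem_univ _))
    have h2 := Finset.sum_le_card_nsmul Finset.univ _ m (fun c _ => hcon c)
    rw [← h1] at h2
    simp [hM] at h2
  let emb : Fin m ↪o Fin M :=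
    (Fin.castLEOrderEmb hc.le).trans (Finset.orderEmbOfFin _ rfl)
  have hemb : ∀ i, col (emb i) = c := fun i => by
    have := Finset.orderEmbOfFin_mem (Finset.univ.filter (fun i => col i = c)) rfl
      (Fin.castLE hc.le i)
    exact (Finset.mem_filter.1 this).2
  let V₃ : Subspace (Fin m) α (Fin M) :=
    { idxFun := Function.extend emb Sum.inr (fun _ => Sum.inl p)
      proper := fun e => ⟨emb e, emb.injective.extend_apply _ _ _⟩ }
  have hV₃ : ∀ w j, liftWord V₃ w (emb j) = w j := fun w j => by
    simp [liftWord, V₃, emb.injective.extend_apply]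
  have hV₃' : ∀ w i, liftWord V₃ w i = none → ∃ j, emb j = i := fun w i h => by
    by_contra hcon
    simp [liftWord, V₃, Function.extend_apply' _ _ _ hcon] at h
  refine ⟨compSubspace V₁ (compSubspace V₂ V₃), c, fun w hw => ?_⟩
  obtain ⟨i₁, hi₁, hmin⟩ : ∃ i₁, w i₁ = none ∧ ∀ j < i₁, w j ≠ none :=
    ⟨_, Fin.find_spec hw, fun j hj => Fin.find_min hw hj⟩
  rw [liftWord_compSubspace, liftWord_compSubspace, ← hemb i₁]
  change _ = C (liftWord V₁ (liftWord V₂ (fun j => if j < emb i₁ then some p else none)))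
  refine hV₂ (liftWord V₃ w) (fun j => if j < emb i₁ then some p else none) (emb i₁)
    (by rw [hV₃, hi₁]) (by simp) (fun j hj => ⟨fun hcon => ?_, by simp [hj]⟩)
  obtain ⟨j', rfl⟩ := hV₃' w j hcon
  rw [hV₃] at hcon
  exact hmin j' (emb.lt_iff_lt.1 hj) hcon

/-- The uniform density of a subset of a finite type. -/
noncomputable def dens {X : Type*} [Fintype X] (S : Set X) : ℝ := 𝔼 x, S.indicator 1 x

section Density

variable {X Z : Type*} [Fintype X] [Fintype Z]

lemma dens_nonneg (S : Set X) : 0 ≤ dens S :=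
  expect_nonneg fun x _ => Set.indicator_nonneg (fun _ _ => zero_le_one) x

lemma dens_mono {S T : Set X} (h : S ⊆ T) : dens S ≤ dens T :=
  expect_le_expect fun x _ => Set.indicator_le_indicator_of_subset h (fun _ => zero_le_one) x

lemma dens_le_one [Nonempty X] (S : Set X) : dens S ≤ 1 := by
  refine expect_le univ_nonempty fun x _ => ?_
  exact Set.indicator_le_self' (fun _ _ => zero_le_one) x

lemma nonempty_of_dens_pos {S : Set X} (h : 0 < dens S) : S.Nonempty := by
  by_contra hcon
  rw [Set.not_nonempty_iff_eq_empty] at hcon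
  simp [dens, hcon] at h

lemma dens_eq_card_div (S : Set X) : dens S = (univ.filter (· ∈ S)).card / Fintype.card X := by
  rw [dens, Fintype.expect_eq_sum_div_card]
  congr 1
  rw [card_filter]
  push_cast
  exact sum_congr rfl fun x _ => by simp [Set.indicator_apply]

lemma dens_preimage_equiv {Y : Type*} [Fintype Y] (e : X ≃ Y) (S : Set Y) :
    dens (e ⁻¹' S) = dens S :=
  Fintype.expect_equiv e _ _ fun _ => rfl

/-- If the sets `A z` have average density at least `δ`, and each of them of density at least
`δ / 2` contains one of finitely many configurations, then one configuration lies in many of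
the `A z`. -/
lemma exists_common_config [Nonempty X] [Nonempty Z] {C : Type*} [Fintype C] (S : C → Set X)
    (A : Z → Set X) {δ : ℝ} (hδ : 0 < δ) (hA : δ ≤ 𝔼 z, dens (A z))
    (h : ∀ z, δ / 2 ≤ dens (A z) → ∃ c, S c ⊆ A z) :
    ∃ c, δ / 2 / Fintype.card C ≤ dens {z | S c ⊆ A z} := by
  have h1 : ∀ z, dens (A z) ≤ δ / 2 + ∑ c, ({z | S c ⊆ A z} : Set Z).indicator (1 : Z → ℝ) z := by
    intro z
    have hn : ∀ c, 0 ≤ ({z | S c ⊆ A z} : Set Z).indicator (1 : Z → ℝ) z := fun c =>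
      Set.indicator_nonneg (fun _ _ => zero_le_one) z
    rcases lt_or_ge (dens (A z)) (δ / 2) with hz | hz
    · linarith [sum_nonneg fun c (_ : c ∈ univ) => hn c]
    · obtain ⟨c, hc⟩ := h z hz
      have := single_le_sum (fun c _ => hn c) (mem_univ c)
      have h2 : ({z | S c ⊆ A z} : Set Z).indicator (1 : Z → ℝ) z = 1 := by simp [hc]
      linarith [dens_le_one (A z)]
  have h2 : δ ≤ δ / 2 + ∑ c, dens {z | S c ⊆ A z} := by
    refine hA.trans ((expect_le_expect fun z _ => h1 z).trans (le_of_eq ?_))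
    rw [expect_add_distrib, expect_sum_comm, Fintype.expect_const]
    rfl
  by_contra! hcon
  rcases isEmpty_or_nonempty C with hC | hC
  · simp at h2
    linarith
  · have h3 := sum_lt_sum_of_nonempty (univ_nonempty (α := C)) fun c _ => hcon c
    have h4 : (Fintype.card C : ℝ) ≠ 0 := by simp
    rw [sum_const, card_univ, nsmul_eq_mul, mul_div_cancel₀ _ h4] at h3
    linarith

end Density

section Words

variable {α β ι η κ : Type}

lemma expect_sumElim [Fintype ι] [Fintype η] [Fintype κ] [Fintype β]
    (e : ι ≃ η ⊕ κ) (f : (ι → β) → ℝ) :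
    𝔼 x, f x = 𝔼 z : κ → β, 𝔼 y : η → β, f (Sum.elim y z ∘ e) := by
  rw [← expect_product']
  refine Fintype.expect_equiv ((e.arrowCongr (Equiv.refl β)).trans
    ((Equiv.sumArrowEquivProdArrow η κ β).trans (Equiv.prodComm _ _))) _ _ fun x => ?_
  congr 1
  funext i
  obtain ⟨s, rfl⟩ := e.symm.surjective i
  rcases s with j | j <;> simp [Equiv.sumArrowEquivProdArrow]

lemma dens_sumElim [Fintype ι] [Fintype η] [Fintype κ] [Fintype β]
    (e : ι ≃ η ⊕ κ) (A : Set (ι → β)) :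
    dens A = 𝔼 z : κ → β, dens {y : η → β | Sum.elim y z ∘ e ∈ A} :=
  expect_sumElim e _

lemma exists_fiber [Fintype ι] [Fintype η] [Fintype κ] [Fintype β] [Nonempty β]
    (e : ι ≃ η ⊕ κ) (A : Set (ι → β)) {δ : ℝ} (h : δ ≤ dens A) :
    ∃ z : κ → β, δ ≤ dens {y : η → β | Sum.elim y z ∘ e ∈ A} := by
  rw [dens_sumElim e] at h
  obtain ⟨z, -, hz⟩ := exists_le_of_le_expect univ_nonempty h
  exact ⟨z, hz⟩

lemma exists_equiv_sum [Fintype ι] [Fintype η] (h : Fintype.card η ≤ Fintype.card ι) :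
    ∃ (κ : Type) (_ : Fintype κ), Fintype.card κ + Fintype.card η = Fintype.card ι ∧
      Nonempty (ι ≃ η ⊕ κ) := by
  refine ⟨Fin (Fintype.card ι - Fintype.card η), inferInstance, by simp; omega,
    ⟨Fintype.equivOfCardEq ?_⟩⟩
  simp
  omega

/-- Fill the variables of a word over `α` with the letter `a`. -/
def fill (a : α) (y : ι → Option α) : ι → α := fun i => (y i).getD a

/-- The set `A` contains a combinatorial line. -/
def HasLine (A : Set (ι → α)) : Prop :=
  ∃ y : ι → Option α, (∃ i, y i = none) ∧ ∀ a, fill a y ∈ A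

/-- The density Hales–Jewett property at density `δ`. -/
def DHJAt (α : Type) [Fintype α] (δ : ℝ) : Prop :=
  ∃ (ι : Type) (_ : Fintype ι), ∀ A : Set (ι → α), δ ≤ dens A → HasLine A

/-- Extend a subspace by constant letters. -/
def extSubspace {d : Type} (e : ι ≃ η ⊕ κ) (z : κ → α) (V : Subspace d α η) :
    Subspace d α ι where
  idxFun i := Sum.elim V.idxFun (fun j => Sum.inl (z j)) (e i)
  proper s := by
    obtain ⟨j, hj⟩ := V.proper s
    exact ⟨e.symm (Sum.inl j), by simp [hj]⟩

lemma extSubspace_apply {d : Type} (e : ι ≃ η ⊕ κ) (z : κ → α) (V : Subspace d α η)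
    (x : d → α) : extSubspace e z V x = Sum.elim (V x) z ∘ e := by
  funext i
  simp only [extSubspace, Subspace.apply_def, Function.comp]
  rcases e i with j | j <;> simp [Subspace.apply_def]

lemma fill_extend (e : ι ≃ η ⊕ κ) (z : κ → α) (y : η → Option α) (a : α) :
    fill a (Sum.elim y (fun j => some (z j)) ∘ e) = Sum.elim (fill a y) z ∘ e := by
  funext i
  simp only [fill, Function.comp]
  rcases e i with j | j <;> simp [fill]

lemma HasLine.of_fiber (e : ι ≃ η ⊕ κ) (z : κ → α) {A : Set (ι → α)}
    (h : HasLine {y : η → α | Sum.elim y z ∘ e ∈ A}) : HasLine A := by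
  obtain ⟨y, ⟨i, hi⟩, hy⟩ := h
  refine ⟨Sum.elim y (fun j => some (z j)) ∘ e, ⟨e.symm (Sum.inl i), by simp [hi]⟩, fun a => ?_⟩
  rw [fill_extend]
  exact hy a

lemma fill_liftWord (V : Subspace η α ι) (y : η → Option α) (a : α) :
    fill a (liftWord V y) = V (fill a y) := by
  funext i
  simp only [fill, liftWord, Subspace.apply_def]
  rcases V.idxFun i with j | j <;> simp [fill]

lemma HasLine.of_subspace (V : Subspace η α ι) {A : Set (ι → α)}
    (h : HasLine {y : η → α | V y ∈ A}) : HasLine A := by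
  obtain ⟨y, ⟨i, hi⟩, hy⟩ := h
  refine ⟨liftWord V y, ?_, fun a => by rw [fill_liftWord]; exact hy a⟩
  obtain ⟨j, hj⟩ := V.proper i
  exact ⟨j, by simp [liftWord, hj, hi]⟩

lemma DHJAt.exists_dim [Fintype α] [Nonempty α] {δ : ℝ} (h : DHJAt α δ) :
    ∃ n : ℕ, ∀ (ι : Type) [Fintype ι], n ≤ Fintype.card ι → ∀ A : Set (ι → α), δ ≤ dens A →
      HasLine A := by
  obtain ⟨η, _, hn⟩ := h
  refine ⟨Fintype.card η, fun ι _ hι A hA => ?_⟩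
  obtain ⟨κ, _, -, ⟨e⟩⟩ := exists_equiv_sum hι
  obtain ⟨z, hz⟩ := exists_fiber e A hA
  exact HasLine.of_fiber e z (hn _ hz)

/-- Prepend a line to a subspace. -/
def consSubspace {d : ℕ} (e : ι ≃ η ⊕ κ) (c : η → Option α) (hc : ∃ i, c i = none)
    (V : Subspace (Fin d) α κ) : Subspace (Fin (d + 1)) α ι where
  idxFun i := Sum.elim (fun j => (c j).elim (Sum.inr 0) Sum.inl)
    (fun j => (V.idxFun j).elim Sum.inl (fun s => Sum.inr s.succ)) (e i)
  proper s := by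
    refine Fin.cases ?_ (fun s => ?_) s
    · obtain ⟨j, hj⟩ := hc
      exact ⟨e.symm (Sum.inl j), by simp [hj]⟩
    · obtain ⟨j, hj⟩ := V.proper s
      exact ⟨e.symm (Sum.inr j), by simp [hj]⟩

lemma consSubspace_apply {d : ℕ} (e : ι ≃ η ⊕ κ) (c : η → Option α) (hc : ∃ i, c i = none)
    (V : Subspace (Fin d) α κ) (x : Fin (d + 1) → α) :
    consSubspace e c hc V x = Sum.elim (fill (x 0) c) (V (fun s => x s.succ)) ∘ e := by
  funext i
  simp only [consSubspace, Subspace.apply_def, Function.comp]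
  rcases e i with j | j
  · rcases h : c j with _ | a <;> simp [fill, h]
  · rcases h : V.idxFun j with a | s <;> simp [Subspace.apply_def, h]

/-- The multidimensional density Hales–Jewett theorem follows from the one-dimensional one. -/
lemma exists_subspace_of_dhj [Fintype α] [Nonempty α] (h : ∀ δ > 0, DHJAt α δ) (d : ℕ) :
    ∀ δ > 0, ∃ n : ℕ, ∀ (ι : Type) [Fintype ι], n ≤ Fintype.card ι →
      ∀ A : Set (ι → α), δ ≤ dens A → ∃ V : Subspace (Fin d) α ι, ∀ x, V x ∈ A := by
  induction d with
  | zero =>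
    intro δ hδ
    refine ⟨0, fun ι _ _ A hA => ?_⟩
    obtain ⟨x, hx⟩ := nonempty_of_dens_pos (hδ.trans_le hA)
    exact ⟨⟨fun i => Sum.inl (x i), fun e => e.elim0⟩, fun _ => hx⟩
  | succ d ih =>
    intro δ hδ
    obtain ⟨η, _, hn₁⟩ := h (δ / 2) (half_pos hδ)
    let C := {c : η → Option α // ∃ i, c i = none}
    rcases isEmpty_or_nonempty C with hC | hC
    · refine ⟨Fintype.card η, fun ι _ hι A hA => ?_⟩
      obtain ⟨κ, _, -, ⟨e⟩⟩ := exists_equiv_sum hι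
      obtain ⟨z, hz⟩ := exists_fiber e A hA
      obtain ⟨y, hy, -⟩ := hn₁ _ ((half_le_self hδ.le).trans hz)
      exact (hC.false ⟨y, hy⟩).elim
    have hpos : 0 < δ / 2 / Fintype.card C := by
      have : 0 < Fintype.card C := Fintype.card_pos
      positivity
    obtain ⟨n₂, hn₂⟩ := ih _ hpos
    refine ⟨Fintype.card η + n₂, fun ι _ hι A hA => ?_⟩
    obtain ⟨κ, _, hm, ⟨e⟩⟩ := exists_equiv_sum (η := η) (le_trans (by omega) hι)
    rw [dens_sumElim e] at hA
    obtain ⟨⟨c, hc⟩, hcd⟩ := exists_common_config (C := C) (fun c => Set.range fun a => fill a c.1)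
      (fun z : κ → α => {y : η → α | Sum.elim y z ∘ e ∈ A}) hδ hA (fun z hz => by
        obtain ⟨y, hy, hyA⟩ := hn₁ _ hz
        exact ⟨⟨y, hy⟩, Set.range_subset_iff.2 hyA⟩)
    obtain ⟨V, hV⟩ := hn₂ κ (by omega) _ hcd
    refine ⟨consSubspace e c hc V, fun x => ?_⟩
    rw [consSubspace_apply]
    exact hV _ ⟨x 0, rfl⟩

/-- Resampling the letters of a word. -/
def mixWord (s : ι → Option α) (u : ι → α) : ι → Option α :=
  fun i => (s i).map fun _ => u i

lemma expect_mixWord [Fintype ι] [Fintype α] [Nonempty α] (g : (ι → Option α) → ℝ) :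
    𝔼 s : ι → Option α, 𝔼 u : ι → α, g (mixWord s u) = 𝔼 x, g x := by
  have h : 𝔼 x, g x = 𝔼 x : ι → Option α, 𝔼 _u : ι → α, g x :=
    expect_congr rfl fun x _ => (Fintype.expect_const _).symm
  rw [h, ← expect_product', ← expect_product']
  let φ : (ι → Option α) × (ι → α) → (ι → Option α) × (ι → α) :=
    fun p => (mixWord p.1 p.2, fun i => (p.1 i).getD (p.2 i))
  have hφ : Function.Involutive φ := by
    rintro ⟨s, u⟩
    ext i : 2
    · rcases h : s i with _ | a <;> simp [φ, mixWord, h]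
    · rcases h : s i with _ | a <;> simp [φ, mixWord, h]
  exact Fintype.expect_equiv hφ.toPerm _ _ fun p => rfl

lemma dens_few_letters_le [Fintype ι] [Fintype α] [Nonempty α] (m : ℕ) :
    dens {s : ι → Option α | (univ.filter fun i => s i ≠ none).card < m} ≤
      2 ^ m * (3 / 4 : ℝ) ^ Fintype.card ι := by
  have h1 : ∀ s : ι → Option α,
      ({s | (univ.filter fun i => s i ≠ none).card < m} : Set (ι → Option α)).indicator
        (1 : (ι → Option α) → ℝ) s ≤ 2 ^ m * ∏ i, (if s i = none then (1 : ℝ) else 1 / 2) := by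
    intro s
    have h2 : ∏ i, (if s i = none then (1 : ℝ) else 1 / 2) =
        (1 / 2) ^ (univ.filter fun i => s i ≠ none).card := by
      rw [← prod_const, prod_filter]
      exact prod_congr rfl fun i _ => by by_cases h : s i = none <;> simp [h]
    rw [h2]
    refine Set.indicator_apply_le' (fun h => ?_) fun _ => by positivity
    have h3 : (1 / 2 : ℝ) ^ m ≤ (1 / 2) ^ (univ.filter fun i => s i ≠ none).card :=
      pow_le_pow_of_le_one (by norm_num) (by norm_num) (le_of_lt h)
    calc (1 : ℝ) = 2 ^ m * (1 / 2) ^ m := by rw [← mul_pow]; norm_num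
      _ ≤ _ := by gcongr
  refine (expect_le_expect fun s _ => h1 s).trans ?_
  rw [← mul_expect, Fintype.expect_eq_sum_div_card,
    ← Fintype.prod_sum (fun (_ : ι) (o : Option α) => if o = none then (1 : ℝ) else 1 / 2)]
  gcongr
  simp only [Fintype.sum_option, prod_const, card_univ, Fintype.card_fun, Fintype.card_option]
  push_cast
  rw [← div_pow]
  have hk : (1 : ℝ) ≤ Fintype.card α := by exact_mod_cast Fintype.card_pos
  refine pow_le_pow_left₀ (by positivity) ?_ _
  rw [div_le_iff₀ (by positivity)]
  simp only [sum_const, card_univ, nsmul_eq_mul]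
  linarith

/-- A version of the multidimensional density Hales–Jewett theorem in which the set is dense with
respect to the measure giving double weight to the letter `a`. -/
lemma exists_subspace_of_dense_fill [Fintype α] [Nonempty α] (h : ∀ δ > 0, DHJAt α δ) (d : ℕ)
    {ε : ℝ} (hε : 0 < ε) : ∃ n : ℕ, ∀ (ι : Type) [Fintype ι], n ≤ Fintype.card ι →
      ∀ (a : α) (E : Set (ι → α)), ε ≤ dens {y : ι → Option α | fill a y ∈ E} →
        ∃ V : Subspace (Fin d) α ι, ∀ x, V x ∈ E := by
  obtain ⟨m, hm⟩ := exists_subspace_of_dhj h d (ε / 2) (half_pos hε)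
  obtain ⟨n, hn⟩ := exists_pow_lt_of_lt_one (show 0 < ε / 2 / 2 ^ m by positivity)
    (show (3 / 4 : ℝ) < 1 by norm_num)
  refine ⟨n, fun ι _ hι a E hE => ?_⟩
  set bad : Set (ι → Option α) := {s | (univ.filter fun i => s i ≠ none).card < m}
  have hbad : dens bad < ε / 2 := by
    refine (dens_few_letters_le m).trans_lt ?_
    have := pow_le_pow_of_le_one (show (0 : ℝ) ≤ 3 / 4 by norm_num) (by norm_num) hι
    rw [← lt_div_iff₀' (by positivity)]
    exact this.trans_lt hn
  have hE' : dens {y : ι → Option α | fill a y ∈ E} =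
      𝔼 s : ι → Option α, dens {u : ι → α | fill a (mixWord s u) ∈ E} := by
    rw [dens, ← expect_mixWord]
    rfl
  rw [hE'] at hE
  obtain ⟨s, hs, hsE⟩ : ∃ s, s ∉ bad ∧ ε / 2 ≤ dens {u : ι → α | fill a (mixWord s u) ∈ E} := by
    by_contra! hcon
    have h1 : ∀ s, dens {u : ι → α | fill a (mixWord s u) ∈ E} ≤
        bad.indicator 1 s + ε / 2 := by
      intro s
      by_cases hs : s ∈ bad
      · simp only [hs, Set.indicator_of_mem, Pi.one_apply]
        linarith [dens_le_one {u : ι → α | fill a (mixWord s u) ∈ E}]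
      · simpa [hs] using (hcon s hs).le
    have h2 := expect_le_expect fun s (_ : s ∈ univ) => h1 s
    rw [expect_add_distrib, Fintype.expect_const] at h2
    change _ ≤ dens bad + _ at h2
    linarith
  let e : ι ≃ {i // s i ≠ none} ⊕ {i // ¬ s i ≠ none} := (Equiv.sumCompl _).symm
  obtain ⟨z, hz⟩ := exists_fiber e _ hsE
  obtain ⟨V, hV⟩ := hm {i // s i ≠ none} (by
    rw [Fintype.card_subtype]
    simpa [bad] using hs) _ hz
  refine ⟨extSubspace e (fun _ => a) V, fun x => ?_⟩
  have : extSubspace e (fun _ => a) V x = fill a (mixWord s (Sum.elim (V x) z ∘ e)) := by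
    rw [extSubspace_apply]
    funext i
    simp only [fill, mixWord, Function.comp, e]
    by_cases hi : s i ≠ none
    · rw [Equiv.sumCompl_symm_apply_of_pos (p := fun i => s i ≠ none) hi]
      obtain ⟨b, hb⟩ := Option.ne_none_iff_exists'.1 hi
      simp [hb]
    · rw [Equiv.sumCompl_symm_apply_of_neg (p := fun i => s i ≠ none) hi]
      simp [not_not.1 hi]
  rw [this]
  exact hV x

end Words

/-- A subspace over `α`, regarded as a subspace over `Option α`. -/
def optSubspace {η α ι : Type} (V : Subspace η α ι) : Subspace η (Option α) ι where
  idxFun i := (V.idxFun i).map some id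
  proper e := by
    obtain ⟨i, hi⟩ := V.proper e
    exact ⟨i, by simp [hi]⟩

lemma optSubspace_apply {η α ι : Type} (V : Subspace η α ι) (x : η → Option α) :
    optSubspace V x = liftWord V x := by
  funext i
  simp only [optSubspace, Subspace.apply_def, liftWord]
  rcases V.idxFun i with a | e <;> simp

lemma liftWord_injective {η α ι : Type} (V : Subspace η α ι) :
    Function.Injective (liftWord V) := by
  intro w w' h
  funext e
  obtain ⟨i, hi⟩ := V.proper e
  simpa [liftWord, hi] using congrFun h i

lemma fill_sumElim {α ι η κ : Type} (e : ι ≃ η ⊕ κ) (y : η → Option α) (z : κ → Option α)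
    (a : α) : fill a (Sum.elim y z ∘ e) = Sum.elim (fill a y) (fill a z) ∘ e := by
  funext i
  simp only [fill, Function.comp]
  rcases e i with j | j <;> simp [fill]

lemma sum_indicator_range {X Y : Type*} [Fintype X] [Fintype Y] {g : Y → X}
    (hg : Function.Injective g) (F : X → ℝ) :
    ∑ x, (Set.range g).indicator F x = ∑ y, F (g y) := by
  exact (Fintype.sum_of_injective g hg _ _ (fun x hx => Set.indicator_of_notMem hx _)
    fun y => by simp).symm

/-- A bounded function with nonpositive sums over all `d`-dimensional subspaces has small
correlation with the sets that do not distinguish the new letter from `a`. -/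
lemma exists_dim_insensitive {α : Type} [Fintype α] [Nonempty α] (h : ∀ δ > 0, DHJAt α δ) (d : ℕ)
    {ε₀ : ℝ} (hε₀ : 0 < ε₀) : ∃ n : ℕ, ∀ (ι : Type) [Fintype ι], n ≤ Fintype.card ι →
      ∀ (a : α) (E : Set (ι → α)) (f : (ι → Option α) → ℝ), (∀ y, f y ≤ 1) →
        (∀ W : Subspace (Fin d) (Option α) ι, ∑ x, f (W x) ≤ 0) →
        𝔼 y, {y : ι → Option α | fill a y ∈ E}.indicator f y ≤ ε₀ := by
  obtain ⟨ε, hε, hε₂⟩ : ∃ ε, 0 < ε ∧ ε + ε = ε₀ := ⟨ε₀ / 2, half_pos hε₀, add_halves ε₀⟩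
  obtain ⟨n₀, hn₀⟩ := exists_subspace_of_dense_fill h d (half_pos hε)
  obtain ⟨η, _, hη⟩ : ∃ (η : Type) (_ : Fintype η), Fintype.card η = n₀ :=
    ⟨Fin n₀, inferInstance, by simp⟩
  let C := Subspace (Fin d) α η
  have : Finite C := Finite.of_injective (Subspace.idxFun (η := Fin d) (α := α) (ι := η))
    fun _ _ h => Subspace.ext h
  have := Fintype.ofFinite C
  let N : ℝ := Fintype.card (η → Option α)
  have hN : 0 < N := Nat.cast_pos.2 Fintype.card_pos
  let θ : ℝ := min 1 (1 / N * (ε / 2 / (Fintype.card C + 1)))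
  have hθ : 0 < θ := lt_min one_pos (by positivity)
  have hθ1 : θ ≤ 1 := min_le_left _ _
  have claim : ∀ T : ℕ, ∃ n : ℕ, ∀ (ι : Type) [Fintype ι], n ≤ Fintype.card ι →
      ∀ (a : α) (E : Set (ι → α)) (f : (ι → Option α) → ℝ), (∀ y, f y ≤ 1) →
        (∀ W : Subspace (Fin d) (Option α) ι, ∑ x, f (W x) ≤ 0) →
        𝔼 y, {y : ι → Option α | fill a y ∈ E}.indicator f y ≤
          ε + (1 - θ) ^ T * dens {y : ι → Option α | fill a y ∈ E} := by
    intro T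
    have triv : ∀ (ι : Type) [Fintype ι] (a : α) (E : Set (ι → α)) (f : (ι → Option α) → ℝ),
        (∀ y, f y ≤ 1) → 𝔼 y, {y : ι → Option α | fill a y ∈ E}.indicator f y ≤
          dens {y : ι → Option α | fill a y ∈ E} := fun ι _ a E f hf =>
      expect_le_expect fun y _ => Set.indicator_le_indicator (hf y)
    induction T with
    | zero =>
      refine ⟨0, fun ι _ _ a E f hf _ => (triv ι a E f hf).trans ?_⟩
      linarith
    | succ T ih =>
      obtain ⟨n, hn⟩ := ih
      refine ⟨n + n₀, fun ι _ hι a E f hf hW => ?_⟩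
      set D : Set (ι → Option α) := {y | fill a y ∈ E} with hD
      have hpow : 0 ≤ (1 - θ) ^ T := pow_nonneg (by linarith) _
      rcases lt_or_ge (dens D) ε with hρ | hρ
      · have := mul_nonneg (pow_nonneg (sub_nonneg.2 hθ1) (T + 1)) (dens_nonneg D)
        linarith [triv ι a E f hf]
      obtain ⟨κ, _, hκ, ⟨e⟩⟩ := exists_equiv_sum (η := η) (ι := ι) (by omega)
      have hDz := hρ
      rw [dens_sumElim e] at hDz
      obtain ⟨c, hc⟩ := exists_common_config (C := C) (fun c => Set.range (liftWord c))
        (fun z : κ → Option α => {y : η → Option α | Sum.elim y z ∘ e ∈ D}) hε hDz (fun z hz => by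
          obtain ⟨V, hV⟩ := hn₀ η hη.ge a {u | Sum.elim u (fill a z) ∘ e ∈ E}
            (by simpa only [hD, Set.mem_ofPred_eq, fill_sumElim] using hz)
          refine ⟨V, Set.range_subset_iff.2 fun x => ?_⟩
          simp only [hD, Set.mem_ofPred_eq, fill_sumElim, fill_liftWord]
          exact hV _)
      set R : Set (η → Option α) := Set.range (liftWord c)
      set Z' : Set (κ → α) := {v | ∀ y ∈ R, Sum.elim (fill a y) v ∘ e ∈ E}
      have hZ : {z : κ → Option α | R ⊆ {y | Sum.elim y z ∘ e ∈ D}} = {z | fill a z ∈ Z'} := by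
        ext z
        simp only [Set.mem_ofPred_eq, Set.subset_def, hD, fill_sumElim, Z']
      rw [hZ] at hc
      set Z : Set (κ → Option α) := {z | fill a z ∈ Z'} with hZdef
      have hRZ : ∀ y ∈ R, ∀ z ∈ Z, Sum.elim y z ∘ e ∈ D := fun y hy z hz => by
        simp only [hD, Set.mem_ofPred_eq, fill_sumElim]
        exact hz y hy
      let E' : (η → Option α) → Set (κ → α) := fun y =>
        {v | Sum.elim (fill a y) v ∘ e ∈ E ∧ ¬ (y ∈ R ∧ v ∈ Z')}
      have hE' : ∀ y z, fill a z ∈ E' y ↔ Sum.elim y z ∘ e ∈ D ∧ ¬ (y ∈ R ∧ z ∈ Z) :=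
        fun y z => by simp only [E', hD, hZdef, Set.mem_ofPred_eq, fill_sumElim]
      have hsplit : ∀ (g : (ι → Option α) → ℝ) y z, D.indicator g (Sum.elim y z ∘ e) =
          {z | fill a z ∈ E' y}.indicator (fun z => g (Sum.elim y z ∘ e)) z +
            R.indicator (fun y => Z.indicator (fun z => g (Sum.elim y z ∘ e)) z) y := by
        intro g y z
        by_cases hy : y ∈ R
        · by_cases hz : z ∈ Z
          · simp [hy, hz, hE', hRZ y hy z hz]
          · by_cases h3 : Sum.elim y z ∘ e ∈ D <;> simp [hy, hz, hE', h3]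
        · by_cases h3 : Sum.elim y z ∘ e ∈ D <;> simp [hy, hE', h3]
      have hfib : ∀ y, 𝔼 z, {z | fill a z ∈ E' y}.indicator (fun z => f (Sum.elim y z ∘ e)) z ≤
          ε + (1 - θ) ^ T * dens {z | fill a z ∈ E' y} := fun y => by
        refine hn κ (by omega) a (E' y) _ (fun z => hf _) fun W => ?_
        have := hW (extSubspace (e.trans (Equiv.sumComm _ _)) y W)
        refine le_trans (le_of_eq (sum_congr rfl fun x _ => ?_)) this
        rw [extSubspace_apply]
        congr 1
        funext i
        simp only [Function.comp, Equiv.trans_apply]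
        rcases e i with j | j <;> simp
      have hRsum : ∀ z, 𝔼 y, R.indicator
          (fun y => Z.indicator (fun z => f (Sum.elim y z ∘ e)) z) y ≤ 0 := fun z => by
        rw [Fintype.expect_eq_sum_div_card, sum_indicator_range (liftWord_injective c)]
        refine div_nonpos_of_nonpos_of_nonneg ?_ (Nat.cast_nonneg _)
        by_cases hz : z ∈ Z
        · simp only [hz, Set.indicator_of_mem]
          refine le_trans (le_of_eq (sum_congr rfl fun x _ => ?_))
            (hW (extSubspace e z (optSubspace c)))
          rw [extSubspace_apply, optSubspace_apply]
        · simp [hz]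
      have hmain : 𝔼 y, D.indicator f y ≤
          ε + (1 - θ) ^ T * 𝔼 y, dens {z | fill a z ∈ E' y} := by
        rw [expect_sumElim e]
        simp only [hsplit f, expect_add_distrib]
        have h1 := expect_le_expect fun z (_ : z ∈ univ) => hRsum z
        have h2 := expect_le_expect fun y (_ : y ∈ univ) => hfib y
        rw [expect_add_distrib, Fintype.expect_const, ← mul_expect] at h2
        rw [expect_comm]
        simp only [expect_const_zero] at h1
        linarith
      have hdens : 𝔼 y, dens {z | fill a z ∈ E' y} ≤ dens D - θ := by
        have h1 : dens D = 𝔼 y, dens {z | fill a z ∈ E' y} + dens R * dens Z := by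
          rw [dens, expect_sumElim e]
          simp only [hsplit, expect_add_distrib]
          rw [expect_comm]
          congr 1
          rw [expect_comm, dens, dens, expect_mul_expect]
          refine expect_congr rfl fun y _ => expect_congr rfl fun z _ => ?_
          by_cases hy : y ∈ R <;> by_cases hz : z ∈ Z <;> simp [hy, hz]
        have h2 : 1 / N ≤ dens R := by
          rw [dens, Fintype.expect_eq_sum_div_card, sum_indicator_range (liftWord_injective c)]
          refine div_le_div_of_nonneg_right ?_ hN.le
          have : 0 < Fintype.card (Fin d → Option α) := Fintype.card_pos
          simp only [Pi.one_apply, sum_const, card_univ, nsmul_eq_mul, mul_one]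
          exact_mod_cast this
        have h3 : ε / 2 / (Fintype.card C + 1) ≤ dens Z := by
          refine le_trans ?_ hc
          have : 0 < Fintype.card C := Fintype.card_pos_iff.2 ⟨c⟩
          gcongr
          linarith
        have h4 : θ ≤ dens R * dens Z := (min_le_right _ _).trans
          (mul_le_mul h2 h3 (by positivity) (dens_nonneg _))
        linarith
      have h5 : dens D ≤ 1 := dens_le_one D
      calc _ ≤ ε + (1 - θ) ^ T * (dens D - θ) :=
            hmain.trans (by gcongr)
        _ ≤ ε + (1 - θ) ^ T * ((1 - θ) * dens D) := by
            gcongr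
            nlinarith
        _ = _ := by ring
  obtain ⟨T, hT⟩ := exists_pow_lt_of_lt_one hε (show 1 - θ < 1 by linarith)
  obtain ⟨n, hn⟩ := claim T
  refine ⟨n, fun ι _ hι a E f hf hW => (hn ι hι a E f hf hW).trans ?_⟩
  have := mul_le_mul_of_nonneg_left (dens_le_one {y : ι → Option α | fill a y ∈ E})
    (pow_nonneg (sub_nonneg.2 hθ1) T)
  linarith

/-- The words whose `a`-filling lies in `E a` for every `a ∈ S`. -/
def cylinder {α ι : Type} (S : Finset α) (E : α → Set (ι → α)) : Set (ι → Option α) :=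
  {y | ∀ a ∈ S, fill a y ∈ E a}

lemma expect_nonpos_of_subspaces {α : Type} [Fintype α] (d : ℕ) (ι : Type) [Fintype ι]
    (hι : d ≤ Fintype.card ι) (f : (ι → Option α) → ℝ)
    (hW : ∀ W : Subspace (Fin d) (Option α) ι, ∑ x, f (W x) ≤ 0) : 𝔼 y, f y ≤ 0 := by
  obtain ⟨η, _, hη⟩ : ∃ (η : Type) (_ : Fintype η), Fintype.card η = d :=
    ⟨Fin d, inferInstance, by simp⟩
  obtain ⟨κ, _, hκ, ⟨e⟩⟩ := exists_equiv_sum (η := η) (ι := ι) (by omega)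
  rw [expect_sumElim e]
  refine expect_le univ_nonempty fun z _ => ?_
  rw [Fintype.expect_eq_sum_div_card]
  refine div_nonpos_of_nonpos_of_nonneg ?_ (Nat.cast_nonneg _)
  have g : η ≃ Fin d := Fintype.equivFinOfCardEq hη
  refine le_trans (le_of_eq ?_)
    (hW (extSubspace e z ⟨fun i => Sum.inr (g i), fun s => ⟨g.symm s, by simp⟩⟩))
  refine Fintype.sum_equiv (g.arrowCongr (Equiv.refl _)) _ _ fun y => ?_
  rw [extSubspace_apply]
  congr 3
  funext i
  simp [Subspace.apply_def]

lemma exists_dim_cylinder {α : Type} [Fintype α] [Nonempty α] (h : ∀ δ > 0, DHJAt α δ)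
    (S : Finset α) : ∀ (d : ℕ) {ε : ℝ}, 0 < ε → ∃ n : ℕ, ∀ (ι : Type) [Fintype ι],
      n ≤ Fintype.card ι → ∀ (E : α → Set (ι → α)) (f : (ι → Option α) → ℝ), (∀ y, f y ≤ 1) →
        (∀ W : Subspace (Fin d) (Option α) ι, ∑ x, f (W x) ≤ 0) →
        𝔼 y, (cylinder S E).indicator f y ≤ ε := by
  induction S using Finset.induction_on with
  | empty =>
    intro d ε hε
    refine ⟨d, fun ι _ hι E f hf hW => ?_⟩
    have : cylinder ∅ E = Set.univ := by simp [cylinder]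
    rw [this]
    simpa using (expect_nonpos_of_subspaces d ι hι f hW).trans hε.le
  | insert a S _ ih =>
    intro d ε hε
    obtain ⟨d₁, hd₁⟩ := ih d (half_pos hε)
    obtain ⟨η, _, hη⟩ : ∃ (η : Type) (_ : Fintype η), Fintype.card η = d₁ :=
      ⟨Fin d₁, inferInstance, by simp⟩
    obtain ⟨n, hn⟩ := exists_dim_insensitive h d₁ (half_pos hε)
    refine ⟨n, fun ι _ hι E f hf hW => ?_⟩
    have h1 := hn ι hι a (E a) (fun y => (cylinder S E).indicator f y - ε / 2)
      (fun y => by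
        have : (cylinder S E).indicator f y ≤ 1 :=
          Set.indicator_apply_le' (fun _ => hf y) fun _ => zero_le_one
        linarith) (fun U => ?_)
    · have h2 : ∀ y, (cylinder (insert a S) E).indicator f y ≤
          {y : ι → Option α | fill a y ∈ E a}.indicator
            (fun y => (cylinder S E).indicator f y - ε / 2) y + ε / 2 := fun y => by
        by_cases h3 : fill a y ∈ E a <;> by_cases h4 : y ∈ cylinder S E
        · have h5 : y ∈ cylinder (insert a S) E := by
            simpa [cylinder, h3] using h4
          simp [h3, h4, h5]
        · have h5 : y ∉ cylinder (insert a S) E := by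
            simpa [cylinder, h3] using h4
          simp [h3, h4, h5]
        · have h5 : y ∉ cylinder (insert a S) E := by simp [cylinder, h3]
          simpa [h3, h5] using (half_pos hε).le
        · have h5 : y ∉ cylinder (insert a S) E := by simp [cylinder, h3]
          simpa [h3, h5] using (half_pos hε).le
      refine (expect_le_expect fun y _ => h2 y).trans ?_
      rw [expect_add_distrib, Fintype.expect_const]
      linarith
    · have g : η ≃ Fin d₁ := Fintype.equivFinOfCardEq hη
      let U' : Subspace η (Option α) ι := U.reindex g.symm (Equiv.refl _) (Equiv.refl _)
      have hU : ∀ x, U x = U' (x ∘ g) := fun x => by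
        funext i
        simp only [U', Subspace.reindex_apply]
        simp only [Equiv.refl_symm, Equiv.coe_refl, id]
        congr 1
        funext s
        simp
      have hE : ∀ y : η → Option α, U' y ∈ cylinder S E ↔
          y ∈ cylinder S (fun a => {u | fill a (U' fun i => some (u i)) ∈ E a}) := fun y => by
        refine forall₂_congr fun b _ => ?_
        have : fill b (U' y) = fill b (U' fun i => some (fill b y i)) := by
          funext i
          simp only [fill, Subspace.apply_def]
          rcases U'.idxFun i with o | s <;> simp
        rw [this]
        rfl
      have h2 := hd₁ η hη.ge (fun a => {u | fill a (U' fun i => some (u i)) ∈ E a})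
        (fun y => f (U' y)) (fun y => hf _) (fun W => by
          simpa only [compSubspace_apply] using hW (compSubspace U' W))
      rw [Fintype.expect_eq_sum_div_card, div_le_iff₀ (Nat.cast_pos.2 Fintype.card_pos)] at h2
      have h3 : ∑ x, ((cylinder S E).indicator f (U x) - ε / 2) =
          ∑ y : η → Option α, ((cylinder S fun a =>
            {u | fill a (U' fun i => some (u i)) ∈ E a}).indicator (fun y => f (U' y)) y -
              ε / 2) := by
        refine Fintype.sum_equiv (g.symm.arrowCongr (Equiv.refl _)) _ _ fun x => ?_
        have hx : (g.symm.arrowCongr (Equiv.refl (Option α))) x = x ∘ g := by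
          funext i
          simp
        rw [hx, hU]
        congr 1
        simp only [Set.indicator_apply, hE]
      rw [h3, sum_sub_distrib, sum_const, card_univ, nsmul_eq_mul]
      linarith

lemma exists_dim_compl_cylinder {α : Type} [Fintype α] [Nonempty α] (h : ∀ δ > 0, DHJAt α δ)
    (d : ℕ) (S : Finset α) : ∀ {ε : ℝ}, 0 < ε → ∃ n : ℕ, ∀ (ι : Type) [Fintype ι],
      n ≤ Fintype.card ι → ∀ (E : α → Set (ι → α)) (f : (ι → Option α) → ℝ), (∀ y, f y ≤ 1) →
        (∀ W : Subspace (Fin d) (Option α) ι, ∑ x, f (W x) ≤ 0) →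
        𝔼 y, (cylinder S E)ᶜ.indicator f y ≤ ε := by
  induction S using Finset.induction_on with
  | empty =>
    intro ε hε
    refine ⟨0, fun ι _ _ E f _ _ => ?_⟩
    have : cylinder ∅ E = Set.univ := by simp [cylinder]
    rw [this]
    simpa using hε.le
  | insert a S ha ih =>
    intro ε hε
    obtain ⟨n₁, hn₁⟩ := ih (half_pos hε)
    obtain ⟨n₂, hn₂⟩ := exists_dim_cylinder h (insert a S) d (half_pos hε)
    refine ⟨max n₁ n₂, fun ι _ hι E f hf hW => ?_⟩
    have h1 := hn₁ ι ((le_max_left _ _).trans hι) E f hf hW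
    have h2 := hn₂ ι ((le_max_right _ _).trans hι) (Function.update E a (E a)ᶜ) f hf hW
    have h3 : ∀ y, (cylinder (insert a S) E)ᶜ.indicator f y = (cylinder S E)ᶜ.indicator f y +
        (cylinder (insert a S) (Function.update E a (E a)ᶜ)).indicator f y := fun y => by
      have h4 : y ∈ cylinder (insert a S) E ↔ fill a y ∈ E a ∧ y ∈ cylinder S E := by
        simp [cylinder]
      have h5 : y ∈ cylinder (insert a S) (Function.update E a (E a)ᶜ) ↔
          fill a y ∉ E a ∧ y ∈ cylinder S E := by
        simp only [cylinder, Set.mem_ofPred_eq, forall_mem_insert, Function.update_self,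
          Set.mem_compl_iff]
        refine and_congr_right fun _ => forall₂_congr fun b hb => ?_
        rw [Function.update_of_ne (by rintro rfl; exact ha hb)]
      by_cases h6 : fill a y ∈ E a <;> by_cases h7 : y ∈ cylinder S E <;>
        simp [h4, h5, h6, h7]
    simp only [h3, expect_add_distrib]
    linarith

lemma sub_mul_le_of_le_expect {X : Type*} [Fintype X] (g : X → ℝ) {a b : ℝ} (ha : a ≤ 𝔼 x, g x)
    (hb : ∀ x, g x ≤ b) (x : X) : b - Fintype.card X * (b - a) ≤ g x := by
  have hX : 0 < (Fintype.card X : ℝ) := Nat.cast_pos.2 (Fintype.card_pos_iff.2 ⟨x⟩)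
  rw [Fintype.expect_eq_sum_div_card, le_div_iff₀ hX] at ha
  have h1 : b - g x ≤ ∑ y, (b - g y) :=
    single_le_sum (f := fun y => b - g y) (fun y _ => sub_nonneg.2 (hb y)) (mem_univ x)
  rw [sum_sub_distrib, sum_const, card_univ, nsmul_eq_mul] at h1
  linarith

lemma exists_dim_dens_no_none {α : Type} [Fintype α] {ρ : ℝ} (hρ : 0 < ρ) :
    ∃ n : ℕ, ∀ (ι : Type) [Fintype ι], n ≤ Fintype.card ι →
      dens {w : ι → Option α | ∀ i, w i ≠ none} ≤ ρ := by
  obtain ⟨k, hk⟩ : ∃ k : ℕ, k = Fintype.card α := ⟨_, rfl⟩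
  have hlt : (k : ℝ) / (k + 1) < 1 := by
    rw [div_lt_one (by positivity)]
    linarith
  obtain ⟨n, hn⟩ := exists_pow_lt_of_lt_one hρ hlt
  refine ⟨n, fun ι _ hι => ?_⟩
  have h1 : {w : ι → Option α | ∀ i, w i ≠ none} =
      Set.range fun (u : ι → α) (i : ι) => some (u i) := by
    ext w
    simp only [Set.mem_ofPred_eq, Set.mem_range]
    constructor
    · intro h
      choose u hu using fun i => Option.ne_none_iff_exists'.1 (h i)
      exact ⟨u, funext fun i => (hu i).symm⟩
    · rintro ⟨u, rfl⟩ i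
      simp
  have h2 : Function.Injective fun (u : ι → α) (i : ι) => some (u i) := fun u v h =>
    funext fun i => Option.some_injective _ (congrFun h i)
  rw [h1, dens, Fintype.expect_eq_sum_div_card, sum_indicator_range h2]
  have h3 : (∑ _u : ι → α, (1 : (ι → Option α) → ℝ) fun i => some (_u i)) /
      (Fintype.card (ι → Option α) : ℝ) = ((k : ℝ) / (k + 1)) ^ Fintype.card ι := by
    rw [div_pow]
    simp [hk]
  rw [h3]
  exact (pow_le_pow_of_le_one (by positivity) hlt.le hι).trans hn.le

lemma exists_word_of_dense {α η η' Z : Type} [Fintype α] [Nonempty α] [Fintype η] [Fintype η']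
    [Fintype Z] [Nonempty Z] {δ : ℝ} (hδ : 0 < δ)
    (hη : ∀ B : Set (η → α), δ / 2 ≤ dens B → HasLine B)
    (hη' : Fintype.card η ≤ Fintype.card η') (G : (η' → α) → Set Z) (hG : ∀ u, δ ≤ dens (G u)) :
    ∃ w : η' → Option α, (∃ i, w i = none) ∧
      δ / 2 / Fintype.card (η → Option α) ≤ dens {z | ∀ a, z ∈ G (fill a w)} := by
  obtain ⟨a₀⟩ := ‹Nonempty α›
  obtain ⟨κ, _, -, ⟨e⟩⟩ := exists_equiv_sum hη'
  let C := {c : η → Option α // ∃ i, c i = none}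
  have := Fintype.ofFinite C
  obtain ⟨c, hc⟩ := exists_common_config (C := C) (fun c => Set.range fun a => fill a c.1)
    (fun z : Z => {u : η → α | z ∈ G (Sum.elim u (fun _ => a₀) ∘ e)}) hδ (by
      have h1 : 𝔼 z : Z, dens {u : η → α | z ∈ G (Sum.elim u (fun _ => a₀) ∘ e)} =
          𝔼 u : η → α, dens (G (Sum.elim u (fun _ => a₀) ∘ e)) := by
        simp only [dens]
        rw [expect_comm]
        rfl
      rw [h1]
      have := Nonempty.intro a₀
      exact le_expect univ_nonempty fun u _ => hG _) (fun z hz => by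
        obtain ⟨c, hc, h⟩ := hη _ hz
        exact ⟨⟨c, hc⟩, Set.range_subset_iff.2 h⟩)
  obtain ⟨i, hi⟩ := c.2
  refine ⟨Sum.elim c.1 (fun _ => some a₀) ∘ e, ⟨e.symm (Sum.inl i), by simp [hi]⟩, ?_⟩
  have hcard : 0 < Fintype.card C := Fintype.card_pos_iff.2 ⟨c⟩
  have hcard' : Fintype.card C ≤ Fintype.card (η → Option α) :=
    Fintype.card_le_of_injective Subtype.val Subtype.val_injective
  refine le_trans ?_ (hc.trans (dens_mono fun z hz a => ?_))
  · gcongr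
  · rw [fill_extend]
    exact hz ⟨a, rfl⟩

lemma not_all_words_dense {α η Z : Type} [Fintype α] [Nonempty α] [Fintype η] [Fintype Z]
    [Nonempty Z] {d : ℕ} {δ θ γ : ℝ} (hδ : 0 < δ) (hθ : 0 < θ) (hγ : 0 < γ) (hγ2 : γ ≤ 1 / 2)
    (hδθ : 8 * γ ≤ δ * θ) (hρ : dens {w : η → Option α | ∀ i, w i ≠ none} ≤ γ)
    (hη : ∀ (E : α → Set (η → α)) (f : (η → Option α) → ℝ), (∀ y, f y ≤ 1) →
        (∀ W : Subspace (Fin d) (Option α) η, ∑ x, f (W x) ≤ 0) →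
        𝔼 y, (cylinder univ E)ᶜ.indicator f y ≤ γ / 2)
    (G : (η → Option α) → Set Z) (hG : ∀ w, δ - γ ≤ dens (G w))
    (hline : ∀ w, (∃ i, w i = none) → ∀ z ∈ G w, ¬ ∀ a, z ∈ G fun i => some (fill a w i))
    (hW : ∀ (z : Z) (W : Subspace (Fin d) (Option α) η),
      ∑ x, ((G (W x)).indicator (1 : Z → ℝ) z - (δ + γ)) ≤ 0)
    (hred : ∀ w : η → Option α, (∃ i, w i = none) →
      θ ≤ dens {z | ∀ a, z ∈ G fun i => some (fill a w i)}) : False := by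
  let E : Z → α → Set (η → α) := fun z _ => {u | z ∈ G fun i => some (u i)}
  have hE : ∀ z w, w ∈ cylinder univ (E z) ↔ ∀ a, z ∈ G fun i => some (fill a w i) :=
    fun z w => by simp [cylinder, E]
  let N : Set (η → Option α) := {w | ∀ i, w i ≠ none}
  have h1 : ∀ z, 𝔼 w, (cylinder univ (E z))ᶜ.indicator
      (fun w => (G w).indicator (1 : Z → ℝ) z - (δ + γ)) w ≤ γ / 2 := fun z =>
    hη (E z) _ (fun w => by
      have : (G w).indicator (1 : Z → ℝ) z ≤ 1 :=
        Set.indicator_le_self' (fun _ _ => zero_le_one) z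
      linarith) (hW z)
  have h2 : ∀ z w, (G w).indicator (1 : Z → ℝ) z - N.indicator 1 w - (δ + γ) +
      (δ + γ) * {z | ∀ a, z ∈ G fun i => some (fill a w i)}.indicator (1 : Z → ℝ) z ≤
      (cylinder univ (E z))ᶜ.indicator (fun w => (G w).indicator (1 : Z → ℝ) z - (δ + γ)) w := by
    intro z w
    by_cases h3 : ∀ a, z ∈ G fun i => some (fill a w i)
    · have h4 : w ∈ cylinder univ (E z) := (hE z w).2 h3
      have h5 : (G w).indicator (1 : Z → ℝ) z ≤ N.indicator 1 w := by
        by_cases h6 : ∃ i, w i = none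
        · have : z ∉ G w := fun h => hline w h6 z h h3
          rw [Set.indicator_of_notMem this]
          exact Set.indicator_nonneg (fun _ _ => zero_le_one) _
        · have : w ∈ N := fun i hi => h6 ⟨i, hi⟩
          rw [Set.indicator_of_mem this]
          exact Set.indicator_le_self' (fun _ _ => zero_le_one) z
      rw [Set.indicator_of_mem (show z ∈ {z | ∀ a, z ∈ G fun i => some (fill a w i)} from h3),
        Set.indicator_of_notMem (s := (cylinder univ (E z))ᶜ) (by simpa using h4)]
      simp only [Pi.one_apply]
      linarith
    · have h4 : w ∉ cylinder univ (E z) := fun h => h3 ((hE z w).1 h)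
      rw [Set.indicator_of_notMem
        (show z ∉ {z | ∀ a, z ∈ G fun i => some (fill a w i)} from h3),
        Set.indicator_of_mem (s := (cylinder univ (E z))ᶜ) (by simpa using h4)]
      have : 0 ≤ N.indicator (1 : (η → Option α) → ℝ) w :=
        Set.indicator_nonneg (fun _ _ => zero_le_one) _
      linarith
  have h3 : 𝔼 w, (dens (G w) - N.indicator 1 w - (δ + γ) +
      (δ + γ) * dens {z | ∀ a, z ∈ G fun i => some (fill a w i)}) ≤ γ / 2 := by
    have h4 := expect_le_expect fun z (_ : z ∈ univ) =>
      (expect_le_expect fun w (_ : w ∈ univ) => h2 z w).trans (h1 z)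
    rw [Fintype.expect_const, expect_comm] at h4
    refine le_trans (le_of_eq (expect_congr rfl fun w _ => ?_)) h4
    simp only [expect_add_distrib, expect_sub_distrib, Fintype.expect_const, ← mul_expect]
    rfl
  have h4 : ∀ w, δ - γ - N.indicator 1 w - (δ + γ) + (δ + γ) * (θ * (1 - N.indicator 1 w)) ≤
      dens (G w) - N.indicator 1 w - (δ + γ) +
      (δ + γ) * dens {z | ∀ a, z ∈ G fun i => some (fill a w i)} := fun w => by
    have h5 : θ * (1 - N.indicator 1 w) ≤
        dens {z | ∀ a, z ∈ G fun i => some (fill a w i)} := by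
      by_cases h6 : ∃ i, w i = none
      · have : w ∉ N := fun h => h6.elim fun i hi => h i hi
        simpa [this] using hred w h6
      · have : w ∈ N := fun i hi => h6 ⟨i, hi⟩
        simpa [this] using dens_nonneg _
    have := mul_le_mul_of_nonneg_left h5 (by linarith : 0 ≤ δ + γ)
    linarith [hG w]
  have h5 := (expect_le_expect fun w (_ : w ∈ univ) => h4 w).trans h3
  simp only [expect_add_distrib, expect_sub_distrib, Fintype.expect_const, ← mul_expect] at h5
  change δ - γ - dens N - (δ + γ) + (δ + γ) * (θ * (1 - dens N)) ≤ γ / 2 at h5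
  have h6 : 0 ≤ dens N := dens_nonneg N
  have h7 : dens N ≤ 1 / 2 := hρ.trans hγ2
  have h8 : θ / 2 ≤ θ * (1 - dens N) := by nlinarith
  have h9 : δ * (θ / 2) ≤ (δ + γ) * (θ * (1 - dens N)) := by
    gcongr
    linarith
  have h10 : dens N ≤ γ := hρ
  linarith

lemma exists_monochromatic {α : Type} [Finite α] [Nonempty α] (η : Type) [Fintype η] :
    ∃ (ι : Type) (_ : Fintype ι), ∀ P : (ι → Option α) → Prop, ∃ V : Subspace η α ι,
      (∀ w : η → Option α, (∃ i, w i = none) → P (liftWord V w)) ∨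
      (∀ w : η → Option α, (∃ i, w i = none) → ¬ P (liftWord V w)) := by
  obtain ⟨ι, hι, h⟩ := graham_rothschild α Prop (Fintype.card η)
  refine ⟨ι, hι, fun P => ?_⟩
  obtain ⟨V, c, hV⟩ := h P
  have g := Fintype.equivFin η
  let V' : Subspace η α ι := ⟨fun i => (V.idxFun i).map id g.symm, fun s => by
    obtain ⟨i, hi⟩ := V.proper (g s)
    exact ⟨i, by simp [hi]⟩⟩
  have hV' : ∀ w, liftWord V' w = liftWord V (w ∘ g.symm) := fun w => by
    funext i
    simp only [liftWord, V']
    rcases V.idxFun i with a | s <;> simp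
  have key : ∀ w : η → Option α, (∃ i, w i = none) → P (liftWord V' w) = c := fun w ⟨i, hi⟩ => by
    rw [hV']
    exact hV _ ⟨g i, by simpa using hi⟩
  refine ⟨V', ?_⟩
  by_cases hc : c
  · exact Or.inl fun w hw => (key w hw).mpr hc
  · exact Or.inr fun w hw h => hc ((key w hw).mp h)

lemma DHJAt.exists_lower {α : Type} [Fintype α] [Nonempty α] (h : ∀ δ > 0, DHJAt α δ) {δ : ℝ}
    (hδ : 0 < δ) (hδ1 : ∀ γ > 0, DHJAt (Option α) (δ + γ)) :
    ∃ γ > 0, DHJAt (Option α) (δ - γ) := by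
  obtain ⟨n₁, hn₁⟩ := (h (3 * δ / 4 / 2) (by positivity)).exists_dim
  obtain ⟨η₁, _, hη₁⟩ : ∃ (η : Type) (_ : Fintype η), Fintype.card η = n₁ :=
    ⟨Fin n₁, inferInstance, by simp⟩
  obtain ⟨θ, hθdef⟩ : ∃ θ : ℝ, θ = 3 * δ / 4 / 2 / Fintype.card (η₁ → Option α) := ⟨_, rfl⟩
  have hK : 0 < (Fintype.card (η₁ → Option α) : ℝ) := Nat.cast_pos.2 Fintype.card_pos
  have hθ : 0 < θ := by rw [hθdef]; positivity
  obtain ⟨γ, hγ, hγ2, hγδ, hγθ⟩ : ∃ γ : ℝ, 0 < γ ∧ γ ≤ 1 / 2 ∧ γ ≤ δ / 4 ∧ 8 * γ ≤ δ * θ := by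
    refine ⟨min (1 / 2) (min (δ / 4) (δ * θ / 8)), by positivity, min_le_left _ _,
      (min_le_right _ _).trans (min_le_left _ _), ?_⟩
    have := (min_le_right (1 / 2 : ℝ) _).trans (min_le_right (δ / 4) (δ * θ / 8))
    linarith
  obtain ⟨d, hd⟩ := (hδ1 γ hγ).exists_dim
  obtain ⟨n₂, hn₂⟩ := exists_dim_compl_cylinder h d univ (half_pos hγ)
  obtain ⟨n₃, hn₃⟩ := exists_dim_dens_no_none (α := α) hγ
  obtain ⟨η, _, hη⟩ : ∃ (η : Type) (_ : Fintype η), Fintype.card η = n₁ + n₂ + n₃ :=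
    ⟨Fin (n₁ + n₂ + n₃), inferInstance, by simp⟩
  obtain ⟨ι₀, _, hι₀⟩ := exists_monochromatic (α := α) η
  obtain ⟨R, hR⟩ : ∃ R : ℝ, R = Fintype.card (ι₀ → Option α) := ⟨_, rfl⟩
  have hRpos : 0 < R := by rw [hR]; exact Nat.cast_pos.2 Fintype.card_pos
  obtain ⟨γ₁, hγ₁, hγ₁R⟩ : ∃ γ₁ : ℝ, 0 < γ₁ ∧ 2 * γ₁ * R ≤ γ :=
    ⟨γ / (2 * R), by positivity, le_of_eq (by field_simp)⟩
  obtain ⟨n₄, hn₄⟩ := (hδ1 γ₁ hγ₁).exists_dim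
  obtain ⟨κ, _, hκ⟩ : ∃ (κ : Type) (_ : Fintype κ), Fintype.card κ = n₄ :=
    ⟨Fin n₄, inferInstance, by simp⟩
  refine ⟨γ₁, hγ₁, κ ⊕ ι₀, inferInstance, fun A hA => ?_⟩
  by_contra hno
  rw [dens_sumElim (Equiv.refl (κ ⊕ ι₀))] at hA
  set G : (ι₀ → Option α) → Set (κ → Option α) :=
    fun y => {z | Sum.elim z y ∘ Equiv.refl (κ ⊕ ι₀) ∈ A} with hG
  have hup : ∀ y, dens (G y) ≤ δ + γ₁ := fun y => by
    by_contra hcon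
    exact hno (HasLine.of_fiber (Equiv.refl _) y (hn₄ κ hκ.ge _ (not_le.1 hcon).le))
  have hlow : ∀ y, δ - γ ≤ dens (G y) := fun y => by
    have := sub_mul_le_of_le_expect _ hA hup y
    rw [← hR] at this
    linarith
  have hfree : ∀ w : ι₀ → Option α, (∃ i, w i = none) → ∀ z ∈ G w,
      ¬ ∀ a, z ∈ G fun i => some (fill a w i) := fun w ⟨i, hi⟩ z hz hall => by
    refine hno ⟨Sum.elim (fun j => some (z j)) (fun j => (w j).map some),
      ⟨Sum.inr i, by simp [hi]⟩, fun o => ?_⟩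
    rcases o with _ | a
    · have h1 : fill none (Sum.elim (fun j => some (z j)) fun j => (w j).map some) =
          Sum.elim z w ∘ Equiv.refl (κ ⊕ ι₀) := by
        funext j
        rcases j with j | j
        · simp [fill]
        · rcases h : w j <;> simp [fill, h]
      rw [h1]
      exact hz
    · have h1 : fill (some a) (Sum.elim (fun j => some (z j)) fun j => (w j).map some) =
          Sum.elim z (fun i => some (fill a w i)) ∘ Equiv.refl (κ ⊕ ι₀) := by
        funext j
        rcases j with j | j
        · simp [fill]
        · rcases h : w j <;> simp [fill, h]
      rw [h1]
      exact hall a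
  have hlift : ∀ (V : Subspace η α ι₀) (w : η → Option α) (a : α),
      (liftWord V fun i => some (fill a w i)) = fun i => some (fill a (liftWord V w) i) :=
    fun V w a => by
      funext i
      simp only [liftWord, fill]
      rcases V.idxFun i with j | j <;> simp
  obtain ⟨V, hV | hV⟩ := hι₀ fun w => θ ≤ dens {z | ∀ a, z ∈ G fun i => some (fill a w i)}
  · refine not_all_words_dense hδ hθ hγ hγ2 hγθ (hn₃ η (by omega)) (hn₂ η (by omega))
      (fun w => G (liftWord V w)) (fun w => hlow _) (fun w hw z hz hall => ?_) (fun z W => ?_)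
      (fun w hw => ?_)
    · obtain ⟨i, hi⟩ := hw
      obtain ⟨j, hj⟩ := V.proper i
      refine hfree (liftWord V w) ⟨j, by simp [liftWord, hj, hi]⟩ z hz fun a => ?_
      rw [← hlift]
      exact hall a
    · by_contra! hcon
      have h1 : δ + γ ≤ dens {x : Fin d → Option α | z ∈ G (liftWord V (W x))} := by
        rw [dens, Fintype.expect_eq_sum_div_card, le_div_iff₀ (Nat.cast_pos.2 Fintype.card_pos)]
        rw [sum_sub_distrib, sum_const, card_univ, nsmul_eq_mul] at hcon
        have h2 : ∀ x, (G (liftWord V (W x))).indicator (1 : (κ → Option α) → ℝ) z =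
          {x : Fin d → Option α | z ∈ G (liftWord V (W x))}.indicator 1 x := fun x => by
            simp [Set.indicator_apply]
        simp only [h2] at hcon
        linarith
      have h2 : HasLine {x : Fin d → Option α | z ∈ G (liftWord V (W x))} :=
        hd (Fin d) (by simp) _ (by convert h1)
      have h3 : HasLine {y | z ∈ G y} := by
        refine HasLine.of_subspace (compSubspace (optSubspace V) W) ?_
        simpa only [compSubspace_apply, optSubspace_apply, Set.mem_ofPred_eq] using h2
      refine hno (HasLine.of_fiber (Equiv.sumComm κ ι₀) z ?_)
      convert h3 using 1
      ext y
      simp only [hG, Set.mem_ofPred_eq]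
      congr! 1
      funext j
      rcases j with j | j <;> simp
    · simp only [hlift]
      exact hV w hw
  · obtain ⟨w, hw, hw2⟩ := exists_word_of_dense (Z := κ → Option α) (δ := 3 * δ / 4)
      (by positivity) (hn₁ η₁ hη₁.ge) (by omega : Fintype.card η₁ ≤ Fintype.card η)
      (fun u => G fun i => some (V u i)) (fun u => by linarith [hlow fun i => some (V u i)])
    refine hV w hw ?_
    rw [hθdef]
    simpa only [fill_liftWord] using hw2

/-- The density Hales–Jewett theorem. -/
theorem dhjAt_of_pos (α : Type) [Fintype α] [Nonempty α] {δ : ℝ} (hδ : 0 < δ) : DHJAt α δ := by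
  have step : ∀ n : ℕ, ∀ (α : Type) [Fintype α] [Nonempty α], Fintype.card α = n + 1 →
      ∀ δ > 0, DHJAt α δ := by
    intro n
    induction n with
    | zero =>
      intro α _ _ hα δ hδ
      obtain ⟨η, _, hη⟩ : ∃ (η : Type) (_ : Fintype η), Fintype.card η = 1 :=
        ⟨Unit, inferInstance, by simp⟩
      have ⟨i⟩ : Nonempty η := Fintype.card_pos_iff.1 (by omega)
      refine ⟨η, inferInstance, fun A hA => ?_⟩
      obtain ⟨x, hx⟩ := nonempty_of_dens_pos (hδ.trans_le hA)
      have := (Fintype.card_eq_one_iff_nonempty_unique.1 hα).some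
      exact ⟨fun _ => none, ⟨i, rfl⟩, fun a => by rwa [Subsingleton.elim (fill a _) x]⟩
    | succ n ih =>
      intro α _ _ hα
      obtain ⟨β, _, _, hβ, ⟨e⟩⟩ : ∃ (β : Type) (_ : Fintype β) (_ : Nonempty β),
          Fintype.card β = n + 1 ∧ Nonempty (α ≃ Option β) :=
        ⟨Fin (n + 1), inferInstance, inferInstance, by simp,
          ⟨Fintype.equivOfCardEq (by simp [hα])⟩⟩
      have hopt : ∀ δ > 0, DHJAt (Option β) δ := by
        by_contra! hcon
        obtain ⟨δ₀, hδ₀, hbad⟩ := hcon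
        let S : Set ℝ := {δ | ¬ DHJAt (Option β) δ}
        obtain ⟨η, _, -⟩ : ∃ (η : Type) (_ : Fintype η), Fintype.card η = 1 :=
          ⟨Unit, inferInstance, by simp⟩
        have hS1 : BddAbove S := ⟨1, fun δ hδ => by
          by_contra! h
          exact hδ ⟨η, inferInstance, fun A hA =>
            absurd (dens_le_one A) (not_le.2 (h.trans_le hA))⟩⟩
        have hpos : 0 < sSup S := hδ₀.trans_le (le_csSup hS1 hbad)
        obtain ⟨γ, hγ, ι, _, h⟩ := DHJAt.exists_lower (ih β hβ) hpos fun γ hγ => by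
          by_contra h
          linarith [le_csSup hS1 (show sSup S + γ ∈ S from h)]
        obtain ⟨δ', hδ', hlt⟩ := exists_lt_of_lt_csSup ⟨δ₀, hbad⟩ (sub_lt_self (sSup S) hγ)
        exact hδ' ⟨ι, inferInstance, fun A hA => h A (by linarith)⟩
      intro δ hδ
      obtain ⟨ι, _, h⟩ := hopt δ hδ
      refine ⟨ι, inferInstance, fun A hA => ?_⟩
      obtain ⟨y, ⟨i, hi⟩, hy⟩ := h {x | e.symm ∘ x ∈ A} (by
        have h1 := dens_preimage_equiv ((Equiv.refl ι).arrowCongr e.symm) A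
        rw [← h1] at hA
        exact hA)
      refine ⟨fun i => (y i).map e.symm, ⟨i, by simp [hi]⟩, fun a => ?_⟩
      have h2 : fill a (fun i => (y i).map e.symm) = e.symm ∘ fill (e a) y := by
        funext i
        rcases h : y i <;> simp [fill, h]
      rw [h2]
      exact hy (e a)
  obtain ⟨n, hn⟩ := Nat.exists_eq_succ_of_ne_zero (Fintype.card_ne_zero (α := α))
  exact step n α hn δ hδ

/-- Szemerédi's theorem in averaged form, in a finite abelian group and for progressions whose
difference is a bounded multiple of a given element. -/
theorem exists_dense_progressions (k : ℕ) {α : ℝ} (hα : 0 < α) :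
    ∃ N : ℕ, ∃ c > 0, ∀ (H : Type) [AddCommGroup H] [Fintype H] (E : Set H) (g : H),
      α ≤ dens E →
        c ≤ ∑ t ∈ Icc 1 N, 𝔼 u, ∏ i ∈ range (k + 1), E.indicator (1 : H → ℝ) (u + (i * t) • g) := by
  obtain ⟨β, _, _, ⟨b⟩⟩ : ∃ (β : Type) (_ : Fintype β) (_ : Nonempty β),
      Nonempty (Fin (k + 1) ≃ β) := ⟨Fin (k + 1), inferInstance, inferInstance, ⟨Equiv.refl _⟩⟩
  obtain ⟨ι, _, hι⟩ := dhjAt_of_pos β (half_pos hα)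
  obtain ⟨n, hn⟩ : ∃ n, n = Fintype.card ι := ⟨_, rfl⟩
  refine ⟨n, α / 2 / (k * n + 1), by positivity, fun H _ _ E g hE => ?_⟩
  let F : ℕ → H → ℝ := fun t u => ∏ i ∈ range (k + 1), E.indicator (1 : H → ℝ) (u + (i * t) • g)
  have hF : ∀ t u, 0 ≤ F t u := fun t u =>
    prod_nonneg fun i _ => Set.indicator_nonneg (fun _ _ => zero_le_one) _
  let σ : (ι → β) → ℕ := fun x => ∑ i, (b.symm (x i) : ℕ)
  let D : H → Set (ι → β) := fun u => {x | u + σ x • g ∈ E}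
  have h1 : 𝔼 u, dens (D u) = dens E := by
    simp only [dens]
    rw [expect_comm]
    have h2 : ∀ x : ι → β, 𝔼 u, (D u).indicator (1 : (ι → β) → ℝ) x = 𝔼 u, E.indicator 1 u :=
      fun x => Fintype.expect_equiv (Equiv.addRight (σ x • g)) _ _ fun u => by
        simp [Set.indicator_apply, D]
    simp only [h2, Fintype.expect_const]
  have h2 : ∀ u, dens (D u) ≤
      α / 2 + ∑ s ∈ range (k * n + 1), ∑ t ∈ Icc 1 n, F t (u + s • g) := by
    intro u
    have hnn : 0 ≤ ∑ s ∈ range (k * n + 1), ∑ t ∈ Icc 1 n, F t (u + s • g) :=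
      sum_nonneg fun s _ => sum_nonneg fun t _ => hF _ _
    rcases lt_or_ge (dens (D u)) (α / 2) with h | h
    · linarith
    obtain ⟨y, ⟨j, hj⟩, hy⟩ := hι (D u) h
    let t := (univ.filter fun i => y i = none).card
    let s := ∑ i, (y i).elim 0 fun a => (b.symm a : ℕ)
    have ht : t ∈ Icc 1 n := by
      rw [mem_Icc, hn]
      exact ⟨card_pos.2 ⟨j, by simp [hj]⟩, card_le_univ _⟩
    have hs : s ∈ range (k * n + 1) := by
      have : s ≤ ∑ _i : ι, k := sum_le_sum fun i _ => by
        rcases y i with _ | a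
        · simp
        · exact Nat.lt_succ_iff.1 (b.symm a).2
      rw [mem_range, Nat.lt_succ_iff]
      refine this.trans ?_
      simp [hn, mul_comm]
    have hσ : ∀ a, σ (fill a y) = s + (b.symm a : ℕ) * t := fun a => by
      simp only [σ, s, t, card_filter, mul_sum, ← sum_add_distrib]
      refine sum_congr rfl fun i _ => ?_
      rcases h : y i <;> simp [fill, h]
    have hF1 : F t (u + s • g) = 1 := prod_eq_one fun i hi => by
      have := hy (b ⟨i, mem_range.1 hi⟩)
      simp only [D, Set.mem_ofPred_eq, hσ, Equiv.symm_apply_apply] at this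
      rw [Set.indicator_of_mem]
      · rfl
      · rw [add_assoc, ← add_smul]
        exact this
    have h3 : 1 ≤ ∑ s ∈ range (k * n + 1), ∑ t ∈ Icc 1 n, F t (u + s • g) := by
      rw [← hF1]
      refine le_trans ?_ (single_le_sum (f := fun s => ∑ t ∈ Icc 1 n, F t (u + s • g))
        (fun s _ => sum_nonneg fun t _ => hF _ _) hs)
      exact single_le_sum (f := fun t => F t (u + s • g)) (fun t _ => hF _ _) ht
    have h4 : dens (D u) ≤ 1 := by
      exact dens_le_one _
    linarith
  have h3 := expect_le_expect fun u (_ : u ∈ univ) => h2 u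
  rw [h1, expect_add_distrib, Fintype.expect_const, expect_sum_comm] at h3
  have h4 : ∀ s ∈ range (k * n + 1), 𝔼 u, ∑ t ∈ Icc 1 n, F t (u + s • g) =
      ∑ t ∈ Icc 1 n, 𝔼 u, F t u := fun s _ => by
    rw [expect_sum_comm]
    exact sum_congr rfl fun t _ => Fintype.expect_equiv (Equiv.addRight (s • g)) _ _ fun u => rfl
  rw [sum_congr rfl h4, sum_const, card_range, nsmul_eq_mul] at h3
  rw [div_le_iff₀ (by positivity)]
  push_cast at h3
  change α / 2 ≤ (∑ t ∈ Icc 1 n, 𝔼 u, F t u) * (k * n + 1)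
  linarith

/-- The average of a product of `k + 1` functions along progressions of difference `n • v`. -/
noncomputable def progAvg {H : Type} [AddCommGroup H] [Fintype H] (k : ℕ) (f : ℕ → H → ℝ) (v : H)
    (n : ℤ) : ℝ :=
  𝔼 u, ∏ i ∈ range (k + 1), f i (u + (i * n) • v)

/-- The possible differences of two integers in `[0, N)`. -/
abbrev Shift (N : ℕ) : Type := Ioo (-(N : ℤ)) N

lemma card_shift_le (N : ℕ) : Fintype.card (Shift N) ≤ 2 * N := by
  rw [Fintype.card_coe, Int.card_Ioo]
  omega

/-- The sum of the shifts selected by `ω`. -/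
def offset {k N : ℕ} (ω : Fin k → Bool) (h : Fin k → Shift N) : ℤ :=
  ∑ j, if ω j then (h j : ℤ) else 0

lemma offset_cons {k N : ℕ} (b : Bool) (ω : Fin k → Bool) (a : Shift N) (h : Fin k → Shift N) :
    offset (Fin.cons b ω : Fin (k + 1) → Bool) (Fin.cons a h : Fin (k + 1) → Shift N) =
      (if b then (a : ℤ) else 0) + offset ω h := by
  simp [offset, Fin.sum_univ_succ]

lemma sum_shift {N : ℕ} {G : ℤ → ℝ} (hG : ∀ n, n ∉ Ico (0 : ℤ) N → G n = 0) (Q : ℤ → ℝ) {n : ℤ}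
    (hn : n ∈ Ico (0 : ℤ) N) :
    ∑ n' ∈ Ico (0 : ℤ) N, G n' * Q (n' - n) = ∑ h : Shift N, G (n + h) * Q h := by
  refine Eq.trans ?_ (sum_coe_sort (Ioo (-(N : ℤ)) N) fun h => G (n + h) * Q h).symm
  simp only [mem_Ico] at hn
  refine sum_of_injOn (fun n' => n' - n) (fun a _ b _ h => by simpa using h) (fun a ha => ?_)
    (fun h _ hh => ?_) fun n' _ => by simp
  · simp only [coe_Ico, Set.mem_Ico] at ha
    simp only [coe_Ioo, Set.mem_Ioo]
    omega
  · rw [hG, zero_mul]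
    intro hmem
    exact hh ⟨n + h, hmem, by simp⟩

lemma sq_sum_mul_progAvg_le {H : Type} [AddCommGroup H] [Fintype H] (k N : ℕ) (f : ℕ → H → ℝ)
    (hf : ∀ i u, |f i u| ≤ 1) (v : H) {G : ℤ → ℝ} (hG : ∀ n, n ∉ Ico (0 : ℤ) N → G n = 0) :
    (∑ n ∈ Ico (0 : ℤ) N, G n * progAvg (k + 1) f v n) ^ 2 ≤
      ∑ h : Shift N, |∑ n ∈ Ico (0 : ℤ) N, G n * G (n + h) *
        progAvg k (fun i u => f (i + 1) u * f (i + 1) (u + ((i + 1 : ℕ) * (h : ℤ)) • v)) v n| := by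
  let A : H → ℝ := fun u =>
    ∑ n ∈ Ico (0 : ℤ) N, G n * ∏ i ∈ range (k + 1), f (i + 1) (u + ((i + 1 : ℕ) * n) • v)
  have h1 : ∑ n ∈ Ico (0 : ℤ) N, G n * progAvg (k + 1) f v n = 𝔼 u, f 0 u * A u := by
    simp only [progAvg, mul_expect, A, mul_sum]
    rw [← expect_sum_comm]
    refine expect_congr rfl fun u _ => sum_congr rfl fun n _ => ?_
    rw [prod_range_succ']
    simp
    ring
  have h2 : (𝔼 u, f 0 u * A u) ^ 2 ≤ 𝔼 u, A u ^ 2 := by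
    refine (expect_mul_sq_le_sq_mul_sq _ _ _).trans ?_
    have h3 : 𝔼 u, f 0 u ^ 2 ≤ 1 := expect_le univ_nonempty fun u _ => by
      rw [← sq_abs]
      exact pow_le_one₀ (abs_nonneg _) (hf _ _)
    exact mul_le_of_le_one_left (expect_nonneg fun u _ => sq_nonneg _) h3
  let P : ℤ → H → ℝ := fun n u => ∏ i ∈ range (k + 1), f (i + 1) (u + ((i + 1 : ℕ) * n) • v)
  let F : ℤ → ℕ → H → ℝ := fun h i u => f (i + 1) u * f (i + 1) (u + ((i + 1 : ℕ) * h) • v)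
  have h3 : ∀ n n', 𝔼 u, P n u * P n' u = progAvg k (F (n' - n)) v n := fun n n' => by
    rw [progAvg]
    refine Fintype.expect_equiv (Equiv.addRight (n • v)) _ _ fun u => ?_
    rw [← prod_mul_distrib]
    refine prod_congr rfl fun i _ => ?_
    simp only [F, Equiv.coe_addRight]
    congr 2
    · rw [add_assoc, ← add_smul]
      congr 2
      push_cast
      ring
    · rw [add_assoc, add_assoc, ← add_smul, ← add_smul]
      congr 2
      push_cast
      ring
  have h4 : 𝔼 u, A u ^ 2 = ∑ n ∈ Ico (0 : ℤ) N, ∑ h : Shift N,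
      G n * G (n + h) * progAvg k (F h) v n := by
    have h5 : ∀ u, A u ^ 2 = ∑ n ∈ Ico (0 : ℤ) N, ∑ n' ∈ Ico (0 : ℤ) N,
        G n * (G n' * (P n u * P n' u)) := fun u => by
      simp only [A, sq, sum_mul_sum]
      exact sum_congr rfl fun n _ => sum_congr rfl fun n' _ => by ring
    simp only [h5]
    rw [expect_sum_comm]
    refine sum_congr rfl fun n hn => ?_
    rw [expect_sum_comm]
    simp only [← mul_expect, h3]
    rw [← mul_sum, sum_shift hG (fun h => progAvg k (F h) v n) hn, mul_sum]
    exact sum_congr rfl fun h _ => by ring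
  rw [h1]
  refine (h2.trans_eq h4).trans ?_
  rw [sum_comm]
  exact sum_le_sum fun h _ => le_abs_self _

/-- Iterated van der Corput inequality. -/
lemma abs_sum_mul_progAvg_pow_le {H : Type} [AddCommGroup H] [Fintype H] (k N : ℕ) :
    ∀ (f : ℕ → H → ℝ), (∀ i u, |f i u| ≤ 1) → ∀ (v : H) (G : ℤ → ℝ),
      (∀ n, n ∉ Ico (0 : ℤ) N → G n = 0) →
      |∑ n ∈ Ico (0 : ℤ) N, G n * progAvg k f v n| ^ 2 ^ k * (2 * N) ^ (k + 1) ≤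
        (2 * N : ℝ) ^ 2 ^ k * ∑ h : Fin k → Shift N,
          |∑ n ∈ Ico (0 : ℤ) N, ∏ ω : Fin k → Bool, G (n + offset ω h)| := by
  induction k with
  | zero =>
    intro f hf v G hG
    have h1 : |𝔼 u, f 0 u| ≤ 1 := (abs_expect_le _ _).trans
      (expect_le univ_nonempty fun u _ => hf _ _)
    simp only [progAvg, offset]
    simp [← sum_mul, abs_mul]
    nlinarith [abs_nonneg (∑ n ∈ Ico (0 : ℤ) N, G n), Nat.cast_nonneg (α := ℝ) N,
      mul_nonneg (Nat.cast_nonneg (α := ℝ) N) (abs_nonneg (∑ n ∈ Ico (0 : ℤ) N, G n))]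
  | succ k ih =>
    intro f hf v G hG
    let S : Shift N → ℝ := fun h => |∑ n ∈ Ico (0 : ℤ) N, G n * G (n + h) *
        progAvg k (fun i u => f (i + 1) u * f (i + 1) (u + ((i + 1 : ℕ) * (h : ℤ)) • v)) v n|
    have hS : ∀ h, 0 ≤ S h := fun h => abs_nonneg _
    have h1 : |∑ n ∈ Ico (0 : ℤ) N, G n * progAvg (k + 1) f v n| ^ 2 ≤ ∑ h, S h := by
      rw [sq_abs]
      exact sq_sum_mul_progAvg_le k N f hf v hG
    have h2 : ∀ h, S h ^ 2 ^ k * (2 * N) ^ (k + 1) ≤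
        (2 * N : ℝ) ^ 2 ^ k * ∑ h' : Fin k → Shift N,
          |∑ n ∈ Ico (0 : ℤ) N, ∏ ω : Fin (k + 1) → Bool, G (n + offset ω (Fin.cons h h'))| := by
      intro h
      refine (ih (fun i u => f (i + 1) u * f (i + 1) (u + ((i + 1 : ℕ) * (h : ℤ)) • v))
        (fun i u => ?_) v (fun n => G n * G (n + h)) (fun n hn => by simp [hG n hn])).trans_eq ?_
      · rw [abs_mul]
        exact mul_le_one₀ (hf _ _) (abs_nonneg _) (hf _ _)
      · congr 1
        refine sum_congr rfl fun h' _ => ?_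
        congr 1
        refine sum_congr rfl fun n _ => ?_
        have hc : ∀ b ω, offset (Fin.consEquiv (fun _ : Fin (k + 1) => Bool) (b, ω))
            (Fin.cons h h' : Fin (k + 1) → Shift N) = (if b then (h : ℤ) else 0) + offset ω h' :=
          fun b ω => offset_cons b ω h h'
        rw [← (Fin.consEquiv fun _ : Fin (k + 1) => Bool).prod_comp, Fintype.prod_prod_type]
        simp only [hc, Fintype.prod_bool, if_true, prod_mul_distrib]
        rw [mul_comm]
        congr 1
        · exact prod_congr rfl fun ω _ => by congr 1; ring
        · exact prod_congr rfl fun ω _ => by simp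
    obtain ⟨m, hm⟩ : ∃ m, 2 ^ k = m + 1 := Nat.exists_eq_succ_of_ne_zero (by positivity)
    have h3 : (∑ h, S h) ^ 2 ^ k ≤ (2 * N : ℝ) ^ m * ∑ h, S h ^ 2 ^ k := by
      rcases Nat.eq_zero_or_pos (Fintype.card (Shift N)) with h0 | h0
      · have : IsEmpty (Shift N) := Fintype.card_eq_zero_iff.1 h0
        simp
      have h4 := pow_sum_div_card_le_sum_pow (s := univ) (f := S) (fun h _ => hS h) m
      rw [card_univ, div_le_iff₀ (by positivity)] at h4
      rw [hm]
      refine h4.trans ?_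
      rw [mul_comm]
      refine mul_le_mul_of_nonneg_right ?_ (sum_nonneg fun h _ => pow_nonneg (hS h) _)
      gcongr
      exact_mod_cast card_shift_le N
    calc |∑ n ∈ Ico (0 : ℤ) N, G n * progAvg (k + 1) f v n| ^ 2 ^ (k + 1) * (2 * N) ^ (k + 1 + 1)
        ≤ (∑ h, S h) ^ 2 ^ k * (2 * N) ^ (k + 1 + 1) := by
          rw [pow_succ' 2 k, pow_mul]
          gcongr
      _ ≤ (2 * N : ℝ) ^ m * (∑ h, S h ^ 2 ^ k) * (2 * N) ^ (k + 1 + 1) := by gcongr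
      _ = (2 * N : ℝ) ^ 2 ^ k * ∑ h, S h ^ 2 ^ k * (2 * N) ^ (k + 1) := by
          rw [← sum_mul, hm]
          ring
      _ ≤ (2 * N : ℝ) ^ 2 ^ k * ∑ h, (2 * N : ℝ) ^ 2 ^ k * ∑ h' : Fin k → Shift N,
          |∑ n ∈ Ico (0 : ℤ) N, ∏ ω : Fin (k + 1) → Bool, G (n + offset ω (Fin.cons h h'))| := by
          exact mul_le_mul_of_nonneg_left (sum_le_sum fun h _ => h2 h) (by positivity)
      _ = _ := by
          rw [← mul_sum, ← mul_assoc, ← pow_add, ← two_mul, ← pow_succ']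
          congr 1
          rw [← (Fin.consEquiv fun _ : Fin (k + 1) => Shift N).sum_comp, Fintype.sum_prod_type]
          rfl

/-- The indicator function of the residue class of `a p` modulo `p`. -/
noncomputable def resInd (a : ℕ → ℤ) (p : ℕ) (n : ℤ) : ℝ := if (p : ℤ) ∣ n - a p then 1 else 0

lemma resInd_nonneg (a : ℕ → ℤ) (p : ℕ) (n : ℤ) : 0 ≤ resInd a p n := by
  rw [resInd]
  split_ifs <;> norm_num

lemma resInd_le_one (a : ℕ → ℤ) (p : ℕ) (n : ℤ) : resInd a p n ≤ 1 := by
  rw [resInd]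
  split_ifs <;> norm_num

lemma resInd_add_of_dvd (a : ℕ → ℤ) (p : ℕ) {Q : ℤ} (hQ : (p : ℤ) ∣ Q) (n : ℤ) :
    resInd a p (n + Q) = resInd a p n := by
  have : (p : ℤ) ∣ n + Q - a p ↔ (p : ℤ) ∣ n - a p := by
    rw [show n + Q - a p = n - a p + Q by ring, dvd_add_left hQ]
  simp only [resInd, this]

lemma sum_resInd_progression (a : ℕ → ℤ) {p : ℕ} (hp : p.Prime) {Q : ℕ} (hQ : p.Coprime Q)
    (n : ℤ) : ∑ j ∈ range p, resInd a p (n + j * Q) = 1 := by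
  obtain ⟨u, v, huv⟩ := Nat.isCoprime_iff_coprime.2 hQ
  have hp0 : (0 : ℤ) < p := by exact_mod_cast hp.pos
  obtain ⟨j₀, hj₀, hj₀'⟩ : ∃ j₀ : ℕ, j₀ < p ∧ (p : ℤ) ∣ j₀ - v * (a p - n) := by
    refine ⟨((v * (a p - n)) % p).toNat, ?_, ?_⟩
    · have := Int.emod_lt_of_pos (v * (a p - n)) hp0
      have := Int.emod_nonneg (v * (a p - n)) hp0.ne'
      omega
    · rw [Int.toNat_of_nonneg (Int.emod_nonneg _ hp0.ne'), ← dvd_neg, neg_sub]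
      exact Int.dvd_self_sub_emod
  have key : ∀ j ∈ range p, (p : ℤ) ∣ n + j * Q - a p ↔ j = j₀ := by
    intro j hj
    have h1 : (p : ℤ) ∣ n + j₀ * Q - a p := by
      have h2 : n + j₀ * Q - a p = (j₀ - v * (a p - n)) * Q + p * (-(u * (a p - n))) := by
        linear_combination (a p - n) * huv
      rw [h2]
      exact dvd_add (Dvd.dvd.mul_right hj₀' _) (dvd_mul_right _ _)
    constructor
    · intro h
      have h2 : (p : ℤ) ∣ ((j : ℤ) - j₀) * Q := by
        have h3 := dvd_sub h h1
        rwa [show n + (j : ℤ) * Q - a p - (n + (j₀ : ℤ) * Q - a p) = ((j : ℤ) - j₀) * Q by ring]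
          at h3
      have h3 := (Nat.isCoprime_iff_coprime.2 hQ).dvd_of_dvd_mul_right h2
      rw [mem_range] at hj
      have h4 := Int.eq_zero_of_abs_lt_dvd h3 (by rw [abs_lt]; omega)
      omega
    · rintro rfl
      exact h1
  simp only [resInd]
  rw [sum_congr rfl fun j hj => if_congr (key j hj) rfl rfl, sum_ite_eq' (range p) j₀,
    if_pos (mem_range.2 hj₀)]

lemma abs_sum_Ico_sub_shift_le (f : ℤ → ℝ) {C : ℝ} (hf : ∀ n, |f n| ≤ C) (A B : ℤ) (s : ℕ) :
    |∑ n ∈ Ico A B, f n - ∑ n ∈ Ico A B, f (n + s)| ≤ 2 * C * s := by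
  induction s with
  | zero => simp
  | succ s ih =>
    have h1 : |∑ n ∈ Ico A B, f (n + s) - ∑ n ∈ Ico A B, f (n + (s + 1 : ℕ))| ≤ 2 * C := by
      rcases lt_or_ge B A with h | h
      · rw [Ico_eq_empty (by omega)]
        have := (abs_nonneg _).trans (hf 0)
        simpa using this
      have h2 : ∑ n ∈ Ico A B, f (n + (s + 1 : ℕ)) = ∑ n ∈ Ico (A + 1) (B + 1), f (n + s) := by
        rw [← map_add_right_Ico, sum_map]
        refine sum_congr rfl fun n _ => ?_
        simp only [addRightEmbedding_apply]
        congr 1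
        push_cast
        ring
      have h3 : f (A + s) + ∑ n ∈ Ico (A + 1) (B + 1), f (n + s) =
          f (B + s) + ∑ n ∈ Ico A B, f (n + s) := by
        have e1 := sum_insert (s := Ico (A + 1) (B + 1)) (a := A) (f := fun n => f (n + s))
          (by simp)
        have e2 := sum_insert (s := Ico A B) (a := B) (f := fun n => f (n + s)) (by simp)
        have e3 : insert A (Ico (A + 1) (B + 1)) = insert B (Ico A B) := by
          ext n
          simp only [mem_insert, mem_Ico]
          omega
        rw [← e1, ← e2, e3]
      have h4 : ∑ n ∈ Ico A B, f (n + s) - ∑ n ∈ Ico A B, f (n + (s + 1 : ℕ)) =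
          f (A + s) - f (B + s) := by
        rw [h2]
        linarith
      rw [h4]
      exact (abs_sub _ _).trans (by linarith [hf (A + s), hf (B + s)])
    calc _ = |(∑ n ∈ Ico A B, f n - ∑ n ∈ Ico A B, f (n + s)) +
        (∑ n ∈ Ico A B, f (n + s) - ∑ n ∈ Ico A B, f (n + (s + 1 : ℕ)))| := by rw [sub_add_sub_cancel]
      _ ≤ _ := (abs_add_le _ _).trans (add_le_add ih h1)
      _ = _ := by push_cast; ring

/-- The balanced indicator function of a residue class, with a weight. -/
noncomputable def balInd (ε : ℕ → ℝ) (a : ℕ → ℤ) (p : ℕ) (n : ℤ) : ℝ :=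
  ε p * (resInd a p n - 1 / p)

lemma abs_balInd_le {ε : ℕ → ℝ} (hε : ∀ p, |ε p| ≤ 1) (a : ℕ → ℤ) (p : ℕ) (n : ℤ) :
    |balInd ε a p n| ≤ resInd a p n + 1 / p := by
  rw [balInd, abs_mul]
  have h1 : 0 ≤ resInd a p n := resInd_nonneg _ _ _
  have h2 : (0 : ℝ) ≤ 1 / p := by positivity
  have h3 : |resInd a p n - 1 / p| ≤ resInd a p n + 1 / p := by
    rw [abs_le]
    constructor <;> linarith
  exact (mul_le_of_le_one_left (abs_nonneg _) (hε p)).trans h3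

lemma abs_balInd_le_one {ε : ℕ → ℝ} (hε : ∀ p, |ε p| ≤ 1) (a : ℕ → ℤ) {p : ℕ} (hp : p.Prime)
    (n : ℤ) : |balInd ε a p n| ≤ 1 := by
  rw [balInd, abs_mul]
  have h1 := resInd_nonneg a p n
  have h1' := resInd_le_one a p n
  have h2 : (0 : ℝ) ≤ 1 / p := by positivity
  have h2' : (1 : ℝ) / p ≤ 1 := by
    rw [div_le_one (by exact_mod_cast hp.pos)]
    exact_mod_cast hp.one_lt.le
  have h3 : |resInd a p n - 1 / p| ≤ 1 := by
    rw [abs_le]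
    constructor <;> linarith
  exact mul_le_one₀ (hε p) (abs_nonneg _) h3

lemma balInd_add_of_dvd (ε : ℕ → ℝ) (a : ℕ → ℤ) (p : ℕ) {Q : ℤ} (hQ : (p : ℤ) ∣ Q) (n : ℤ) :
    balInd ε a p (n + Q) = balInd ε a p n := by
  rw [balInd, resInd_add_of_dvd a p hQ, balInd]

lemma sum_balInd_progression (ε : ℕ → ℝ) (a : ℕ → ℤ) {p : ℕ} (hp : p.Prime) {Q : ℕ}
    (hQ : p.Coprime Q) (n : ℤ) : ∑ j ∈ range p, balInd ε a p (n + j * Q) = 0 := by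
  simp only [balInd, ← mul_sum, sum_sub_distrib, sum_resInd_progression a hp hQ]
  have : (p : ℝ) ≠ 0 := by exact_mod_cast hp.ne_zero
  simp [this]

lemma abs_sum_balInd_mul_periodic_le {ε : ℕ → ℝ} (hε : ∀ p, |ε p| ≤ 1) (a : ℕ → ℤ) {p : ℕ}
    (hp : p.Prime) {Q : ℕ} (hQ : p.Coprime Q) {Ψ : ℤ → ℝ} (hΨ : ∀ n, Ψ (n + Q) = Ψ n)
    (hΨ1 : ∀ n, |Ψ n| ≤ 1) (A B : ℤ) :
    |∑ n ∈ Ico A B, balInd ε a p n * Ψ n| ≤ 2 * (p * Q) := by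
  have hp0 : (0 : ℝ) < p := by exact_mod_cast hp.pos
  let f : ℤ → ℝ := fun n => balInd ε a p n * Ψ n
  have hf : ∀ n, |f n| ≤ 1 := fun n => by
    rw [abs_mul]
    exact mul_le_one₀ (abs_balInd_le_one hε a hp n) (abs_nonneg _) (hΨ1 n)
  have hΨj : ∀ (j : ℕ) n, Ψ (n + j * Q) = Ψ n := fun j => by
    induction j with
    | zero => simp
    | succ j ih =>
      intro n
      rw [← ih n, ← hΨ (n + j * Q)]
      congr 1
      push_cast
      ring
  have h1 : ∑ j ∈ range p, ∑ n ∈ Ico A B, f (n + (j * Q : ℕ)) = 0 := by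
    rw [sum_comm]
    refine sum_eq_zero fun n _ => ?_
    simp only [f, Nat.cast_mul, hΨj]
    rw [← sum_mul, sum_balInd_progression ε a hp hQ, zero_mul]
  have h2 : p * ∑ n ∈ Ico A B, f n =
      ∑ j ∈ range p, (∑ n ∈ Ico A B, f n - ∑ n ∈ Ico A B, f (n + (j * Q : ℕ))) := by
    rw [sum_sub_distrib, h1]
    simp
  have h3 : |p * ∑ n ∈ Ico A B, f n| ≤ ∑ _j ∈ range p, 2 * ((p : ℝ) * Q) := by
    rw [h2]
    refine (abs_sum_le_sum_abs _ _).trans (sum_le_sum fun j hj => ?_)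
    refine (abs_sum_Ico_sub_shift_le f hf A B (j * Q)).trans ?_
    have : (j : ℝ) ≤ p := by exact_mod_cast (mem_range.1 hj).le
    push_cast
    rw [mul_one]
    gcongr
  rw [abs_mul, abs_of_pos hp0, sum_const, card_range, nsmul_eq_mul] at h3
  exact le_of_mul_le_mul_left h3 hp0

lemma abs_sum_balInd_mul_prod_le {ε : ℕ → ℝ} (hε : ∀ p, |ε p| ≤ 1) (a : ℕ → ℤ) {I : Finset ℕ}
    (hI : ∀ p ∈ I, p.Prime) {P : ℕ} (hP : ∀ p ∈ I, p ≤ P) {p : ℕ} (hp : p ∈ I) {Ω : Type}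
    [Fintype Ω] (o : Ω → ℤ) (A B : ℤ) :
    |∑ n ∈ Ico A B, balInd ε a p n * ∏ ω, ∑ q ∈ I.erase p, balInd ε a q (n + o ω)| ≤
      (I.card : ℝ) ^ Fintype.card Ω * (2 * P ^ (Fintype.card Ω + 1)) := by
  have h1 : ∀ n, balInd ε a p n * ∏ ω, ∑ q ∈ I.erase p, balInd ε a q (n + o ω) =
      ∑ τ ∈ Fintype.piFinset fun _ : Ω => I.erase p,
        balInd ε a p n * ∏ ω, balInd ε a (τ ω) (n + o ω) := fun n => by
    rw [prod_univ_sum, mul_sum]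
  simp only [h1]
  rw [sum_comm]
  refine (abs_sum_le_sum_abs _ _).trans ?_
  have h2 : ∀ τ ∈ Fintype.piFinset fun _ : Ω => I.erase p,
      |∑ n ∈ Ico A B, balInd ε a p n * ∏ ω, balInd ε a (τ ω) (n + o ω)| ≤
        2 * P ^ (Fintype.card Ω + 1) := by
    intro τ hτ
    rw [Fintype.mem_piFinset] at hτ
    have hτI : ∀ ω, τ ω ∈ I := fun ω => mem_of_mem_erase (hτ ω)
    refine (abs_sum_balInd_mul_periodic_le hε a (hI p hp) (Q := ∏ ω, τ ω)
      (Nat.Coprime.prod_right fun ω _ => (Nat.coprime_primes (hI p hp) (hI _ (hτI ω))).2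
        (ne_of_mem_erase (hτ ω)).symm) (fun n => ?_) (fun n => ?_) A B).trans ?_
    · refine prod_congr rfl fun ω _ => ?_
      rw [add_right_comm]
      exact balInd_add_of_dvd _ _ _ (by exact_mod_cast dvd_prod_of_mem τ (mem_univ ω)) _
    · rw [abs_prod]
      exact prod_le_one (fun ω _ => abs_nonneg _) fun ω _ =>
        abs_balInd_le_one hε a (hI _ (hτI ω)) _
    · have h3 : ((∏ ω, τ ω : ℕ) : ℝ) ≤ P ^ Fintype.card Ω := by
        have : ∏ ω, τ ω ≤ ∏ _ω : Ω, P := prod_le_prod' fun ω _ => hP _ (hτI ω)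
        rw [prod_const, card_univ] at this
        exact_mod_cast this
      have h4 : (p : ℝ) ≤ P := by exact_mod_cast hP p hp
      rw [pow_succ']
      gcongr
  refine (sum_le_sum h2).trans ?_
  rw [sum_const, nsmul_eq_mul, Fintype.card_piFinset, prod_const, card_univ]
  push_cast
  gcongr
  exact erase_subset _ _

lemma abs_prod_add_sub_prod_le {Ω : Type*} (s : Finset Ω) {x y c : Ω → ℝ}
    (hx : ∀ ω ∈ s, |x ω| ≤ c ω) (hxy : ∀ ω ∈ s, |x ω + y ω| ≤ c ω) :
    |∏ ω ∈ s, (x ω + y ω) - ∏ ω ∈ s, x ω| ≤ ∑ ω ∈ s, |y ω| * ∏ ω' ∈ s, (1 + c ω') := by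
  induction s using Finset.induction_on with
  | empty => simp
  | insert b s hb ih =>
    have hx' : ∀ ω ∈ s, |x ω| ≤ c ω := fun ω h => hx ω (mem_insert_of_mem h)
    have ih' := ih hx' fun ω h => hxy ω (mem_insert_of_mem h)
    have hc : ∀ ω ∈ s, 0 ≤ c ω := fun ω h => (abs_nonneg _).trans (hx' ω h)
    have hcb : 0 ≤ c b := (abs_nonneg _).trans (hx b (mem_insert_self _ _))
    set T := ∏ ω' ∈ s, (1 + c ω') with hT
    have hT0 : 0 ≤ T := prod_nonneg fun ω h => by linarith [hc ω h]
    have h1 : |∏ ω ∈ s, x ω| ≤ T := by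
      rw [abs_prod]
      exact prod_le_prod (fun ω _ => abs_nonneg _) fun ω h => by linarith [hx' ω h]
    have hb2 := hxy b (mem_insert_self _ _)
    rw [prod_insert hb, prod_insert hb, sum_insert hb, prod_insert hb, ← hT]
    have h2 : (x b + y b) * ∏ ω ∈ s, (x ω + y ω) - x b * ∏ ω ∈ s, x ω =
        (x b + y b) * (∏ ω ∈ s, (x ω + y ω) - ∏ ω ∈ s, x ω) + y b * ∏ ω ∈ s, x ω := by ring
    rw [h2]
    refine (abs_add_le _ _).trans ?_
    rw [abs_mul, abs_mul]
    have h3 : |x b + y b| * |∏ ω ∈ s, (x ω + y ω) - ∏ ω ∈ s, x ω| ≤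
        c b * ∑ ω ∈ s, |y ω| * T := by gcongr
    have h4 : |y b| * |∏ ω ∈ s, x ω| ≤ |y b| * T := by gcongr
    have h5 : |y b| * T ≤ |y b| * ((1 + c b) * T) := by
      gcongr
      nlinarith
    have h6 : ∑ ω ∈ s, |y ω| * ((1 + c b) * T) = (1 + c b) * ∑ ω ∈ s, |y ω| * T := by
      rw [mul_sum]
      exact sum_congr rfl fun ω _ => by ring
    have h7 : 0 ≤ ∑ ω ∈ s, |y ω| * T := sum_nonneg fun ω _ => by positivity
    rw [h6]
    nlinarith

lemma exists_Ico_eq_filter {Ω : Type*} (s : Finset Ω) (o : Ω → ℤ) (N : ℕ) :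
    ∃ A B : ℤ, ∀ n, n ∈ Ico A B ↔ n ∈ Ico (0 : ℤ) N ∧ ∀ ω ∈ s, n + o ω ∈ Ico (0 : ℤ) N := by
  induction s using Finset.induction_on with
  | empty => exact ⟨0, N, by simp⟩
  | insert b s _ ih =>
    obtain ⟨A, B, h⟩ := ih
    refine ⟨max A (-o b), min B (N - o b), ?_⟩
    intro n
    rw [forall_mem_insert, and_left_comm, ← h n]
    simp only [mem_Ico]
    omega

lemma sum_prod_resInd_le (a : ℕ → ℤ) {D : Finset ℕ} (hD : ∀ p ∈ D, p.Prime) (N : ℕ) :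
    ∑ n ∈ Ico (0 : ℤ) N, ∏ p ∈ D, resInd a p n ≤ N / ∏ p ∈ D, (p : ℝ) + 1 := by
  have hd0 : 0 < ∏ p ∈ D, p := prod_pos fun p hp => (hD p hp).pos
  have hnn : (0 : ℝ) ≤ N / ∏ p ∈ D, (p : ℝ) := by positivity
  have h1 : ∀ n, ∏ p ∈ D, resInd a p n = if ∀ p ∈ D, (p : ℤ) ∣ n - a p then 1 else 0 := fun n => by
    simp only [resInd]
    rw [prod_ite_zero]
    simp
  simp only [h1]
  rw [sum_boole]
  rcases (filter (fun n : ℤ => ∀ p ∈ D, (p : ℤ) ∣ n - a p) (Ico (0 : ℤ) N)).eq_empty_or_nonempty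
    with h | ⟨v, hv⟩
  · rw [h]
    simp only [card_empty, Nat.cast_zero]
    linarith
  · have hsub : filter (fun n : ℤ => ∀ p ∈ D, (p : ℤ) ∣ n - a p) (Ico (0 : ℤ) N) ⊆
        filter (fun n : ℤ => n ≡ v [ZMOD ((∏ p ∈ D, p : ℕ) : ℤ)]) (Ico (0 : ℤ) N) := by
      intro n hn
      rw [mem_filter] at hn hv ⊢
      refine ⟨hn.1, Int.ModEq.symm ((Int.modEq_iff_dvd).2 ?_)⟩
      push_cast
      refine Finset.prod_dvd_of_coprime (fun p hp q hq hpq => ?_) fun p hp => ?_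
      · exact Nat.isCoprime_iff_coprime.2 ((Nat.coprime_primes (hD p hp) (hD q hq)).2 hpq)
      · have := dvd_sub (hn.2 p hp) (hv.2 p hp)
        rwa [sub_sub_sub_cancel_right] at this
    have hcard := Int.Ico_filter_modEq_card (0 : ℤ) N (r := ((∏ p ∈ D, p : ℕ) : ℤ))
      (by exact_mod_cast hd0) v
    have h2 : ((filter (fun n : ℤ => n ≡ v [ZMOD ((∏ p ∈ D, p : ℕ) : ℤ)])
        (Ico (0 : ℤ) N)).card : ℝ) ≤ N / ∏ p ∈ D, (p : ℝ) + 1 := by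
      set d : ℤ := ((∏ p ∈ D, p : ℕ) : ℤ) with hd
      have hd0' : (0 : ℚ) < (d : ℚ) := by
        rw [hd]
        exact_mod_cast hd0
      set u : ℚ := ((N : ℤ) - v : ℚ) / d with hu
      set w : ℚ := ((0 : ℤ) - v : ℚ) / d with hw
      have huw : u - w = N / d := by
        rw [hu, hw, ← sub_div]
        push_cast
        ring_nf
      have hle : ((⌈u⌉ - ⌈w⌉ : ℤ) : ℚ) ≤ N / d + 1 := by
        push_cast
        have := Int.ceil_lt_add_one u
        have := Int.le_ceil w
        linarith
      have hnn' : (0 : ℚ) ≤ N / d + 1 := by positivity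
      have h3 : ((filter (fun n : ℤ => n ≡ v [ZMOD d]) (Ico (0 : ℤ) N)).card : ℚ) ≤
          N / d + 1 := by
        have : (((filter (fun n : ℤ => n ≡ v [ZMOD d]) (Ico (0 : ℤ) N)).card : ℤ) : ℚ) ≤
          N / d + 1 := by
          rw [hcard]
          push_cast
          push_cast at hle
          exact max_le hle hnn'
        exact_mod_cast this
      have h4 : (((filter (fun n : ℤ => n ≡ v [ZMOD d]) (Ico (0 : ℤ) N)).card : ℚ) : ℝ) ≤
          ((N / d + 1 : ℚ) : ℝ) := by exact_mod_cast h3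
      rw [hd] at h4 ⊢
      push_cast at h4 ⊢
      exact h4
    exact le_trans (by exact_mod_cast card_le_card hsub) h2

lemma sum_prod_resInd_le_two_mul (a : ℕ → ℤ) {D : Finset ℕ} (hD : ∀ p ∈ D, p.Prime) {N : ℕ}
    (hN : ∏ p ∈ D, p ≤ N) :
    ∑ n ∈ Ico (0 : ℤ) N, ∏ p ∈ D, resInd a p n ≤ 2 * N / ∏ p ∈ D, (p : ℝ) := by
  refine (sum_prod_resInd_le a hD N).trans ?_
  have hd0 : (0 : ℝ) < ∏ p ∈ D, (p : ℝ) :=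
    prod_pos fun p hp => by exact_mod_cast (hD p hp).pos
  have : (1 : ℝ) ≤ N / ∏ p ∈ D, (p : ℝ) := by
    rw [one_le_div hd0, ← Nat.cast_prod]
    exact_mod_cast hN
  rw [mul_div_assoc]
  linarith

/-- The constants in the moment bounds for the number of residue classes containing a point. -/
noncomputable def momentConst (C : ℝ) : ℕ → ℕ → ℝ
  | 0, _ => 2
  | m + 1, t => t * momentConst C m t + C * momentConst C m (t + 1)

lemma momentConst_nonneg {C : ℝ} (hC : 0 ≤ C) (m t : ℕ) : 0 ≤ momentConst C m t := by
  induction m generalizing t with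
  | zero => norm_num [momentConst]
  | succ m ih =>
    have := ih t
    have := ih (t + 1)
    rw [momentConst]
    positivity

lemma sum_prod_resInd_mul_pow_le (a : ℕ → ℤ) {I : Finset ℕ} (hI : ∀ p ∈ I, p.Prime) {C : ℝ}
    (hC : ∑ p ∈ I, (1 : ℝ) / p ≤ C) {P N : ℕ} (hP : ∀ p ∈ I, p ≤ P) (hP0 : 0 < P) (m : ℕ) :
    ∀ D ⊆ I, P ^ (D.card + m) ≤ N →
      ∑ n ∈ Ico (0 : ℤ) N, (∏ p ∈ D, resInd a p n) * (∑ p ∈ I, resInd a p n) ^ m ≤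
        momentConst C m D.card * (N / ∏ p ∈ D, (p : ℝ)) := by
  have hC0 : 0 ≤ C := (sum_nonneg fun p _ => by positivity).trans hC
  induction m with
  | zero =>
    intro D hDI hN
    have h1 : ∏ p ∈ D, p ≤ N := by
      refine le_trans ?_ hN
      rw [add_zero, ← prod_const]
      exact prod_le_prod' fun p hp => hP p (hDI hp)
    simpa [momentConst, mul_div_assoc] using
      sum_prod_resInd_le_two_mul a (fun p hp => hI p (hDI hp)) h1
  | succ m ih =>
    intro D hDI hN
    have hsplit : ∀ n, (∏ p ∈ D, resInd a p n) * (∑ p ∈ I, resInd a p n) ^ (m + 1) =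
        ∑ q ∈ I, (∏ p ∈ insert q D, resInd a p n) * (∑ p ∈ I, resInd a p n) ^ m := fun n => by
      rw [pow_succ, ← mul_assoc, mul_sum]
      refine sum_congr rfl fun q _ => ?_
      by_cases hq : q ∈ D
      · rw [insert_eq_of_mem hq, ← mul_prod_erase D _ hq]
        have : resInd a q n * resInd a q n = resInd a q n := by
          rw [resInd]
          split_ifs <;> norm_num
        linear_combination (∏ x ∈ D.erase q, resInd a x n) * (∑ p ∈ I, resInd a p n) ^ m * this
      · rw [prod_insert hq]
        ring
    simp only [hsplit]
    rw [sum_comm, ← sum_sdiff hDI, add_comm]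
    have hPN : P ^ (D.card + m) ≤ N := (Nat.pow_le_pow_right hP0 (by omega)).trans hN
    have h1 : ∑ q ∈ D, ∑ n ∈ Ico (0 : ℤ) N,
        (∏ p ∈ insert q D, resInd a p n) * (∑ p ∈ I, resInd a p n) ^ m ≤
        D.card * (momentConst C m D.card * (N / ∏ p ∈ D, (p : ℝ))) := by
      rw [← nsmul_eq_mul, ← sum_const]
      refine sum_le_sum fun q hq => ?_
      rw [insert_eq_of_mem hq]
      exact ih D hDI hPN
    have hX : 0 ≤ momentConst C m (D.card + 1) * (N / ∏ p ∈ D, (p : ℝ)) :=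
      mul_nonneg (momentConst_nonneg hC0 _ _) (by positivity)
    have h2 : ∑ q ∈ I \ D, ∑ n ∈ Ico (0 : ℤ) N,
        (∏ p ∈ insert q D, resInd a p n) * (∑ p ∈ I, resInd a p n) ^ m ≤
        ∑ q ∈ I \ D, (1 : ℝ) / q * (momentConst C m (D.card + 1) * (N / ∏ p ∈ D, (p : ℝ))) := by
      refine sum_le_sum fun q hq => ?_
      rw [Finset.mem_sdiff] at hq
      have := ih (insert q D) (insert_subset hq.1 hDI)
        (by rwa [card_insert_of_notMem hq.2, add_assoc, add_comm 1 m])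
      rw [card_insert_of_notMem hq.2, prod_insert (f := fun p : ℕ => (p : ℝ)) hq.2] at this
      refine this.trans (le_of_eq ?_)
      rw [div_mul_eq_div_div_swap]
      ring
    have h3 : ∑ q ∈ I \ D, (1 : ℝ) / q ≤ C :=
      (sum_le_sum_of_subset_of_nonneg sdiff_subset fun _ _ _ => by positivity).trans hC
    rw [← sum_mul] at h2
    have h4 := mul_le_mul_of_nonneg_right h3 hX
    rw [momentConst, add_mul, mul_assoc, mul_assoc]
    linarith

lemma sum_one_add_pow_le (a : ℕ → ℤ) {I : Finset ℕ} (hI : ∀ p ∈ I, p.Prime) {C : ℝ}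
    (hC : ∑ p ∈ I, (1 : ℝ) / p ≤ C) {P N : ℕ} (hP : ∀ p ∈ I, p ≤ P) (hP0 : 0 < P) (m : ℕ)
    (hN : P ^ m ≤ N) :
    ∑ n ∈ Ico (0 : ℤ) N, (1 + ∑ p ∈ I, (resInd a p n + 1 / p)) ^ m ≤
      2 ^ m * ((1 + C) ^ m + momentConst C m 0) * N := by
  have hC0 : 0 ≤ C := (sum_nonneg fun p _ => by positivity).trans hC
  have h1 := sum_prod_resInd_mul_pow_le a hI hC hP hP0 m ∅ (empty_subset _) (by simpa using hN)
  simp only [prod_empty, one_mul, card_empty, div_one] at h1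
  have h2 : ∀ n, (1 + ∑ p ∈ I, (resInd a p n + 1 / p)) ^ m ≤
      2 ^ m * ((1 + C) ^ m + (∑ p ∈ I, resInd a p n) ^ m) := fun n => by
    have hν : 0 ≤ ∑ p ∈ I, resInd a p n := sum_nonneg fun p _ => resInd_nonneg _ _ _
    have hinv : (0 : ℝ) ≤ ∑ p ∈ I, (1 : ℝ) / p := sum_nonneg fun p _ => by positivity
    set ν := ∑ p ∈ I, resInd a p n with hνdef
    rw [sum_add_distrib, ← hνdef]
    have h3 : 1 + (ν + ∑ p ∈ I, (1 : ℝ) / p) ≤ 2 * max (1 + C) ν := by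
      have := le_max_left (1 + C) ν
      have := le_max_right (1 + C) ν
      linarith
    calc _ ≤ (2 * max (1 + C) ν) ^ m := by gcongr
      _ = 2 ^ m * (max (1 + C) ν) ^ m := by rw [mul_pow]
      _ ≤ _ := by
        gcongr
        rcases max_cases (1 + C) ν with h | h <;> rw [h.1]
        · have : 0 ≤ ν ^ m := by positivity
          linarith
        · have : 0 ≤ (1 + C) ^ m := by positivity
          linarith
  refine (sum_le_sum fun n _ => h2 n).trans ?_
  rw [← mul_sum, sum_add_distrib, sum_const, Int.card_Ico, nsmul_eq_mul, mul_assoc]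
  gcongr
  simp only [sub_zero, Int.toNat_natCast]
  linarith

lemma sum_resInd_mul_resInd_le (a : ℕ → ℤ) {p q N : ℕ} (hp : p.Prime) (hq : q.Prime)
    (hpq : p * q ≤ N) :
    ∑ n ∈ Ico (0 : ℤ) N, (resInd a p n + 1 / p) * (resInd a q n + 1 / q) ≤
      7 * N / (p * q) + if p = q then 7 * (N : ℝ) / p else 0 := by
  have hp0 : (0 : ℝ) < p := by exact_mod_cast hp.pos
  have hq0 : (0 : ℝ) < q := by exact_mod_cast hq.pos
  have hs : ∀ r : ℕ, r.Prime → r ≤ N → ∑ n ∈ Ico (0 : ℤ) N, resInd a r n ≤ 2 * N / r := by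
    intro r hr hrN
    have := sum_prod_resInd_le_two_mul a (D := {r}) (N := N) (by simpa using hr) (by simpa using hrN)
    simpa using this
  have hp1 := hs p hp ((Nat.le_mul_of_pos_right p hq.pos).trans hpq)
  have hq1 := hs q hq ((Nat.le_mul_of_pos_left q hp.pos).trans hpq)
  have h1 : ∑ n ∈ Ico (0 : ℤ) N, (resInd a p n + 1 / p) * (resInd a q n + 1 / q) =
      ∑ n ∈ Ico (0 : ℤ) N, resInd a p n * resInd a q n +
        (1 / q * ∑ n ∈ Ico (0 : ℤ) N, resInd a p n + 1 / p * ∑ n ∈ Ico (0 : ℤ) N, resInd a q n +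
          N * (1 / p * (1 / q))) := by
    rw [mul_sum, mul_sum, ← sum_add_distrib]
    have : (N : ℝ) * (1 / p * (1 / q)) = ∑ n ∈ Ico (0 : ℤ) N, (1 / p * (1 / q) : ℝ) := by
      simp
    rw [this, ← sum_add_distrib, ← sum_add_distrib]
    exact sum_congr rfl fun n _ => by ring
  have h2 : 1 / q * ∑ n ∈ Ico (0 : ℤ) N, resInd a p n +
      1 / p * ∑ n ∈ Ico (0 : ℤ) N, resInd a q n + N * (1 / p * (1 / q)) ≤
      5 * N / (p * q : ℝ) := by
    calc _ ≤ 1 / q * (2 * N / p) + 1 / p * (2 * N / q) + N * (1 / p * (1 / q) : ℝ) := by gcongr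
      _ = _ := by field_simp; ring
  have h3 : ∑ n ∈ Ico (0 : ℤ) N, resInd a p n * resInd a q n ≤
      2 * N / (p * q) + if p = q then 7 * (N : ℝ) / p else 0 := by
    by_cases h : p = q
    · subst h
      rw [if_pos rfl]
      have h4 : ∀ n, resInd a p n * resInd a p n = resInd a p n := fun n => by
        rw [resInd]
        split_ifs <;> norm_num
      simp only [h4]
      have h5 : (0 : ℝ) ≤ 2 * N / (p * p) := by positivity
      have h6 : (0 : ℝ) ≤ N / p := by positivity
      rw [mul_div_assoc] at hp1 ⊢
      rw [mul_div_assoc] at h5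
      rw [mul_div_assoc]
      linarith
    · rw [if_neg h, add_zero]
      have := sum_prod_resInd_le_two_mul a (D := {p, q}) (N := N)
        (by simp [hp, hq]) (by rwa [prod_pair h])
      simpa [prod_pair h] using this
  rw [h1]
  have h4 : 7 * (N : ℝ) / (p * q) = 2 * N / (p * q) + 5 * N / (p * q) := by ring
  rw [h4]
  linarith

lemma sum_sum_sq_le (a : ℕ → ℤ) {I : Finset ℕ} (hI : ∀ p ∈ I, p.Prime) {C : ℝ}
    (hC : ∑ p ∈ I, (1 : ℝ) / p ≤ C) {P N y : ℕ} (hP : ∀ p ∈ I, p ≤ P) (hN : P ^ 2 ≤ N)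
    (hy : ∀ p ∈ I, y ≤ p) (hy0 : 0 < y) :
    ∑ n ∈ Ico (0 : ℤ) N, ∑ n' ∈ Ico (0 : ℤ) N,
      (∑ p ∈ I, (resInd a p n + 1 / p) * (resInd a p n' + 1 / p)) ^ 2 ≤
      98 * (C ^ 2 + C) * N ^ 2 / y := by
  have hC0 : 0 ≤ C := (sum_nonneg fun p _ => by positivity).trans hC
  have hy0' : (0 : ℝ) < y := by exact_mod_cast hy0
  have h1 : ∑ n ∈ Ico (0 : ℤ) N, ∑ n' ∈ Ico (0 : ℤ) N,
      (∑ p ∈ I, (resInd a p n + 1 / p) * (resInd a p n' + 1 / p)) ^ 2 =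
      ∑ p ∈ I, ∑ q ∈ I,
        (∑ n ∈ Ico (0 : ℤ) N, (resInd a p n + 1 / p) * (resInd a q n + 1 / q)) ^ 2 := by
    simp only [sq, sum_mul_sum]
    have e1 : ∀ n n' : ℤ, ∑ p ∈ I, ∑ q ∈ I, (resInd a p n + 1 / p) * (resInd a p n' + 1 / p) *
        ((resInd a q n + 1 / q) * (resInd a q n' + 1 / q)) = ∑ p ∈ I, ∑ q ∈ I,
        (resInd a p n + 1 / p) * (resInd a q n + 1 / q) *
        ((resInd a p n' + 1 / p) * (resInd a q n' + 1 / q)) := fun n n' =>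
      sum_congr rfl fun p _ => sum_congr rfl fun q _ => by ring
    simp only [e1]
    calc _ = ∑ n ∈ Ico (0 : ℤ) N, ∑ p ∈ I, ∑ n' ∈ Ico (0 : ℤ) N, ∑ q ∈ I, _ :=
          sum_congr rfl fun n _ => sum_comm
      _ = ∑ p ∈ I, ∑ n ∈ Ico (0 : ℤ) N, ∑ n' ∈ Ico (0 : ℤ) N, ∑ q ∈ I, _ := sum_comm
      _ = ∑ p ∈ I, ∑ n ∈ Ico (0 : ℤ) N, ∑ q ∈ I, ∑ n' ∈ Ico (0 : ℤ) N, _ :=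
          sum_congr rfl fun p _ => sum_congr rfl fun n _ => sum_comm
      _ = _ := sum_congr rfl fun p _ => sum_comm
  rw [h1]
  have h2 : ∀ p ∈ I, ∀ q ∈ I,
      (∑ n ∈ Ico (0 : ℤ) N, (resInd a p n + 1 / p) * (resInd a q n + 1 / q)) ^ 2 ≤
      98 * N ^ 2 / y * (1 / p * (1 / q)) + if p = q then 98 * (N : ℝ) ^ 2 / y * (1 / p) else 0 := by
    intro p hp q hq
    have hp0 : (0 : ℝ) < p := by exact_mod_cast (hI p hp).pos
    have hq0 : (0 : ℝ) < q := by exact_mod_cast (hI q hq).pos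
    have hyp : (y : ℝ) ≤ p := by exact_mod_cast hy p hp
    have hyq : (y : ℝ) ≤ q := by exact_mod_cast hy q hq
    have hpq : p * q ≤ N := (Nat.mul_le_mul (hP p hp) (hP q hq)).trans (by rwa [← sq])
    have h3 := sum_resInd_mul_resInd_le a (hI p hp) (hI q hq) hpq
    have hnn : 0 ≤ ∑ n ∈ Ico (0 : ℤ) N, (resInd a p n + 1 / p) * (resInd a q n + 1 / q) :=
      sum_nonneg fun n _ => by
        have := resInd_nonneg a p n
        have := resInd_nonneg a q n
        positivity
    have h4 : (7 * N / (p * q : ℝ)) ^ 2 ≤ 49 * N ^ 2 / y * (1 / p * (1 / q)) := by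
      have : (7 * N / (p * q : ℝ)) ^ 2 = 49 * N ^ 2 / (p * q) * (1 / p * (1 / q)) := by
        field_simp
        ring
      rw [this]
      gcongr
      have : (1 : ℝ) ≤ q := by exact_mod_cast (hI q hq).one_lt.le
      nlinarith
    have h5 : (if p = q then 7 * (N : ℝ) / p else 0) ^ 2 ≤
        if p = q then 49 * (N : ℝ) ^ 2 / y * (1 / p) else 0 := by
      split_ifs
      · have : (7 * (N : ℝ) / p) ^ 2 = 49 * N ^ 2 / p * (1 / p) := by
          field_simp
          ring
        rw [this]
        gcongr
      · norm_num
    have h6 : (if p = q then 98 * (N : ℝ) ^ 2 / y * (1 / p) else 0) =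
        2 * if p = q then 49 * (N : ℝ) ^ 2 / y * (1 / p) else 0 := by
      split_ifs <;> ring
    have h7 : 98 * (N : ℝ) ^ 2 / y = 2 * (49 * N ^ 2 / y) := by ring
    rw [h6, h7]
    refine (pow_le_pow_left₀ hnn h3 2).trans (add_sq_le.trans ?_)
    linarith
  refine (sum_le_sum fun p hp => sum_le_sum fun q hq => h2 p hp q hq).trans ?_
  have h3 : ∑ p ∈ I, ∑ q ∈ I, (98 * (N : ℝ) ^ 2 / y * (1 / p * (1 / q)) +
      if p = q then 98 * (N : ℝ) ^ 2 / y * (1 / p) else 0) =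
      98 * N ^ 2 / y * ((∑ p ∈ I, (1 : ℝ) / p) ^ 2 + ∑ p ∈ I, (1 : ℝ) / p) := by
    simp only [sum_add_distrib, sum_ite_eq]
    rw [sum_congr rfl fun p hp => if_pos hp, mul_add, sq (∑ p ∈ I, (1 : ℝ) / p), sum_mul_sum, mul_sum, mul_sum]
    simp only [mul_sum]
  rw [h3, show 98 * (C ^ 2 + C) * (N : ℝ) ^ 2 / y = 98 * N ^ 2 / y * (C ^ 2 + C) by ring]
  have : (0 : ℝ) ≤ ∑ p ∈ I, (1 : ℝ) / p := sum_nonneg fun p _ => by positivity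
  gcongr

/-- The sum over `I` of balanced indicators of residue classes, truncated to `[0, N)`. -/
noncomputable def balSum (ε : ℕ → ℝ) (a : ℕ → ℤ) (I : Finset ℕ) (N : ℕ) (n : ℤ) : ℝ :=
  if n ∈ Ico (0 : ℤ) N then ∑ p ∈ I, balInd ε a p n else 0

/-- The natural majorant of `balSum`. -/
noncomputable def balMaj (a : ℕ → ℤ) (I : Finset ℕ) (N : ℕ) (n : ℤ) : ℝ :=
  if n ∈ Ico (0 : ℤ) N then ∑ p ∈ I, (resInd a p n + 1 / p) else 0

/-- The diagonal part of the product of two majorants. -/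
noncomputable def diagMaj (a : ℕ → ℤ) (I : Finset ℕ) (N : ℕ) (n n' : ℤ) : ℝ :=
  if n' ∈ Ico (0 : ℤ) N then ∑ p ∈ I, (resInd a p n + 1 / p) * (resInd a p n' + 1 / p) else 0

lemma resInd_add_inv_nonneg (a : ℕ → ℤ) (p : ℕ) (n : ℤ) : 0 ≤ resInd a p n + 1 / p :=
  add_nonneg (resInd_nonneg _ _ _) (by positivity)

lemma balMaj_nonneg (a : ℕ → ℤ) (I : Finset ℕ) (N : ℕ) (n : ℤ) : 0 ≤ balMaj a I N n := by
  rw [balMaj]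
  split_ifs
  · exact sum_nonneg fun p _ => resInd_add_inv_nonneg _ _ _
  · exact le_rfl

lemma diagMaj_nonneg (a : ℕ → ℤ) (I : Finset ℕ) (N : ℕ) (n n' : ℤ) : 0 ≤ diagMaj a I N n n' := by
  rw [diagMaj]
  split_ifs
  · exact sum_nonneg fun p _ =>
      mul_nonneg (resInd_add_inv_nonneg _ _ _) (resInd_add_inv_nonneg _ _ _)
  · exact le_rfl

lemma abs_sum_balSum_mul_prod_le {ε : ℕ → ℝ} (hε : ∀ p, |ε p| ≤ 1) (a : ℕ → ℤ) {I : Finset ℕ}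
    (hI : ∀ p ∈ I, p.Prime) {P : ℕ} (hP : ∀ p ∈ I, p ≤ P) {Ω : Type} [Fintype Ω] (o : Ω → ℤ)
    (N : ℕ) :
    |∑ n ∈ Ico (0 : ℤ) N, balSum ε a I N n * ∏ ω, balSum ε a I N (n + o ω)| ≤
      2 * P ^ (2 * Fintype.card Ω + 2) +
        ∑ n ∈ Ico (0 : ℤ) N, ∑ ω, diagMaj a I N n (n + o ω) *
          ∏ ω', (1 + balMaj a I N (n + o ω')) := by
  obtain ⟨A, B, hAB⟩ := exists_Ico_eq_filter (univ : Finset Ω) o N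
  have hmem : ∀ n ∈ Ico A B, n ∈ Ico (0 : ℤ) N ∧ ∀ ω, n + o ω ∈ Ico (0 : ℤ) N := fun n hn => by
    rw [hAB] at hn
    exact ⟨hn.1, fun ω => hn.2 ω (mem_univ _)⟩
  have hsub : Ico A B ⊆ Ico (0 : ℤ) N := fun n hn => (hmem n hn).1
  have h1 : ∑ n ∈ Ico (0 : ℤ) N, balSum ε a I N n * ∏ ω, balSum ε a I N (n + o ω) =
      ∑ n ∈ Ico A B, ∑ p ∈ I, balInd ε a p n * ∏ ω, ∑ q ∈ I, balInd ε a q (n + o ω) := by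
    rw [← sum_subset hsub]
    · refine sum_congr rfl fun n hn => ?_
      rw [balSum, if_pos (hmem n hn).1, sum_mul]
      refine sum_congr rfl fun p _ => ?_
      congr 1
      refine prod_congr rfl fun ω _ => ?_
      rw [balSum, if_pos ((hmem n hn).2 ω)]
    · intro n hn hn'
      rw [hAB, not_and] at hn'
      have := hn' hn
      push Not at this
      obtain ⟨ω, hω, h⟩ := this
      rw [prod_eq_zero hω, mul_zero]
      rw [balSum, if_neg h]
  have h2 : ∀ p ∈ I, ∀ n ∈ Ico A B,
      |balInd ε a p n * ∏ ω, ∑ q ∈ I, balInd ε a q (n + o ω) -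
        balInd ε a p n * ∏ ω, ∑ q ∈ I.erase p, balInd ε a q (n + o ω)| ≤
      ∑ ω, (resInd a p n + 1 / p) * (resInd a p (n + o ω) + 1 / p) *
        ∏ ω', (1 + balMaj a I N (n + o ω')) := by
    intro p hp n hn
    have hW : ∀ ω, balMaj a I N (n + o ω) = ∑ q ∈ I, (resInd a q (n + o ω) + 1 / q) :=
      fun ω => by rw [balMaj, if_pos ((hmem n hn).2 ω)]
    have h3 := abs_prod_add_sub_prod_le (univ : Finset Ω)
      (x := fun ω => ∑ q ∈ I.erase p, balInd ε a q (n + o ω))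
      (y := fun ω => balInd ε a p (n + o ω)) (c := fun ω => balMaj a I N (n + o ω))
      (fun ω _ => by
        rw [hW]
        refine (abs_sum_le_sum_abs _ _).trans ((sum_le_sum fun q _ =>
          abs_balInd_le hε a q _).trans ?_)
        exact sum_le_sum_of_subset_of_nonneg (erase_subset _ _)
          fun q _ _ => resInd_add_inv_nonneg _ _ _)
      (fun ω _ => by
        rw [hW, sum_erase_add I _ hp]
        exact (abs_sum_le_sum_abs _ _).trans (sum_le_sum fun q _ => abs_balInd_le hε a q _))
    simp only [sum_erase_add I _ hp] at h3
    rw [← mul_sub, abs_mul]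
    have h4 : ∑ ω, |balInd ε a p (n + o ω)| * ∏ ω', (1 + balMaj a I N (n + o ω')) ≤
        ∑ ω, (resInd a p (n + o ω) + 1 / p) * ∏ ω', (1 + balMaj a I N (n + o ω')) := by
      refine sum_le_sum fun ω _ => mul_le_mul_of_nonneg_right (abs_balInd_le hε a p _) ?_
      exact prod_nonneg fun ω' _ => by
        have := balMaj_nonneg a I N (n + o ω')
        positivity
    refine (mul_le_mul (abs_balInd_le hε a p n) (h3.trans h4) (abs_nonneg _)
      (resInd_add_inv_nonneg _ _ _)).trans (le_of_eq ?_)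
    rw [mul_sum]
    exact sum_congr rfl fun ω _ => by ring
  have h3 : |∑ p ∈ I, ∑ n ∈ Ico A B,
      balInd ε a p n * ∏ ω, ∑ q ∈ I.erase p, balInd ε a q (n + o ω)| ≤
      2 * P ^ (2 * Fintype.card Ω + 2) := by
    have hcard : (I.card : ℝ) ≤ P := by
      have : I ⊆ Icc 1 P := fun p hp => mem_Icc.2 ⟨(hI p hp).one_lt.le, hP p hp⟩
      have := card_le_card this
      rw [Nat.card_Icc, Nat.add_sub_cancel] at this
      exact_mod_cast this
    refine (abs_sum_le_sum_abs _ _).trans ((sum_le_sum fun p hp =>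
      abs_sum_balInd_mul_prod_le hε a hI hP hp o A B).trans ?_)
    rw [sum_const, nsmul_eq_mul]
    calc _ ≤ (P : ℝ) * (P ^ Fintype.card Ω * (2 * P ^ (Fintype.card Ω + 1))) := by gcongr
      _ = _ := by ring
  rw [h1, sum_comm]
  have h4 : ∑ p ∈ I, ∑ n ∈ Ico A B, balInd ε a p n * ∏ ω, ∑ q ∈ I, balInd ε a q (n + o ω) =
      ∑ p ∈ I, ∑ n ∈ Ico A B,
        balInd ε a p n * ∏ ω, ∑ q ∈ I.erase p, balInd ε a q (n + o ω) +
      ∑ p ∈ I, ∑ n ∈ Ico A B, (balInd ε a p n * ∏ ω, ∑ q ∈ I, balInd ε a q (n + o ω) -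
        balInd ε a p n * ∏ ω, ∑ q ∈ I.erase p, balInd ε a q (n + o ω)) := by
    simp only [sum_sub_distrib]
    ring
  rw [h4]
  refine (abs_add_le _ _).trans (add_le_add h3 ?_)
  refine (abs_sum_le_sum_abs _ _).trans ?_
  have h5 : ∑ p ∈ I, |∑ n ∈ Ico A B, (balInd ε a p n * ∏ ω, ∑ q ∈ I, balInd ε a q (n + o ω) -
      balInd ε a p n * ∏ ω, ∑ q ∈ I.erase p, balInd ε a q (n + o ω))| ≤
      ∑ p ∈ I, ∑ n ∈ Ico A B, ∑ ω, (resInd a p n + 1 / p) * (resInd a p (n + o ω) + 1 / p) *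
        ∏ ω', (1 + balMaj a I N (n + o ω')) :=
    sum_le_sum fun p hp => (abs_sum_le_sum_abs _ _).trans (sum_le_sum fun n hn => h2 p hp n hn)
  refine h5.trans ?_
  rw [sum_comm]
  have h6 : ∑ n ∈ Ico A B, ∑ p ∈ I, ∑ ω,
      (resInd a p n + 1 / p) * (resInd a p (n + o ω) + 1 / p) *
        ∏ ω', (1 + balMaj a I N (n + o ω')) =
      ∑ n ∈ Ico A B, ∑ ω, diagMaj a I N n (n + o ω) *
          ∏ ω', (1 + balMaj a I N (n + o ω')) := by
    refine sum_congr rfl fun n hn => ?_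
    rw [sum_comm]
    refine sum_congr rfl fun ω _ => ?_
    rw [diagMaj, if_pos ((hmem n hn).2 ω), sum_mul]
  rw [h6]
  refine sum_le_sum_of_subset_of_nonneg hsub fun n _ _ => sum_nonneg fun ω _ =>
    mul_nonneg (diagMaj_nonneg _ _ _ _ _) (prod_nonneg fun ω' _ => ?_)
  have := balMaj_nonneg a I N (n + o ω')
  positivity

lemma sum_offset_le {k N : ℕ} {ω : Fin k → Bool} {j : Fin k} (hj : ω j = true) {φ : ℤ → ℝ}
    (hφ : ∀ n, 0 ≤ φ n) (hφ0 : ∀ n, n ∉ Ico (0 : ℤ) N → φ n = 0) (n : ℤ) :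
    (2 * N : ℝ) * ∑ h : Fin k → Shift N, φ (n + offset ω h) ≤
      (2 * N : ℝ) ^ k * ∑ n' ∈ Ico (0 : ℤ) N, φ n' := by
  have hsum0 : 0 ≤ ∑ n' ∈ Ico (0 : ℤ) N, φ n' := sum_nonneg fun _ _ => hφ _
  have hcard : (Fintype.card (Shift N) : ℝ) ≤ 2 * N := by exact_mod_cast card_shift_le N
  have hoff : ∀ h : Fin k → Shift N, offset ω h = (h j : ℤ) +
      ∑ i : {i // i ≠ j}, if ω i then ((h i : Shift N) : ℤ) else 0 := fun h => by
    rw [offset, Fintype.sum_eq_add_sum_subtype_ne _ j, if_pos hj]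
  have h1 : ∑ h : Fin k → Shift N, φ (n + offset ω h) =
      ∑ r : {i // i ≠ j} → Shift N, ∑ t : Shift N,
        φ (n + (t + ∑ i : {i // i ≠ j}, if ω i then ((r i : Shift N) : ℤ) else 0)) := by
    rw [Fintype.sum_equiv (Equiv.funSplitAt j (Shift N)) _
      (fun x : Shift N × ({i // i ≠ j} → Shift N) => φ (n + ((x.1 : ℤ) +
        ∑ i : {i // i ≠ j}, if ω i then ((x.2 i : Shift N) : ℤ) else 0)))
      (fun h => by rw [hoff]; rfl), Fintype.sum_prod_type_right]
  have h2 : ∀ r : {i // i ≠ j} → Shift N, ∑ t : Shift N,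
      φ (n + (t + ∑ i : {i // i ≠ j}, if ω i then ((r i : Shift N) : ℤ) else 0)) ≤
      ∑ n' ∈ Ico (0 : ℤ) N, φ n' := by
    intro r
    set c := ∑ i : {i // i ≠ j}, if ω i then ((r i : Shift N) : ℤ) else 0
    have hinj : Function.Injective fun t : Shift N => n + ((t : ℤ) + c) := fun t t' h => by
      have : n + ((t : ℤ) + c) = n + ((t' : ℤ) + c) := h
      exact Subtype.ext (by omega)
    rw [← sum_image (s := univ) (f := φ) (g := fun t : Shift N => n + ((t : ℤ) + c))
      fun _ _ _ _ h => hinj h]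
    rw [← sum_filter_of_ne (p := fun m => m ∈ Ico (0 : ℤ) N) (fun m _ h => by
      by_contra h'
      exact h (hφ0 m h'))]
    exact sum_le_sum_of_subset_of_nonneg (fun m hm => (mem_filter.1 hm).2) fun m _ _ => hφ m
  have hk : Fintype.card {i // i ≠ j} + 1 = k := by
    have := j.pos
    simp only [ne_eq, Fintype.card_subtype_compl, Fintype.card_fin, Fintype.card_unique]
    omega
  have h3 : (2 * N : ℝ) * Fintype.card ({i // i ≠ j} → Shift N) ≤ (2 * N : ℝ) ^ k := by
    rw [Fintype.card_fun]
    push_cast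
    calc _ ≤ (2 * N : ℝ) * (2 * N) ^ Fintype.card {i // i ≠ j} := by gcongr
      _ = _ := by rw [← pow_succ', hk]
  rw [h1]
  calc _ ≤ (2 * N : ℝ) * ∑ _r : {i // i ≠ j} → Shift N, ∑ n' ∈ Ico (0 : ℤ) N, φ n' := by
        gcongr with r
        exact h2 r
    _ = (2 * N : ℝ) * Fintype.card ({i // i ≠ j} → Shift N) * ∑ n' ∈ Ico (0 : ℤ) N, φ n' := by
        rw [sum_const, card_univ, nsmul_eq_mul]
        ring
    _ ≤ _ := by gcongr

lemma prod_sq_le_sum_pow {Ω : Type*} {s : Finset Ω} (hs : s.Nonempty) {x : Ω → ℝ}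
    (hx : ∀ ω ∈ s, 0 ≤ x ω) : (∏ ω ∈ s, x ω) ^ 2 ≤ ∑ ω ∈ s, x ω ^ (2 * s.card) := by
  obtain ⟨b, hb, hmax⟩ := s.exists_max_image x hs
  have h1 : ∏ ω ∈ s, x ω ≤ x b ^ s.card := (prod_le_prod hx hmax).trans_eq (prod_const _)
  calc _ ≤ (x b ^ s.card) ^ 2 := pow_le_pow_left₀ (prod_nonneg hx) h1 2
    _ = x b ^ (2 * s.card) := by rw [← pow_mul, mul_comm]
    _ ≤ _ := single_le_sum (f := fun ω => x ω ^ (2 * s.card))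
      (fun ω h => pow_nonneg (hx ω h) _) hb

lemma sum_one_add_balMaj_shift_le (a : ℕ → ℤ) (I : Finset ℕ) (N m : ℕ) (o : ℤ) :
    ∑ n ∈ Ico (0 : ℤ) N, (1 + balMaj a I N (n + o)) ^ m ≤
      N + ∑ n ∈ Ico (0 : ℤ) N, (1 + ∑ p ∈ I, (resInd a p n + 1 / p)) ^ m := by
  have h0 : ∀ n, 0 ≤ (1 + ∑ p ∈ I, (resInd a p n + 1 / p)) ^ m := fun n => by
    have : 0 ≤ ∑ p ∈ I, (resInd a p n + 1 / p) := sum_nonneg fun p _ => resInd_add_inv_nonneg _ _ _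
    positivity
  let φ : ℤ → ℝ := fun n =>
    if n ∈ Ico (0 : ℤ) N then (1 + ∑ p ∈ I, (resInd a p n + 1 / p)) ^ m else 0
  have hφ : ∀ n, 0 ≤ φ n := fun n => by
    simp only [φ]
    split_ifs
    · exact h0 n
    · exact le_rfl
  have h1 : ∀ n, (1 + balMaj a I N (n + o)) ^ m ≤ 1 + φ (n + o) := fun n => by
    simp only [φ, balMaj]
    split_ifs
    · linarith
    · simp
  refine (sum_le_sum fun n _ => h1 n).trans ?_
  rw [sum_add_distrib]
  have h2 : ∑ n ∈ Ico (0 : ℤ) N, φ (n + o) ≤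
      ∑ n ∈ Ico (0 : ℤ) N, (1 + ∑ p ∈ I, (resInd a p n + 1 / p)) ^ m := by
    have h3 : ∑ n ∈ Ico (0 : ℤ) N, φ (n + o) = ∑ n ∈ Ico (0 + o) (N + o), φ n := by
      rw [← map_add_right_Ico, sum_map]
      rfl
    rw [h3, ← sum_filter_of_ne (p := fun m => m ∈ Ico (0 : ℤ) N) (fun m _ h => by
      by_contra h'
      exact h (if_neg h'))]
    refine (sum_le_sum_of_subset_of_nonneg (fun m hm => (mem_filter.1 hm).2)
      fun m _ _ => hφ m).trans (sum_le_sum fun n hn => ?_)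
    simp only [φ, if_pos hn, le_refl]
  have h3 : ∑ _n ∈ Ico (0 : ℤ) N, (1 : ℝ) = N := by simp
  rw [h3]
  linarith

/-- Sums of balanced indicators of residue classes modulo primes in a short range correlate weakly
with progression averages. -/
theorem exists_abs_sum_balSum_mul_progAvg_le (k : ℕ) {C : ℝ} (hC : 0 ≤ C) : ∃ K > 0,
    ∀ (ε : ℕ → ℝ) (a : ℕ → ℤ) (I : Finset ℕ) (y P N : ℕ), (∀ p, |ε p| ≤ 1) →
      (∀ p ∈ I, p.Prime) → ∑ p ∈ I, (1 : ℝ) / p ≤ C → (∀ p ∈ I, y ≤ p) → (∀ p ∈ I, p ≤ P) →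
      0 < y → y ≤ P → P ^ (2 ^ (k + 1) + 1) ≤ N →
      ∀ (H : Type) [AddCommGroup H] [Fintype H] (f : ℕ → H → ℝ) (v : H),
        (∀ i u, |f i u| ≤ 1) →
        |∑ n ∈ Ico (0 : ℤ) N, balSum ε a I N n * progAvg k f v n| ^ 2 ^ (k + 1) ≤
          K * N ^ 2 ^ (k + 1) / y := by
  let M : ℕ := 2 ^ k - 1
  have hM : M + 1 = 2 ^ k := Nat.sub_add_cancel Nat.one_le_two_pow
  let K₁ : ℝ := 1 + 2 ^ (2 * M) * ((1 + C) ^ (2 * M) + momentConst C (2 * M) 0)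
  have hmom := momentConst_nonneg hC (2 * M) 0
  have hK₁ : 0 ≤ K₁ := by positivity
  let K₂ : ℝ := 98 * (C ^ 2 + C) * (M * K₁)
  have hK₂ : 0 ≤ K₂ := by positivity
  let K₃ : ℝ := 2 + 2 * M ^ 2 * K₂
  have hK₃ : 0 < K₃ := by positivity
  refine ⟨2 ^ 2 ^ (k + 1) * K₃, by positivity, ?_⟩
  intro ε a I y P N hε hI hIC hy hP hy0 hyP hN H _ _ f v hf
  have hP0 : 0 < P := hy0.trans_le hyP
  have hN0 : 0 < N := (pow_pos hP0 _).trans_le hN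
  have hN0' : (0 : ℝ) < N := by exact_mod_cast hN0
  have hy0' : (0 : ℝ) < y := by exact_mod_cast hy0
  have hMe : 2 * M + 2 = 2 ^ (k + 1) := by rw [pow_succ]; omega
  have hP2 : P ^ 2 ≤ N := (Nat.pow_le_pow_right hP0 (by omega)).trans hN
  have hP2M : P ^ (2 * M) ≤ N := (Nat.pow_le_pow_right hP0 (by omega)).trans hN
  let ω₀ : Fin k → Bool := fun _ => false
  let Ω := {ω : Fin k → Bool // ω ≠ ω₀}
  have hΩ : Fintype.card Ω = M := by
    have h1 : Fintype.card Ω + 1 = 2 ^ k := by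
      have h2 := Fintype.card_subtype_compl (fun ω : Fin k → Bool => ω = ω₀)
      simp only [Fintype.card_unique, Fintype.card_fun, Fintype.card_bool, Fintype.card_fin] at h2
      have h3 : Fintype.card Ω = 2 ^ k - 1 := by
        rw [← h2]
      omega
    omega
  let W : (Fin k → Shift N) → ℤ → ℝ := fun h n =>
    ∏ ω : Ω, (1 + balMaj a I N (n + offset ω.1 h))
  have hone : ∀ n, 0 ≤ 1 + balMaj a I N n := fun n => by
    have := balMaj_nonneg a I N n
    positivity
  have hcardh : (Fintype.card (Fin k → Shift N) : ℝ) ≤ (2 * N : ℝ) ^ k := by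
    rw [Fintype.card_fun, Fintype.card_fin]
    exact_mod_cast Nat.pow_le_pow_left (card_shift_le N) k
  have hW2 : 0 < M → ∀ h, ∑ n ∈ Ico (0 : ℤ) N, W h n ^ 2 ≤ M * (K₁ * N) := by
    intro hM0 h
    have h1 : ∀ n, W h n ^ 2 ≤ ∑ ω : Ω, (1 + balMaj a I N (n + offset ω.1 h)) ^ (2 * M) := fun n => by
      have hne : (univ : Finset Ω).Nonempty := by
        rw [← card_pos, card_univ, hΩ]
        exact hM0
      have := prod_sq_le_sum_pow hne (x := fun ω : Ω => 1 + balMaj a I N (n + offset ω.1 h))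
        fun ω _ => hone _
      rwa [card_univ, hΩ] at this
    refine (sum_le_sum fun n _ => h1 n).trans ?_
    rw [sum_comm]
    have h2 : ∀ ω : Ω, ∑ n ∈ Ico (0 : ℤ) N, (1 + balMaj a I N (n + offset ω.1 h)) ^ (2 * M) ≤
        K₁ * N := fun ω => by
      refine (sum_one_add_balMaj_shift_le a I N (2 * M) _).trans ?_
      have := sum_one_add_pow_le a hI hIC hP hP0 (2 * M) hP2M
      simp only [K₁]
      linarith
    refine (sum_le_sum fun ω _ => h2 ω).trans_eq ?_
    rw [sum_const, card_univ, hΩ, nsmul_eq_mul]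
  let X : Ω → ℝ := fun ω =>
    ∑ h : Fin k → Shift N, ∑ n ∈ Ico (0 : ℤ) N, diagMaj a I N n (n + offset ω.1 h) * W h n
  have hX : ∀ ω, X ω ^ 2 ≤ (2 * N : ℝ) ^ (2 * k + 2) * K₂ / y := by
    intro ω
    have hM0 : 0 < M := hΩ ▸ Fintype.card_pos_iff.2 ⟨ω⟩
    obtain ⟨j, hj⟩ : ∃ j, ω.1 j = true := by
      by_contra h
      push Not at h
      exact ω.2 (funext fun j => by simpa using h j)
    have h1 : X ω ^ 2 ≤
        (∑ h : Fin k → Shift N, ∑ n ∈ Ico (0 : ℤ) N, diagMaj a I N n (n + offset ω.1 h) ^ 2) *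
          ∑ h : Fin k → Shift N, ∑ n ∈ Ico (0 : ℤ) N, W h n ^ 2 := by
      simp only [X, ← sum_product']
      exact sum_mul_sq_le_sq_mul_sq _ _ _
    have h2 : ∑ h : Fin k → Shift N, ∑ n ∈ Ico (0 : ℤ) N, W h n ^ 2 ≤
        (2 * N : ℝ) ^ k * (M * (K₁ * N)) := by
      refine (sum_le_sum fun h _ => hW2 hM0 h).trans ?_
      rw [sum_const, card_univ, nsmul_eq_mul]
      gcongr
    have h3 : (2 * N : ℝ) *
        ∑ h : Fin k → Shift N, ∑ n ∈ Ico (0 : ℤ) N, diagMaj a I N n (n + offset ω.1 h) ^ 2 ≤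
        (2 * N : ℝ) ^ k * (98 * (C ^ 2 + C) * N ^ 2 / y) := by
      rw [sum_comm, mul_sum]
      refine (sum_le_sum fun n _ => sum_offset_le (φ := fun n' => diagMaj a I N n n' ^ 2) hj
        (fun _ => sq_nonneg _) (fun n' hn' => by simp only [diagMaj, if_neg hn']; norm_num)
        n).trans ?_
      rw [← mul_sum]
      refine mul_le_mul_of_nonneg_left ?_ (by positivity)
      refine le_trans (le_of_eq ?_) (sum_sum_sq_le a hI hIC hP hP2 hy hy0)
      exact sum_congr rfl fun n _ => sum_congr rfl fun n' hn' => by rw [diagMaj, if_pos hn']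
    have h4 : 0 ≤ ∑ h : Fin k → Shift N, ∑ n ∈ Ico (0 : ℤ) N, W h n ^ 2 :=
      sum_nonneg fun _ _ => sum_nonneg fun _ _ => sq_nonneg _
    have h5 : (2 * N : ℝ) * X ω ^ 2 ≤ (2 * N : ℝ) * ((2 * N : ℝ) ^ (2 * k + 2) * K₂ / y) := by
      calc (2 * N : ℝ) * X ω ^ 2 ≤ (2 * N : ℝ) * (_ * _) :=
            mul_le_mul_of_nonneg_left h1 (by positivity)
        _ = (2 * N : ℝ) * _ * _ := (mul_assoc _ _ _).symm
        _ ≤ (2 * N : ℝ) ^ k * (98 * (C ^ 2 + C) * N ^ 2 / y) *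
            ((2 * N : ℝ) ^ k * (M * (K₁ * N))) := mul_le_mul h3 h2 h4 (by positivity)
        _ = (2 * N : ℝ) ^ (2 * k) * (N ^ 3) * (K₂ / y) := by
            simp only [K₂]
            ring
        _ ≤ (2 * N : ℝ) ^ (2 * k) * ((2 * N) ^ 3) * (K₂ / y) := by
            gcongr
            linarith
        _ = _ := by ring
    exact le_of_mul_le_mul_left h5 (by positivity)
  have hZ : ∑ h : Fin k → Shift N, |∑ n ∈ Ico (0 : ℤ) N,
      ∏ ω : Fin k → Bool, balSum ε a I N (n + offset ω h)| ≤
      (2 * N : ℝ) ^ k * (2 * P ^ (2 * M + 2)) + ∑ ω, X ω := by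
    have h1 : ∀ h : Fin k → Shift N, |∑ n ∈ Ico (0 : ℤ) N,
        ∏ ω : Fin k → Bool, balSum ε a I N (n + offset ω h)| ≤
        2 * P ^ (2 * M + 2) +
          ∑ n ∈ Ico (0 : ℤ) N, ∑ ω : Ω, diagMaj a I N n (n + offset ω.1 h) * W h n := by
      intro h
      have h2 := abs_sum_balSum_mul_prod_le hε a hI hP (fun ω : Ω => offset ω.1 h) N
      rw [hΩ] at h2
      have h3 : ∀ n, ∏ ω : Fin k → Bool, balSum ε a I N (n + offset ω h) =
          balSum ε a I N n * ∏ ω : Ω, balSum ε a I N (n + offset ω.1 h) := fun n => by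
        rw [Fintype.prod_eq_mul_prod_subtype_ne _ ω₀]
        congr 2
        simp [offset, ω₀]
      simp only [h3]
      exact h2
    refine (sum_le_sum fun h _ => h1 h).trans ?_
    rw [sum_add_distrib, sum_const, card_univ, nsmul_eq_mul]
    refine add_le_add (by gcongr) (le_of_eq ?_)
    exact (sum_congr rfl fun h _ => sum_comm).trans sum_comm
  have hZ2 : ((2 * N : ℝ) ^ k * (2 * P ^ (2 * M + 2)) + ∑ ω, X ω) ^ 2 ≤
      (2 * N : ℝ) ^ (2 * k + 2) * K₃ / y := by
    have h1 : (∑ ω, X ω) ^ 2 ≤ M ^ 2 * ((2 * N : ℝ) ^ (2 * k + 2) * K₂ / y) := by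
      refine (sq_sum_le_card_mul_sum_sq).trans ?_
      rw [card_univ, hΩ, sq, mul_assoc]
      refine mul_le_mul_of_nonneg_left ((sum_le_sum fun ω _ => hX ω).trans_eq ?_) (by positivity)
      rw [sum_const, card_univ, hΩ, nsmul_eq_mul]
    have h2 : (P : ℝ) ^ (2 * M + 2) ^ 1 * y ≤ N := by
      have : P ^ (2 * M + 2) * y ≤ N := by
        refine (Nat.mul_le_mul_left _ hyP).trans ?_
        rwa [← pow_succ, hMe]
      rw [pow_one]
      exact_mod_cast this
    rw [pow_one] at h2
    have h3 : ((2 * N : ℝ) ^ k * (2 * P ^ (2 * M + 2))) ^ 2 ≤ (2 * N : ℝ) ^ (2 * k + 2) / y := by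
      have hy1 : (1 : ℝ) ≤ y := by exact_mod_cast hy0
      have h4 : (2 * P ^ (2 * M + 2) : ℝ) ^ 2 ≤ (2 * N) ^ 2 / y := by
        rw [le_div_iff₀ hy0']
        have h5 : (P : ℝ) ^ (2 * M + 2) ≤ N := le_trans (le_mul_of_one_le_right (by positivity) hy1) h2
        calc (2 * P ^ (2 * M + 2) : ℝ) ^ 2 * y =
            4 * (P ^ (2 * M + 2) * (P ^ (2 * M + 2) * y)) := by ring
          _ ≤ 4 * (N * N : ℝ) := by gcongr
          _ = _ := by ring
      calc _ = (2 * N : ℝ) ^ (2 * k) * (2 * P ^ (2 * M + 2) : ℝ) ^ 2 := by ring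
        _ ≤ (2 * N : ℝ) ^ (2 * k) * ((2 * N) ^ 2 / y) := by gcongr
        _ = _ := by ring
    refine add_sq_le.trans ?_
    have h5 : (2 * N : ℝ) ^ (2 * k + 2) * K₃ / y = 2 * ((2 * N : ℝ) ^ (2 * k + 2) / y +
        M ^ 2 * ((2 * N : ℝ) ^ (2 * k + 2) * K₂ / y)) := by
      simp only [K₃]
      ring
    rw [h5]
    linarith
  have hmain := abs_sum_mul_progAvg_pow_le k N f hf v (balSum ε a I N)
    (fun n hn => by rw [balSum, if_neg hn])
  have hA := hmain.trans (mul_le_mul_of_nonneg_left hZ (by positivity))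
  have hB := pow_le_pow_left₀ (by positivity) hA 2
  rw [mul_pow (_ ^ 2 ^ k) ((2 * N : ℝ) ^ (k + 1)) 2, mul_pow ((2 * N : ℝ) ^ 2 ^ k) _ 2, ← pow_mul,
    ← pow_mul, ← pow_mul, ← pow_succ, mul_comm (k + 1) 2, mul_add_one 2 k] at hB
  have hD := hB.trans (mul_le_mul_of_nonneg_left hZ2 (by positivity))
  have hE : (2 * N : ℝ) ^ 2 ^ (k + 1) * ((2 * N : ℝ) ^ (2 * k + 2) * K₃ / y) =
      2 ^ 2 ^ (k + 1) * K₃ * N ^ 2 ^ (k + 1) / y * (2 * N : ℝ) ^ (2 * k + 2) := by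
    rw [mul_pow (2 : ℝ) N (2 ^ (k + 1))]
    ring
  rw [hE] at hD
  exact le_of_mul_le_mul_right hD (by positivity)

/-- The primes in `(y, z]`. -/
def primesIn (y z : ℕ) : Finset ℕ := (Ioc y z).filter Nat.Prime

lemma mem_primesIn {y z p : ℕ} : p ∈ primesIn y z ↔ (y < p ∧ p ≤ z) ∧ p.Prime := by
  rw [primesIn, mem_filter, mem_Ioc]

lemma sum_inv_primesIn_two_mul_le {x : ℕ} (hx : 2 ≤ x) :
    ∑ p ∈ primesIn x (2 * x), (1 : ℝ) / p ≤ 4 * Real.log 2 / Real.log x := by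
  have hx0 : (0 : ℝ) < x := by positivity
  have hlog : 0 < Real.log x := Real.log_pos (by exact_mod_cast hx)
  have h1 : ∑ p ∈ primesIn x (2 * x), Real.log x ≤ Real.log 4 * (2 * x) := by
    refine le_trans ?_ (Chebyshev.theta_le_log4_mul_x (x := 2 * x) (by positivity))
    have : (2 * x : ℝ) = ((2 * x : ℕ) : ℝ) := by push_cast; ring
    rw [this, Chebyshev.theta_eq_sum_primesLE_log]
    have hsub : primesIn x (2 * x) ⊆ Nat.primesLE (2 * x) := fun p hp => by
      rw [mem_primesIn] at hp
      exact Nat.mem_primesLE.2 ⟨hp.1.2, hp.2⟩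
    refine (sum_le_sum fun p hp => ?_).trans (sum_le_sum_of_subset_of_nonneg hsub
      fun p _ _ => Real.log_natCast_nonneg p)
    rw [mem_primesIn] at hp
    exact Real.log_le_log hx0 (by exact_mod_cast hp.1.1.le)
  have h2 : ∑ p ∈ primesIn x (2 * x), (1 : ℝ) / p ≤ ∑ _p ∈ primesIn x (2 * x), (1 : ℝ) / x := by
    refine sum_le_sum fun p hp => ?_
    rw [mem_primesIn] at hp
    have : (x : ℝ) ≤ p := by exact_mod_cast hp.1.1.le
    gcongr
  refine h2.trans ?_
  rw [sum_const, nsmul_eq_mul] at h1 ⊢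
  rw [le_div_iff₀ hlog]
  have h4 : Real.log 4 = 2 * Real.log 2 := by
    rw [show (4 : ℝ) = 2 ^ 2 by norm_num, Real.log_pow]
    norm_num
  rw [h4] at h1
  calc _ = (((primesIn x (2 * x)).card : ℝ) * Real.log x) / x := by ring
    _ ≤ (2 * Real.log 2 * (2 * x)) / x := by gcongr
    _ = _ := by field_simp; ring

lemma sum_inv_primesIn_two_pow_mul_le {y : ℕ} (hy : 2 ≤ y) (m : ℕ) :
    ∑ p ∈ primesIn y (2 ^ m * y), (1 : ℝ) / p ≤ m * (4 * Real.log 2 / Real.log y) := by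
  induction m with
  | zero => simp [primesIn]
  | succ m ih =>
    have h1 : y ≤ 2 ^ m * y := Nat.le_mul_of_pos_left y (by positivity)
    have hsub : primesIn y (2 ^ (m + 1) * y) ⊆
        primesIn y (2 ^ m * y) ∪ primesIn (2 ^ m * y) (2 * (2 ^ m * y)) := fun p hp => by
      rw [mem_union]
      simp only [mem_primesIn] at hp ⊢
      have : 2 ^ (m + 1) * y = 2 * (2 ^ m * y) := by ring
      rw [this] at hp
      rcases le_or_gt p (2 ^ m * y) with h | h
      · exact Or.inl ⟨⟨hp.1.1, h⟩, hp.2⟩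
      · exact Or.inr ⟨⟨h, hp.1.2⟩, hp.2⟩
    have hdisj : Disjoint (primesIn y (2 ^ m * y)) (primesIn (2 ^ m * y) (2 * (2 ^ m * y))) := by
      rw [Finset.disjoint_left]
      intro p hp hp'
      rw [mem_primesIn] at hp hp'
      omega
    refine (sum_le_sum_of_subset_of_nonneg hsub fun _ _ _ => by positivity).trans ?_
    rw [sum_union hdisj]
    have h2 := sum_inv_primesIn_two_mul_le (hy.trans h1)
    have hlog : 0 < Real.log y := Real.log_pos (by exact_mod_cast hy)
    have h3 : 4 * Real.log 2 / Real.log ((2 ^ m * y : ℕ) : ℝ) ≤ 4 * Real.log 2 / Real.log y := by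
      have := Real.log_pos one_lt_two
      refine div_le_div_of_nonneg_left (by positivity) hlog (Real.log_le_log (by positivity) ?_)
      exact_mod_cast h1
    push_cast at h2 h3 ih ⊢
    linarith

lemma sum_inv_primesIn_sq_le {y : ℕ} (hy : 2 ≤ y) :
    ∑ p ∈ primesIn y (y ^ 2), (1 : ℝ) / p ≤ 8 := by
  have hlog : 0 < Real.log y := Real.log_pos (by exact_mod_cast hy)
  have hlog2 := Real.log_pos one_lt_two
  have hle2 : Real.log 2 ≤ Real.log y := Real.log_le_log (by norm_num) (by exact_mod_cast hy)
  set m := Nat.clog 2 y with hm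
  have h1 : y ≤ 2 ^ m := Nat.le_pow_clog one_lt_two y
  have hsub : primesIn y (y ^ 2) ⊆ primesIn y (2 ^ m * y) := fun p hp => by
    rw [mem_primesIn] at hp ⊢
    refine ⟨⟨hp.1.1, hp.1.2.trans ?_⟩, hp.2⟩
    rw [sq]
    exact Nat.mul_le_mul_right y h1
  refine (sum_le_sum_of_subset_of_nonneg hsub fun _ _ _ => by positivity).trans
    ((sum_inv_primesIn_two_pow_mul_le hy m).trans ?_)
  have h2 : 2 ^ (m - 1) < y := Nat.pow_pred_clog_lt_self one_lt_two (by omega)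
  have h3 : ((m : ℝ) - 1) * Real.log 2 ≤ Real.log y := by
    have hm1 : 1 ≤ m := Nat.clog_pos one_lt_two hy
    have : Real.log ((2 : ℝ) ^ (m - 1)) ≤ Real.log y :=
      Real.log_le_log (by positivity) (by exact_mod_cast h2.le)
    rw [Real.log_pow, Nat.cast_sub hm1] at this
    exact_mod_cast this
  rw [mul_div_assoc', div_le_iff₀ hlog]
  nlinarith

lemma exp_neg_le_prod_one_sub {I : Finset ℕ} (hI : ∀ p ∈ I, p.Prime) {C : ℝ}
    (hC : ∑ p ∈ I, (1 : ℝ) / p ≤ C) : Real.exp (-(2 * C)) ≤ ∏ p ∈ I, (1 - 1 / (p : ℝ)) := by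
  have h1 : ∀ p ∈ I, Real.exp (-(2 * (1 / (p : ℝ)))) ≤ 1 - 1 / (p : ℝ) := by
    intro p hp
    have hp2 : (2 : ℝ) ≤ p := by exact_mod_cast (hI p hp).two_le
    have ht : (1 : ℝ) / p ≤ 1 / 2 := by gcongr
    have ht0 : (0 : ℝ) < 1 / p := by positivity
    set t := (1 : ℝ) / p
    rw [Real.exp_neg, inv_le_comm₀ (Real.exp_pos _) (by linarith)]
    refine le_trans ?_ (Real.add_one_le_exp _)
    rw [inv_le_iff_one_le_mul₀ (by linarith)]
    nlinarith
  calc _ ≤ Real.exp (∑ p ∈ I, -(2 * (1 / (p : ℝ)))) := by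
        rw [sum_neg_distrib, ← mul_sum]
        exact Real.exp_le_exp.2 (by linarith)
    _ = ∏ p ∈ I, Real.exp (-(2 * (1 / (p : ℝ)))) := Real.exp_sum _ _
    _ ≤ _ := prod_le_prod (fun _ _ => (Real.exp_pos _).le) h1

/-- `F` is an average along progressions in a finite abelian group, of `1`-bounded functions. -/
def IsProgAvg (k : ℕ) (F : ℤ → ℝ) : Prop :=
  ∃ (H : Type) (_ : AddCommGroup H) (_ : Fintype H) (f : ℕ → H → ℝ) (v : H),
    (∀ i u, |f i u| ≤ 1) ∧ F = progAvg k f v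

lemma IsProgAvg.comp_affine {k : ℕ} {F : ℤ → ℝ} (hF : IsProgAvg k F) (r q : ℤ) :
    IsProgAvg k fun m => F (r + q * m) := by
  obtain ⟨H, _, _, f, v, hf, rfl⟩ := hF
  refine ⟨H, inferInstance, inferInstance, fun i u => f i (u + (i * r) • v), q • v,
    fun i u => hf _ _, ?_⟩
  funext m
  simp only [progAvg]
  refine expect_congr rfl fun u _ => prod_congr rfl fun i _ => ?_
  congr 1
  rw [smul_smul, add_assoc, ← add_smul]
  congr 2
  ring

/-- `κ` bounds the total discrepancy of progression averages over residue classes modulo the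
primes of `I`, on intervals of length at least `M`. -/
def ResidueDiscrepancyLE (k : ℕ) (I : Finset ℕ) (M : ℕ) (κ : ℝ) : Prop :=
  ∀ (a : ℕ → ℤ) (N : ℕ) (F : ℤ → ℝ), IsProgAvg k F → M ≤ N →
    ∑ p ∈ I, |∑ n ∈ Ico (0 : ℤ) N, resInd a p n * F n - 1 / p * ∑ n ∈ Ico (0 : ℤ) N, F n| ≤ κ * N

lemma exists_residueDiscrepancyLE (k : ℕ) {C : ℝ} (hC : 0 ≤ C) :
    ∃ K : ℝ, 0 < K ∧ ∀ (I : Finset ℕ) (y P : ℕ), (∀ p ∈ I, p.Prime) → ∑ p ∈ I, (1 : ℝ) / p ≤ C →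
      (∀ p ∈ I, y ≤ p) → (∀ p ∈ I, p ≤ P) → 0 < y → y ≤ P →
      ResidueDiscrepancyLE k I (P ^ (2 ^ (k + 1) + 1)) ((K / y) ^ ((1 : ℝ) / 2 ^ (k + 1))) := by
  obtain ⟨K, hK, key⟩ := exists_abs_sum_balSum_mul_progAvg_le k hC
  refine ⟨K, hK, fun I y P hI hIC hIy hIP hy hyP a N F hF hN => ?_⟩
  obtain ⟨H, _, _, f, v, hf, rfl⟩ := hF
  set X : ℕ → ℝ := fun p => ∑ n ∈ Ico (0 : ℤ) N, resInd a p n * progAvg k f v n -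
    1 / p * ∑ n ∈ Ico (0 : ℤ) N, progAvg k f v n with hX
  set ε : ℕ → ℝ := fun p => if 0 ≤ X p then 1 else -1 with hε
  have hε1 : ∀ p, |ε p| ≤ 1 := fun p => by
    simp only [hε]
    split_ifs <;> norm_num
  have hεX : ∀ p, |X p| = ε p * X p := fun p => by
    simp only [hε]
    split_ifs with h
    · rw [abs_of_nonneg h, one_mul]
    · rw [abs_of_neg (not_le.1 h), neg_one_mul]
  have hsum : ∑ p ∈ I, |X p| =
      ∑ n ∈ Ico (0 : ℤ) N, balSum ε a I N n * progAvg k f v n := by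
    have h1 : ∀ n ∈ Ico (0 : ℤ) N, balSum ε a I N n * progAvg k f v n =
        ∑ p ∈ I, ε p * (resInd a p n * progAvg k f v n - 1 / p * progAvg k f v n) := by
      intro n hn
      rw [balSum, if_pos hn, sum_mul]
      refine sum_congr rfl fun p _ => ?_
      rw [balInd]
      ring
    rw [sum_congr rfl h1, sum_comm]
    refine sum_congr rfl fun p _ => ?_
    rw [hεX, ← mul_sum, sum_sub_distrib, ← mul_sum]
  have h2 := key ε a I y P N hε1 hI hIC hIy hIP hy hyP hN H f v hf
  rw [← hsum, abs_of_nonneg (sum_nonneg fun _ _ => abs_nonneg _)] at h2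
  have hpos : (0 : ℝ) ≤ K / y := by positivity
  refine le_of_pow_le_pow_left₀ (n := 2 ^ (k + 1)) (by positivity) (by positivity) (h2.trans_eq ?_)
  rw [mul_pow, ← Real.rpow_natCast ((K / y) ^ _) (2 ^ (k + 1)), ← Real.rpow_mul hpos]
  push_cast
  rw [one_div_mul_cancel (by positivity), Real.rpow_one]
  ring

lemma sum_resInd_mul_eq (a : ℕ → ℤ) {p : ℕ} (hp : p.Prime) (N : ℕ) :
    ∃ (N' : ℕ) (a' : ℕ → ℤ) (r : ℤ),
      (∀ G : ℤ → ℝ, ∑ n ∈ Ico (0 : ℤ) N, resInd a p n * G n =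
        ∑ m ∈ Ico (0 : ℤ) N', G (r + p * m)) ∧
      |(N' : ℝ) - N / p| ≤ 1 ∧
      (∀ p' : ℕ, p'.Prime → p' ≠ p → ∀ m : ℤ, resInd a p' (r + p * m) = resInd a' p' m) ∧
      0 ≤ r ∧ r < p ∧ (p : ℤ) ∣ r - a p := by
  have hp0 : (0 : ℤ) < p := by exact_mod_cast hp.pos
  set r : ℤ := a p % p with hr
  have hr0 : 0 ≤ r := Int.emod_nonneg _ hp0.ne'
  have hrp : r < p := Int.emod_lt_of_pos _ hp0
  have hra : (p : ℤ) ∣ r - a p := by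
    rw [hr, ← dvd_neg, neg_sub]
    exact Int.dvd_self_sub_emod
  have hinv : ∀ p' : ℕ, ∃ t : ℤ, p'.Prime → p' ≠ p → (p' : ℤ) ∣ p * t + r - a p' := by
    intro p'
    by_cases h : p'.Prime ∧ p' ≠ p
    · obtain ⟨u, v, huv⟩ := Nat.isCoprime_iff_coprime.2 ((Nat.coprime_primes hp h.1).2 h.2.symm)
      refine ⟨u * (a p' - r), fun _ _ => ⟨-(v * (a p' - r)), ?_⟩⟩
      linear_combination (a p' - r) * huv
    · exact ⟨0, fun h1 h2 => absurd ⟨h1, h2⟩ h⟩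
  choose a' ha' using hinv
  -- the number of `m` with `0 ≤ r + p m < N`
  set M : ℤ := (N - r + p - 1) / p with hM
  have hM0 : 0 ≤ M := Int.ediv_nonneg (by omega) hp0.le
  have hM1 : p * M ≤ N - r + p - 1 := Int.mul_ediv_self_le hp0.ne'
  have hM2 : N - r + p - 1 < p * M + p := by
    have := Int.lt_ediv_add_one_mul_self (N - r + p - 1) hp0
    rw [← hM] at this
    linarith
  refine ⟨M.toNat, a', r, fun G => ?_, ?_, fun p' hp' hne m => ?_, hr0, hrp, hra⟩
  · rw [Int.toNat_of_nonneg hM0]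
    have h1 : ∀ n ∈ Ico (0 : ℤ) N, resInd a p n * G n = if (p : ℤ) ∣ n - a p then G n else 0 := by
      intro n _
      rw [resInd]
      split_ifs <;> simp
    rw [sum_congr rfl h1, ← sum_filter]
    symm
    refine sum_bij (fun m _ => r + p * m) ?_ ?_ ?_ fun _ _ => rfl
    · intro m hm
      rw [mem_Ico] at hm
      rw [mem_filter, mem_Ico]
      refine ⟨⟨by nlinarith, by nlinarith⟩, ?_⟩
      rw [show r + p * m - a p = r - a p + p * m by ring]
      exact dvd_add hra (dvd_mul_right _ _)
    · intro m _ m' _ h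
      have h2 : (p : ℤ) * m = p * m' := by linarith
      exact mul_left_cancel₀ hp0.ne' h2
    · intro n hn
      rw [mem_filter, mem_Ico] at hn
      have h2 : (p : ℤ) ∣ n - r := by
        have h3 : (p : ℤ) ∣ a p - r := Int.dvd_self_sub_emod
        have h4 := dvd_add hn.2 h3
        rwa [sub_add_sub_cancel] at h4
      obtain ⟨m, hm⟩ := h2
      refine ⟨m, ?_, by linarith⟩
      rw [mem_Ico]
      constructor
      · by_contra hneg
        push Not at hneg
        nlinarith
      · by_contra hge
        push Not at hge
        nlinarith
  · have h1 : ((M.toNat : ℕ) : ℝ) = (M : ℝ) := by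
      exact_mod_cast Int.toNat_of_nonneg hM0
    have hpR : (0 : ℝ) < p := by exact_mod_cast hp.pos
    rw [h1, abs_le]
    have e1 : (p : ℝ) * M ≤ N - r + p - 1 := by exact_mod_cast hM1
    have e2 : (N : ℝ) - r + p - 1 < p * M + p := by exact_mod_cast hM2
    have e3 : (0 : ℝ) ≤ r := by exact_mod_cast hr0
    have e4 : (r : ℝ) + 1 ≤ p := by exact_mod_cast hrp
    constructor
    · rw [neg_le_sub_iff_le_add, div_le_iff₀ hpR]
      nlinarith
    · rw [sub_le_iff_le_add, ← sub_le_iff_le_add', le_div_iff₀ hpR]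
      nlinarith
  · have h1 := ha' p' hp' hne
    have h2 : (p' : ℤ) ∣ r + p * m - a p' ↔ (p' : ℤ) ∣ m - a' p' := by
      rw [show r + p * m - a p' = p * (m - a' p') + (p * a' p' + r - a p') by ring,
        dvd_add_left h1]
      refine ⟨fun h => ?_, fun h => Dvd.dvd.mul_left h _⟩
      exact (Nat.isCoprime_iff_coprime.2 ((Nat.coprime_primes hp' hp).2 hne)).dvd_of_dvd_mul_left h
    simp only [resInd, h2]

lemma sum_prod_resInd_mul_eq (a : ℕ → ℤ) {D : Finset ℕ} (hD : ∀ p ∈ D, p.Prime) (N : ℕ) :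
    ∃ (N' : ℕ) (a' : ℕ → ℤ) (r : ℤ),
      (∀ G : ℤ → ℝ, ∑ n ∈ Ico (0 : ℤ) N, (∏ p ∈ D, resInd a p n) * G n =
        ∑ m ∈ Ico (0 : ℤ) N', G (r + (∏ p ∈ D, (p : ℤ)) * m)) ∧
      |(N' : ℝ) - N / ∏ p ∈ D, (p : ℝ)| ≤ 2 ∧
      ∀ p : ℕ, p.Prime → p ∉ D → ∀ m : ℤ,
        resInd a p (r + (∏ p ∈ D, (p : ℤ)) * m) = resInd a' p m := by
  induction D using Finset.induction_on with
  | empty => exact ⟨N, a, 0, by simp, by simp, by simp⟩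
  | insert q D hq ih =>
    obtain ⟨N₁, a₁, r₁, h1, h2, h3⟩ := ih fun p hp => hD p (mem_insert_of_mem hp)
    have hqp := hD q (mem_insert_self _ _)
    obtain ⟨N₂, a₂, r₂, h4, h5, h6, -⟩ := sum_resInd_mul_eq a₁ hqp N₁
    have heq : ∀ m : ℤ, r₁ + (∏ p ∈ D, (p : ℤ)) * (r₂ + q * m) =
        r₁ + (∏ p ∈ D, (p : ℤ)) * r₂ + (∏ p ∈ insert q D, (p : ℤ)) * m := fun m => by
      rw [prod_insert hq]
      ring
    refine ⟨N₂, a₂, r₁ + (∏ p ∈ D, (p : ℤ)) * r₂, fun G => ?_, ?_, fun p hp hpD m => ?_⟩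
    · have e1 : ∀ n, (∏ p ∈ insert q D, resInd a p n) * G n =
          (∏ p ∈ D, resInd a p n) * (resInd a q n * G n) := fun n => by
        rw [prod_insert hq]
        ring
      simp only [e1, h1, h3 q hqp hq, h4 fun m => G (r₁ + (∏ p ∈ D, (p : ℤ)) * m), heq]
    · rw [prod_insert hq]
      have hqR : (2 : ℝ) ≤ q := by exact_mod_cast hqp.two_le
      have e2 : (N₂ : ℝ) - N / (q * ∏ p ∈ D, (p : ℝ)) =
          (N₂ - N₁ / q) + (N₁ - N / ∏ p ∈ D, (p : ℝ)) / q := by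
        rw [sub_div, div_div, mul_comm (∏ p ∈ D, (p : ℝ))]
        ring
      rw [e2]
      refine (abs_add_le _ _).trans ?_
      have e3 : |((N₁ : ℝ) - N / ∏ p ∈ D, (p : ℝ)) / q| ≤ 1 := by
        rw [abs_div, abs_of_pos (by linarith : (0 : ℝ) < q), div_le_one (by linarith)]
        linarith
      linarith
    · rw [mem_insert, not_or] at hpD
      rw [← heq, h3 p hp hpD.2, h6 p hp hpD.1]

/-- The sum of `F` over the `n < N` which lie in the given residue class modulo each `p ∈ D`. -/
noncomputable def resSum (a : ℕ → ℤ) (N : ℕ) (F : ℤ → ℝ) (D : Finset ℕ) : ℝ :=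
  ∑ n ∈ Ico (0 : ℤ) N, (∏ p ∈ D, resInd a p n) * F n

lemma sum_abs_resSum_insert_sub_le {k M : ℕ} {I : Finset ℕ} {κ : ℝ} (hM : 1 ≤ M) (hκ0 : 0 ≤ κ)
    (hκ : ResidueDiscrepancyLE k I M κ) (hI : ∀ p ∈ I, p.Prime) (a : ℕ → ℤ) {D : Finset ℕ}
    (hD : ∀ p ∈ D, p.Prime) {N : ℕ} (hN : 3 * (∏ p ∈ D, p) * M ≤ N) {F : ℤ → ℝ}
    (hF : IsProgAvg k F) :
    ∑ p ∈ I \ D, |resSum a N F (insert p D) - resSum a N F D / p| ≤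
      2 * κ * (N / ∏ p ∈ D, (p : ℝ)) := by
  obtain ⟨N', a', r, h1, h2, h3⟩ := sum_prod_resInd_mul_eq a hD N
  have hq0 : (0 : ℝ) < ∏ p ∈ D, (p : ℝ) := prod_pos fun p hp => by exact_mod_cast (hD p hp).pos
  have hNq : 3 * (M : ℝ) ≤ N / ∏ p ∈ D, (p : ℝ) := by
    rw [le_div_iff₀ hq0]
    have : ((3 * (∏ p ∈ D, p) * M : ℕ) : ℝ) ≤ N := by exact_mod_cast hN
    push_cast at this
    linarith
  have hM' : (1 : ℝ) ≤ M := by exact_mod_cast hM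
  rw [abs_le] at h2
  have hMN : M ≤ N' := by
    have : (M : ℝ) ≤ N' := by linarith
    exact_mod_cast this
  have h4 := hκ a' N' _ (hF.comp_affine r (∏ p ∈ D, (p : ℤ))) hMN
  calc _ ≤ ∑ p ∈ I \ D, |∑ n ∈ Ico (0 : ℤ) N', resInd a' p n *
        F (r + (∏ p ∈ D, (p : ℤ)) * n) -
          1 / p * ∑ n ∈ Ico (0 : ℤ) N', F (r + (∏ p ∈ D, (p : ℤ)) * n)| := by
        refine (sum_congr rfl fun p hp => ?_).le
        rw [Finset.mem_sdiff] at hp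
        have e1 : ∀ n, (∏ p ∈ insert p D, resInd a p n) * F n =
            (∏ p ∈ D, resInd a p n) * (resInd a p n * F n) := fun n => by
          rw [prod_insert hp.2]
          ring
        simp only [resSum, e1, h1, h3 p (hI p hp.1) hp.2]
        rw [one_div_mul_eq_div]
    _ ≤ κ * N' := (sum_le_sum_of_subset_of_nonneg sdiff_subset
        fun _ _ _ => abs_nonneg _).trans h4
    _ ≤ _ := by nlinarith

lemma succ_mul_sum_powersetCard_succ {ι : Type*} [DecidableEq ι] (I : Finset ι) (i : ℕ) (g : Finset ι → ℝ) :
    ((i : ℝ) + 1) * ∑ D ∈ powersetCard (i + 1) I, g D =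
      ∑ D ∈ powersetCard i I, ∑ p ∈ I \ D, g (insert p D) := by
  have h1 : ((i : ℝ) + 1) * ∑ D ∈ powersetCard (i + 1) I, g D =
      ∑ D ∈ powersetCard (i + 1) I, ∑ _p ∈ D, g D := by
    rw [mul_sum]
    refine sum_congr rfl fun D hD => ?_
    rw [sum_const, (mem_powersetCard.1 hD).2, nsmul_eq_mul]
    push_cast
    rfl
  rw [h1, sum_sigma', sum_sigma']
  refine sum_bij' (fun x _ => ⟨x.1.erase x.2, x.2⟩) (fun x _ => ⟨insert x.2 x.1, x.2⟩)
    ?_ ?_ ?_ ?_ ?_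
  · rintro ⟨D, p⟩ h
    simp only [mem_sigma, mem_powersetCard, Finset.mem_sdiff] at h ⊢
    exact ⟨⟨(erase_subset _ _).trans h.1.1, by rw [card_erase_of_mem h.2, h.1.2]; rfl⟩,
      h.1.1 h.2, notMem_erase _ _⟩
  · rintro ⟨D, p⟩ h
    simp only [mem_sigma, mem_powersetCard, Finset.mem_sdiff] at h ⊢
    exact ⟨⟨insert_subset h.2.1 h.1.1, by rw [card_insert_of_notMem h.2.2, h.1.2]⟩,
      mem_insert_self _ _⟩
  · rintro ⟨D, p⟩ h
    simp only [mem_sigma] at h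
    simp [insert_erase h.2]
  · rintro ⟨D, p⟩ h
    simp only [mem_sigma, Finset.mem_sdiff] at h
    simp [erase_insert h.2.2]
  · rintro ⟨D, p⟩ h
    simp only [mem_sigma] at h
    simp [insert_erase h.2]

lemma sum_powersetCard_prod_le {ι : Type*} (I : Finset ι) {x : ι → ℝ} (hx : ∀ p ∈ I, 0 ≤ x p)
    {S : ℝ} (hS : ∑ p ∈ I, x p ≤ S) (i : ℕ) :
    ∑ D ∈ powersetCard i I, ∏ p ∈ D, x p ≤ S ^ i / i.factorial := by
  have hS0 : 0 ≤ S := (sum_nonneg hx).trans hS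
  induction i with
  | zero => simp
  | succ i ih =>
    have hi : (0 : ℝ) < (i : ℝ) + 1 := by positivity
    have h1 : ((i : ℝ) + 1) * ∑ D ∈ powersetCard (i + 1) I, ∏ p ∈ D, x p ≤
        ∑ D ∈ powersetCard i I, (∏ p ∈ D, x p) * S := by
      rw [succ_mul_sum_powersetCard_succ]
      refine sum_le_sum fun D hD => ?_
      have hDI := (mem_powersetCard.1 hD).1
      have h2 : ∀ p ∈ I \ D, ∏ q ∈ insert p D, x q = (∏ q ∈ D, x q) * x p := fun p hp => by
        rw [prod_insert (Finset.mem_sdiff.1 hp).2, mul_comm]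
      rw [sum_congr rfl h2, ← mul_sum]
      refine mul_le_mul_of_nonneg_left ((sum_le_sum_of_subset_of_nonneg sdiff_subset
        fun p hp _ => hx p hp).trans hS) (prod_nonneg fun p hp => hx p (hDI hp))
    rw [← sum_mul] at h1
    rw [Nat.factorial_succ, Nat.cast_mul, pow_succ, Nat.cast_add_one, mul_comm ((i : ℝ) + 1),
      ← div_div, le_div_iff₀ hi, mul_div_right_comm, mul_comm]
    exact h1.trans (mul_le_mul_of_nonneg_right ih hS0)

lemma sum_powersetCard_abs_resSum_union_sub_le {k E P : ℕ} {I : Finset ℕ} {κ C : ℝ} (hP : 1 ≤ P)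
    (hκ0 : 0 ≤ κ) (hκ : ResidueDiscrepancyLE k I (P ^ E) κ) (hI : ∀ p ∈ I, p.Prime)
    (hIP : ∀ p ∈ I, p ≤ P) (hIC : ∑ p ∈ I, (1 : ℝ) / p ≤ C) (a : ℕ → ℤ) {D₀ : Finset ℕ}
    (hD₀ : ∀ p ∈ D₀, p.Prime) (hdisj : Disjoint D₀ I) {N : ℕ} {F : ℤ → ℝ} (hF : IsProgAvg k F)
    (i : ℕ) (hN : 3 * (∏ p ∈ D₀, p) * P ^ (i + E) ≤ N) :
    ∑ D ∈ powersetCard i I, |resSum a N F (D₀ ∪ D) - resSum a N F D₀ / ∏ p ∈ D, (p : ℝ)| ≤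
      2 * κ * (N / ∏ p ∈ D₀, (p : ℝ)) * ((1 + C) ^ i / i.factorial) := by
  have hC0 : 0 ≤ C := (sum_nonneg fun _ _ => by positivity).trans hIC
  have hq0 : (0 : ℝ) < ∏ p ∈ D₀, (p : ℝ) :=
    prod_pos fun p hp => by exact_mod_cast (hD₀ p hp).pos
  induction i with
  | zero =>
    simp only [powersetCard_zero, sum_singleton, union_empty, prod_empty, div_one, sub_self,
      abs_zero]
    positivity
  | succ i ih =>
    have hi : (0 : ℝ) < (i : ℝ) + 1 := by positivity
    have hpow : P ^ (i + E) ≤ P ^ (i + 1 + E) := Nat.pow_le_pow_right hP (by omega)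
    have ih' := ih ((Nat.mul_le_mul_left _ hpow).trans hN)
    have h1 : ((i : ℝ) + 1) * ∑ D ∈ powersetCard (i + 1) I,
        |resSum a N F (D₀ ∪ D) - resSum a N F D₀ / ∏ p ∈ D, (p : ℝ)| ≤
        ∑ D ∈ powersetCard i I, (2 * κ * (N / ∏ p ∈ D₀, (p : ℝ)) * ∏ p ∈ D, (1 : ℝ) / p +
          C * |resSum a N F (D₀ ∪ D) - resSum a N F D₀ / ∏ p ∈ D, (p : ℝ)|) := by
      rw [succ_mul_sum_powersetCard_succ]
      refine sum_le_sum fun D hD => ?_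
      obtain ⟨hDI, hDc⟩ := mem_powersetCard.1 hD
      have hprime : ∀ p ∈ D₀ ∪ D, p.Prime := fun p hp => by
        rcases mem_union.1 hp with h | h
        exacts [hD₀ p h, hI p (hDI h)]
      have hdD : Disjoint D₀ D := Finset.disjoint_of_subset_right hDI hdisj
      have hprod : ∏ p ∈ D, p ≤ P ^ i := by
        rw [← hDc]
        exact prod_le_pow_card _ _ _ fun p hp => hIP p (hDI hp)
      have hN' : 3 * (∏ p ∈ D₀ ∪ D, p) * P ^ E ≤ N := by
        rw [prod_union hdD]
        calc _ = 3 * (∏ p ∈ D₀, p) * ((∏ p ∈ D, p) * P ^ E) := by ring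
          _ ≤ 3 * (∏ p ∈ D₀, p) * (P ^ i * P ^ E) := by gcongr
          _ ≤ _ := by rw [← pow_add]; exact (Nat.mul_le_mul_left _ hpow).trans hN
      have h2 := sum_abs_resSum_insert_sub_le (Nat.one_le_pow _ _ hP) hκ0 hκ hI a hprime hN' hF
      have hsd : I \ (D₀ ∪ D) = I \ D := by
        ext p
        simp only [Finset.mem_sdiff, mem_union, not_or]
        exact ⟨fun h => ⟨h.1, h.2.2⟩,
          fun h => ⟨h.1, fun h' => Finset.disjoint_left.1 hdisj h' h.1, h.2⟩⟩
      rw [hsd, prod_union hdD] at h2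
      have h3 : ∀ p ∈ I \ D, |resSum a N F (D₀ ∪ insert p D) -
          resSum a N F D₀ / ∏ q ∈ insert p D, (q : ℝ)| ≤
          |resSum a N F (insert p (D₀ ∪ D)) - resSum a N F (D₀ ∪ D) / p| +
            1 / p * |resSum a N F (D₀ ∪ D) - resSum a N F D₀ / ∏ q ∈ D, (q : ℝ)| := by
        intro p hp
        rw [prod_insert (Finset.mem_sdiff.1 hp).2, union_insert,
          ← abs_of_nonneg (show (0 : ℝ) ≤ 1 / p by positivity), ← abs_mul]
        refine le_trans (le_of_eq ?_) (abs_add_le _ _)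
        congr 1
        rw [mul_comm (p : ℝ), ← div_div]
        ring
      refine (sum_le_sum h3).trans ?_
      rw [sum_add_distrib, ← sum_mul]
      refine add_le_add (h2.trans_eq ?_) (mul_le_mul_of_nonneg_right
        ((sum_le_sum_of_subset_of_nonneg sdiff_subset fun _ _ _ => by positivity).trans hIC)
        (abs_nonneg _))
      rw [← div_div, prod_div_distrib, prod_const_one]
      ring
    rw [sum_add_distrib, ← mul_sum, ← mul_sum] at h1
    have h4 := sum_powersetCard_prod_le I (fun p _ => by positivity) hIC i
    have h5 : C ^ i ≤ (1 + C) ^ i := pow_le_pow_left₀ hC0 (by linarith) i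
    set X : ℝ := 2 * κ * (N / ∏ p ∈ D₀, (p : ℝ)) with hX
    have hX0 : 0 ≤ X := by positivity
    have h6 : ((i : ℝ) + 1) * ∑ D ∈ powersetCard (i + 1) I,
        |resSum a N F (D₀ ∪ D) - resSum a N F D₀ / ∏ p ∈ D, (p : ℝ)| ≤
        X * ((1 + C) ^ (i + 1) / i.factorial) := by
      refine h1.trans ?_
      calc _ ≤ X * ((1 + C) ^ i / i.factorial) + C * (X * ((1 + C) ^ i / i.factorial)) := by
            refine add_le_add (mul_le_mul_of_nonneg_left (h4.trans ?_) hX0)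
              (mul_le_mul_of_nonneg_left ih' hC0)
            gcongr
        _ = _ := by rw [pow_succ]; ring
    rw [Nat.factorial_succ, Nat.cast_mul, Nat.cast_add_one, mul_comm ((i : ℝ) + 1),
      ← div_div, mul_div_assoc', le_div_iff₀ hi, mul_comm]
    exact h6

/-- The symmetric multiaffine polynomial whose coefficient on a monomial of degree `i` is
`c i`. -/
noncomputable def symPoly {ι : Type*} (c : ℕ → ℝ) (x : ι → ℝ) (I : Finset ι) : ℝ :=
  ∑ D ∈ I.powerset, c D.card * ∏ p ∈ D, x p

lemma symPoly_empty {ι : Type*} (c : ℕ → ℝ) (x : ι → ℝ) : symPoly c x ∅ = c 0 := by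
  simp [symPoly]

lemma symPoly_insert {ι : Type*} (c : ℕ → ℝ) (x : ι → ℝ) {I : Finset ι} {p : ι} (hp : p ∉ I) :
    symPoly c x (insert p I) = symPoly c x I + x p * symPoly (fun i => c (i + 1)) x I := by
  rw [symPoly, sum_powerset_insert hp, symPoly, symPoly, mul_sum]
  congr 1
  refine sum_congr rfl fun D hD => ?_
  have : p ∉ D := fun h => hp (mem_powerset.1 hD h)
  rw [card_insert_of_notMem this, prod_insert this]
  ring

lemma symPoly_eq_sum {ι : Type*} {c : ℕ → ℝ} {β : ℕ} (hc : ∀ i, β < i → c i = 0) (x : ι → ℝ)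
    (I : Finset ι) :
    symPoly c x I = ∑ i ∈ range (β + 1), c i * ∑ D ∈ powersetCard i I, ∏ p ∈ D, x p := by
  have h1 : ∀ i ∈ range (β + 1), c i * ∑ D ∈ powersetCard i I, ∏ p ∈ D, x p =
      ∑ D ∈ I.powerset with D.card = i, c D.card * ∏ p ∈ D, x p := by
    intro i _
    rw [mul_sum, powersetCard_eq_filter]
    refine sum_congr rfl fun D hD => ?_
    rw [(mem_filter.1 hD).2]
  rw [sum_congr rfl h1, sum_fiberwise_eq_sum_filter, symPoly, sum_filter]
  refine sum_congr rfl fun D _ => ?_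
  split_ifs with h
  · rfl
  · rw [mem_range] at h
    rw [hc _ (by omega), zero_mul]

/-- The coefficients of the truncation at degree `b` of `∏ (1 - x p)`. -/
def bonfCoeff (b i : ℕ) : ℝ := if i ≤ b then (-1) ^ i else 0

/-- The coefficients of the elementary symmetric polynomial of degree `b`. -/
def esymmCoeff (b i : ℕ) : ℝ := if i = b then 1 else 0

lemma symPoly_esymmCoeff_nonneg {ι : Type*} {x : ι → ℝ} {I : Finset ι} (hx : ∀ p ∈ I, 0 ≤ x p)
    (b : ℕ) : 0 ≤ symPoly (esymmCoeff b) x I := by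
  refine sum_nonneg fun D hD => mul_nonneg ?_
    (prod_nonneg fun p hp => hx p (mem_powerset.1 hD hp))
  rw [esymmCoeff]
  split_ifs <;> norm_num

lemma symPoly_esymmCoeff_eq {ι : Type*} (x : ι → ℝ) (I : Finset ι) (b : ℕ) :
    symPoly (esymmCoeff b) x I = ∑ D ∈ powersetCard b I, ∏ p ∈ D, x p := by
  rw [symPoly, powersetCard_eq_filter, sum_filter]
  refine sum_congr rfl fun D _ => ?_
  rw [esymmCoeff]
  split_ifs <;> simp

lemma bonferroni {ι : Type*} {x : ι → ℝ} (hx0 : ∀ p, 0 ≤ x p) (hx1 : ∀ p, x p ≤ 1)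
    (I : Finset ι) (b : ℕ) :
    0 ≤ (-1) ^ b * (symPoly (bonfCoeff b) x I - ∏ p ∈ I, (1 - x p)) ∧
      (-1) ^ b * (symPoly (bonfCoeff b) x I - ∏ p ∈ I, (1 - x p)) ≤
        symPoly (esymmCoeff (b + 1)) x I := by
  induction I using Finset.induction_on generalizing b with
  | empty => simp [symPoly_empty, bonfCoeff, esymmCoeff]
  | insert p I hp ih =>
    have hV0 : 0 ≤ ∏ q ∈ I, (1 - x q) := prod_nonneg fun q _ => by linarith [hx1 q]
    have hV1 : ∏ q ∈ I, (1 - x q) ≤ 1 :=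
      prod_le_one (fun q _ => by linarith [hx1 q]) fun q _ => by linarith [hx0 q]
    have hp0 := hx0 p
    rw [symPoly_insert _ _ hp, symPoly_insert _ _ hp, prod_insert hp]
    obtain ⟨h1, h2⟩ := ih b
    have hE : (fun i => esymmCoeff (b + 1) (i + 1)) = esymmCoeff b := by
      funext i
      simp [esymmCoeff]
    rw [hE]
    rcases b with _ | b
    · have hz : (fun i => bonfCoeff 0 (i + 1)) = fun _ => 0 := by
        funext i
        simp [bonfCoeff]
      have hone : symPoly (esymmCoeff 0) x I = 1 := by
        rw [symPoly_esymmCoeff_eq]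
        simp
      have hzero : symPoly (fun _ : ℕ => (0 : ℝ)) x I = 0 := by simp [symPoly]
      rw [hz, hone, hzero]
      rw [pow_zero, one_mul] at h1 h2 ⊢
      constructor <;> nlinarith
    · have hs : symPoly (fun i => bonfCoeff (b + 1) (i + 1)) x I =
          -symPoly (bonfCoeff b) x I := by
        rw [symPoly, symPoly, ← sum_neg_distrib]
        refine sum_congr rfl fun D _ => ?_
        simp only [bonfCoeff, add_le_add_iff_right]
        split_ifs
        · rw [pow_succ]
          ring
        · simp
      rw [hs]
      obtain ⟨h3, h4⟩ := ih b
      have h5 : (-1 : ℝ) ^ (b + 1) * (symPoly (bonfCoeff (b + 1)) x I +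
          x p * -symPoly (bonfCoeff b) x I - (1 - x p) * ∏ q ∈ I, (1 - x q)) =
          (-1) ^ (b + 1) * (symPoly (bonfCoeff (b + 1)) x I - ∏ q ∈ I, (1 - x q)) +
          x p * ((-1) ^ b * (symPoly (bonfCoeff b) x I - ∏ q ∈ I, (1 - x q))) := by
        rw [pow_succ]
        ring
      rw [h5]
      exact ⟨add_nonneg h1 (mul_nonneg hp0 h3), add_le_add h2 (mul_le_mul_of_nonneg_left h4 hp0)⟩

/-- `g` is a combination of indicator functions of residue classes to moduli at most `Q` composed
of primes at most `y`, whose coefficients have weighted sum at most `s`. -/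
def SieveRep (a : ℕ → ℤ) (y : ℕ) (s : ℝ) (Q : ℕ) (g : ℤ → ℝ) : Prop :=
  ∃ (ι : Type) (𝒯 : Finset ι) (D : ι → Finset ℕ) (c : ι → ℝ),
    (∀ t ∈ 𝒯, (∀ p ∈ D t, p.Prime ∧ p ≤ y) ∧ ∏ p ∈ D t, p ≤ Q) ∧
    (∀ n, g n = ∑ t ∈ 𝒯, c t * ∏ p ∈ D t, resInd a p n) ∧
    ∑ t ∈ 𝒯, |c t| / ∏ p ∈ D t, (p : ℝ) ≤ s

lemma sieveRep_one (a : ℕ → ℤ) (y : ℕ) : SieveRep a y 1 1 fun _ => 1 :=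
  ⟨Unit, {()}, fun _ => ∅, fun _ => 1, by simp, by simp, by simp⟩

/-- The weight of a family of coefficients `c 0, …, c β`. -/
noncomputable def coeffNorm (C : ℝ) (β : ℕ) (c : ℕ → ℝ) : ℝ :=
  ∑ i ∈ range (β + 1), |c i| * ((1 + C) ^ i / i.factorial)

lemma SieveRep.mul {a : ℕ → ℤ} {y : ℕ} {s : ℝ} {Q : ℕ} {g : ℤ → ℝ} (hg : SieveRep a y s Q g)
    {I : Finset ℕ} {P β : ℕ} {C : ℝ} {c : ℕ → ℝ} (hP : 1 ≤ P) (hyP : y ≤ P)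
    (hI : ∀ p ∈ I, p.Prime) (hIy : ∀ p ∈ I, y < p) (hIP : ∀ p ∈ I, p ≤ P)
    (hIC : ∑ p ∈ I, (1 : ℝ) / p ≤ C) (hc : ∀ i, β < i → c i = 0) :
    SieveRep a P (s * coeffNorm C β c) (Q * P ^ β)
      fun n => g n * symPoly c (fun p => resInd a p n) I := by
  obtain ⟨ι, 𝒯, D, e, h1, h2, h3⟩ := hg
  have hC0 : 0 ≤ C := (sum_nonneg fun _ _ => by positivity).trans hIC
  have hdisj : ∀ t ∈ 𝒯, ∀ B ⊆ I, Disjoint (D t) B := fun t ht B hB => by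
    rw [Finset.disjoint_left]
    intro p hp hp'
    have := hIy p (hB hp')
    have := ((h1 t ht).1 p hp).2
    omega
  have hw : ∑ B ∈ (range (β + 1)).biUnion fun i => powersetCard i I,
      |c B.card| / ∏ p ∈ B, (p : ℝ) ≤ coeffNorm C β c := by
    rw [sum_biUnion fun i _ j _ hij => Finset.disjoint_left.2 fun B hB hB' => hij
      ((mem_powersetCard.1 hB).2.symm.trans (mem_powersetCard.1 hB').2)]
    refine sum_le_sum fun i _ => ?_
    have h4 := sum_powersetCard_prod_le I (fun p _ => by positivity) hIC i
    have h5 : C ^ i ≤ (1 + C) ^ i := pow_le_pow_left₀ hC0 (by linarith) i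
    calc _ = |c i| * ∑ B ∈ powersetCard i I, ∏ p ∈ B, (1 : ℝ) / p := by
          rw [mul_sum]
          refine sum_congr rfl fun B hB => ?_
          rw [(mem_powersetCard.1 hB).2, prod_div_distrib, prod_const_one]
          ring
      _ ≤ _ := by
          refine mul_le_mul_of_nonneg_left (h4.trans ?_) (abs_nonneg _)
          gcongr
  refine ⟨ι × Finset ℕ, 𝒯 ×ˢ (range (β + 1)).biUnion fun i => powersetCard i I,
    fun x => D x.1 ∪ x.2, fun x => e x.1 * c x.2.card, ?_, fun n => ?_, ?_⟩
  · rintro ⟨t, B⟩ hx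
    rw [mem_product, mem_biUnion] at hx
    obtain ⟨ht, i, hi, hB⟩ := hx
    obtain ⟨hBI, hBc⟩ := mem_powersetCard.1 hB
    refine ⟨fun p hp => ?_, ?_⟩
    · rcases mem_union.1 hp with h | h
      · exact ⟨((h1 t ht).1 p h).1, ((h1 t ht).1 p h).2.trans hyP⟩
      · exact ⟨hI p (hBI h), hIP p (hBI h)⟩
    · simp only
      rw [prod_union (hdisj t ht B hBI)]
      refine Nat.mul_le_mul (h1 t ht).2 ?_
      refine (prod_le_pow_card _ _ _ fun p hp => hIP p (hBI hp)).trans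
        (Nat.pow_le_pow_right hP ?_)
      have := mem_range.1 hi
      have hBc' : B.card = i := hBc
      change B.card ≤ β
      omega
  · simp only
    rw [h2, symPoly_eq_sum hc, sum_mul, sum_product]
    refine sum_congr rfl fun t ht => ?_
    rw [sum_biUnion fun i _ j _ hij => Finset.disjoint_left.2 fun B hB hB' => hij
      ((mem_powersetCard.1 hB).2.symm.trans (mem_powersetCard.1 hB').2), mul_sum]
    refine sum_congr rfl fun i _ => ?_
    rw [mul_sum, mul_sum]
    refine sum_congr rfl fun B hB => ?_
    obtain ⟨hBI, hBc⟩ := mem_powersetCard.1 hB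
    simp only
    rw [prod_union (hdisj t ht B hBI), hBc]
    ring
  · have hs0 : 0 ≤ ∑ t ∈ 𝒯, |e t| / ∏ p ∈ D t, (p : ℝ) := sum_nonneg fun _ _ => by positivity
    calc _ = (∑ t ∈ 𝒯, |e t| / ∏ p ∈ D t, (p : ℝ)) *
          ∑ B ∈ (range (β + 1)).biUnion fun i => powersetCard i I,
            |c B.card| / ∏ p ∈ B, (p : ℝ) := by
          rw [sum_product, sum_mul]
          refine sum_congr rfl fun t ht => ?_
          rw [mul_sum]
          refine sum_congr rfl fun B hB => ?_
          obtain ⟨i, _, hB⟩ := mem_biUnion.1 hB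
          simp only
          rw [prod_union (hdisj t ht B (mem_powersetCard.1 hB).1), abs_mul, mul_div_mul_comm]
      _ ≤ s * coeffNorm C β c :=
          mul_le_mul h3 hw (sum_nonneg fun _ _ => by positivity) (hs0.trans h3)

lemma SieveRep.abs_sum_sub_le {a : ℕ → ℤ} {y : ℕ} {s : ℝ} {Q : ℕ} {g : ℤ → ℝ}
    (hg : SieveRep a y s Q g) {I : Finset ℕ} {P β k E : ℕ} {C κ : ℝ} {c : ℕ → ℝ} (hP : 1 ≤ P)
    (hκ0 : 0 ≤ κ) (hκ : ResidueDiscrepancyLE k I (P ^ E) κ)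
    (hI : ∀ p ∈ I, p.Prime) (hIy : ∀ p ∈ I, y < p) (hIP : ∀ p ∈ I, p ≤ P)
    (hIC : ∑ p ∈ I, (1 : ℝ) / p ≤ C) (hc : ∀ i, β < i → c i = 0) {N : ℕ}
    (hN : 3 * Q * P ^ (β + E) ≤ N) {F : ℤ → ℝ} (hF : IsProgAvg k F) :
    |∑ n ∈ Ico (0 : ℤ) N, g n * symPoly c (fun p => resInd a p n) I * F n -
      symPoly c (fun p : ℕ => 1 / (p : ℝ)) I * ∑ n ∈ Ico (0 : ℤ) N, g n * F n| ≤
      2 * κ * N * (s * coeffNorm C β c) := by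
  obtain ⟨ι, 𝒯, D, e, h1, h2, h3⟩ := hg
  have hC0 : 0 ≤ C := (sum_nonneg fun _ _ => by positivity).trans hIC
  have hdisj : ∀ t ∈ 𝒯, Disjoint (D t) I := fun t ht => by
    rw [Finset.disjoint_left]
    intro p hp hp'
    have := hIy p hp'
    have := ((h1 t ht).1 p hp).2
    omega
  have e1 : ∑ n ∈ Ico (0 : ℤ) N, g n * F n = ∑ t ∈ 𝒯, e t * resSum a N F (D t) := by
    simp only [h2, resSum, sum_mul, mul_sum]
    rw [sum_comm]
    simp only [mul_assoc]
  have e2 : ∑ n ∈ Ico (0 : ℤ) N, g n * symPoly c (fun p => resInd a p n) I * F n =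
      ∑ t ∈ 𝒯, e t * ∑ i ∈ range (β + 1), c i *
        ∑ B ∈ powersetCard i I, resSum a N F (D t ∪ B) := by
    have h4 : ∀ n, g n * symPoly c (fun p => resInd a p n) I * F n =
        ∑ t ∈ 𝒯, ∑ i ∈ range (β + 1), ∑ B ∈ powersetCard i I,
          e t * (c i * ((∏ p ∈ D t ∪ B, resInd a p n) * F n)) := by
      intro n
      rw [h2, symPoly_eq_sum hc, mul_assoc, sum_mul]
      refine sum_congr rfl fun t ht => ?_
      rw [sum_mul, mul_sum]
      refine sum_congr rfl fun i _ => ?_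
      rw [mul_sum, sum_mul, mul_sum]
      refine sum_congr rfl fun B hB => ?_
      rw [prod_union (Finset.disjoint_of_subset_right (mem_powersetCard.1 hB).1 (hdisj t ht))]
      ring
    rw [sum_congr rfl fun n _ => h4 n, sum_comm]
    refine sum_congr rfl fun t ht => ?_
    rw [sum_comm, mul_sum]
    refine sum_congr rfl fun i _ => ?_
    rw [sum_comm, mul_sum, mul_sum]
    refine sum_congr rfl fun B _ => ?_
    rw [resSum, mul_sum, mul_sum]
  have e3 : symPoly c (fun p : ℕ => 1 / (p : ℝ)) I * ∑ t ∈ 𝒯, e t * resSum a N F (D t) =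
      ∑ t ∈ 𝒯, e t * ∑ i ∈ range (β + 1), c i *
        ∑ B ∈ powersetCard i I, resSum a N F (D t) / ∏ p ∈ B, (p : ℝ) := by
    rw [symPoly_eq_sum hc, mul_sum]
    refine sum_congr rfl fun t _ => ?_
    rw [mul_left_comm, sum_mul]
    congr 1
    refine sum_congr rfl fun i _ => ?_
    rw [mul_assoc, sum_mul]
    congr 1
    refine sum_congr rfl fun B _ => ?_
    rw [prod_div_distrib, prod_const_one]
    ring
  rw [e1, e2, e3, ← sum_sub_distrib]
  have h4 : ∀ t ∈ 𝒯, |(e t * ∑ i ∈ range (β + 1), c i *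
      ∑ B ∈ powersetCard i I, resSum a N F (D t ∪ B)) - (e t * ∑ i ∈ range (β + 1), c i *
        ∑ B ∈ powersetCard i I, resSum a N F (D t) / ∏ p ∈ B, (p : ℝ))| ≤
      2 * κ * N * coeffNorm C β c * (|e t| / ∏ p ∈ D t, (p : ℝ)) := by
    intro t ht
    rw [← mul_sub, ← sum_sub_distrib, abs_mul]
    have h5 : ∀ i ∈ range (β + 1), |c i * ∑ B ∈ powersetCard i I, resSum a N F (D t ∪ B) -
        c i * ∑ B ∈ powersetCard i I, resSum a N F (D t) / ∏ p ∈ B, (p : ℝ)| ≤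
        2 * κ * (N / ∏ p ∈ D t, (p : ℝ)) * (|c i| * ((1 + C) ^ i / i.factorial)) := by
      intro i hi
      rw [← mul_sub, ← sum_sub_distrib, abs_mul, mul_left_comm]
      refine mul_le_mul_of_nonneg_left ((abs_sum_le_sum_abs _ _).trans ?_) (abs_nonneg _)
      refine sum_powersetCard_abs_resSum_union_sub_le hP hκ0 hκ hI hIP hIC a
        (fun p hp => ((h1 t ht).1 p hp).1) (hdisj t ht) hF i ?_
      rw [mem_range] at hi
      refine le_trans (Nat.mul_le_mul (Nat.mul_le_mul_left 3 (h1 t ht).2)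
        (Nat.pow_le_pow_right hP (by omega))) hN
    calc _ ≤ |e t| * ∑ i ∈ range (β + 1), 2 * κ * (N / ∏ p ∈ D t, (p : ℝ)) *
          (|c i| * ((1 + C) ^ i / i.factorial)) :=
          mul_le_mul_of_nonneg_left ((abs_sum_le_sum_abs _ _).trans (sum_le_sum h5)) (abs_nonneg _)
      _ = _ := by
          rw [← mul_sum, coeffNorm]
          ring
  have hcn : 0 ≤ coeffNorm C β c := sum_nonneg fun _ _ => by positivity
  calc _ ≤ ∑ t ∈ 𝒯, 2 * κ * N * coeffNorm C β c * (|e t| / ∏ p ∈ D t, (p : ℝ)) :=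
        (abs_sum_le_sum_abs _ _).trans (sum_le_sum h4)
    _ ≤ 2 * κ * N * coeffNorm C β c * s := by
        rw [← mul_sum]
        exact mul_le_mul_of_nonneg_left h3 (by positivity)
    _ = _ := by ring

/-- The composition of several blocks of sieve weights. -/
theorem abs_sum_prod_symPoly_sub_le {k E : ℕ} {C R : ℝ} (hR : 0 ≤ R) (y β : ℕ → ℕ)
    (κ ρ U : ℕ → ℝ)
    (I : ℕ → Finset ℕ) (c : ℕ → ℕ → ℝ) (hy : ∀ j, 1 ≤ y j) (hymono : ∀ j, y j ≤ y (j + 1))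
    (hκ0 : ∀ j, 0 ≤ κ j)
    (hκ : ∀ j, ResidueDiscrepancyLE k (I j) (y (j + 1) ^ E) (κ j))
    (hI : ∀ j, ∀ p ∈ I j, p.Prime) (hIy : ∀ j, ∀ p ∈ I j, y j < p)
    (hIP : ∀ j, ∀ p ∈ I j, p ≤ y (j + 1))
    (hIC : ∀ j, ∑ p ∈ I j, (1 : ℝ) / p ≤ C) (hc : ∀ j i, β j < i → c j i = 0)
    (hρ : ∀ j, 0 ≤ ρ j) (hU : ∀ j, 0 ≤ U j)
    (hφ : ∀ j, |symPoly (c j) (fun p : ℕ => 1 / (p : ℝ)) (I j)| ≤ ρ j * U j)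
    (hs : ∀ j, coeffNorm C (β j) (c j) ≤ ρ j * R * U j) (a : ℕ → ℤ) (J : ℕ) {N : ℕ}
    (hN : 3 * (∏ j ∈ range J, y (j + 1) ^ β j) * y J ^ E ≤ N) {F : ℤ → ℝ} (hF : IsProgAvg k F) :
    |∑ n ∈ Ico (0 : ℤ) N, (∏ j ∈ range J, symPoly (c j) (fun p => resInd a p n) (I j)) * F n -
      (∏ j ∈ range J, symPoly (c j) (fun p : ℕ => 1 / (p : ℝ)) (I j)) *
        ∑ n ∈ Ico (0 : ℤ) N, F n| ≤
      N * (∏ j ∈ range J, ρ j * U j) * ∑ j ∈ range J, 2 * κ j * R ^ (j + 1) := by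
  have hC0 : 0 ≤ C := (sum_nonneg fun _ _ => by positivity).trans (hIC 0)
  have hcn : ∀ j, 0 ≤ coeffNorm C (β j) (c j) := fun j => sum_nonneg fun _ _ => by positivity
  have hrep : ∀ J, SieveRep a (y J) (∏ j ∈ range J, coeffNorm C (β j) (c j))
      (∏ j ∈ range J, y (j + 1) ^ β j)
      fun n => ∏ j ∈ range J, symPoly (c j) (fun p => resInd a p n) (I j) := by
    intro J
    induction J with
    | zero => simpa using sieveRep_one a (y 0)
    | succ J ih =>
      simp only [prod_range_succ]
      exact ih.mul (hy _) (hymono J) (hI J) (hIy J) (hIP J) (hIC J) (hc J)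
  induction J with
  | zero => simp
  | succ J ih =>
    have hpow : 3 * (∏ j ∈ range J, y (j + 1) ^ β j) * y (J + 1) ^ (β J + E) ≤ N := by
      refine le_trans (le_of_eq ?_) hN
      rw [prod_range_succ, pow_add]
      ring
    have hN' : 3 * (∏ j ∈ range J, y (j + 1) ^ β j) * y J ^ E ≤ N := by
      refine le_trans (Nat.mul_le_mul_left _ ?_) hpow
      exact (Nat.pow_le_pow_left (hymono J) E).trans
        (Nat.pow_le_pow_right (hy _) (Nat.le_add_left _ _))
    have h1 := ih hN'
    have h2 := (hrep J).abs_sum_sub_le (hy _) (hκ0 J) (hκ J) (hI J) (hIy J) (hIP J) (hIC J)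
      (hc J) hpow hF
    simp only [prod_range_succ, sum_range_succ]
    set X := ∑ n ∈ Ico (0 : ℤ) N,
      (∏ j ∈ range J, symPoly (c j) (fun p => resInd a p n) (I j)) * F n
    set W := ∏ j ∈ range J, symPoly (c j) (fun p : ℕ => 1 / (p : ℝ)) (I j)
    set φ := symPoly (c J) (fun p : ℕ => 1 / (p : ℝ)) (I J)
    set Y := ∑ n ∈ Ico (0 : ℤ) N, F n
    set Z := ∑ n ∈ Ico (0 : ℤ) N, (∏ j ∈ range J, symPoly (c j) (fun p => resInd a p n) (I j)) *
      symPoly (c J) (fun p => resInd a p n) (I J) * F n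
    set G := ∏ j ∈ range J, ρ j * U j
    have hG0 : 0 ≤ G := prod_nonneg fun j _ => mul_nonneg (hρ j) (hU j)
    have h3 : (∏ j ∈ range J, coeffNorm C (β j) (c j)) * coeffNorm C (β J) (c J) ≤
        G * (ρ J * U J) * R ^ (J + 1) := by
      have h4 : ∏ j ∈ range J, coeffNorm C (β j) (c j) ≤ G * R ^ J := by
        refine (prod_le_prod (fun j _ => hcn j) fun j _ => hs j).trans_eq ?_
        rw [← card_range J, ← prod_const, card_range, ← prod_mul_distrib]
        exact prod_congr rfl fun j _ => by ring
      calc _ ≤ G * R ^ J * (ρ J * R * U J) :=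
            mul_le_mul h4 (hs J) (hcn J) (by positivity)
        _ = _ := by rw [pow_succ]; ring
    have h5 : |φ| * |X - W * Y| ≤ ρ J * U J *
        (N * G * ∑ j ∈ range J, 2 * κ j * R ^ (j + 1)) :=
      mul_le_mul (hφ J) h1 (abs_nonneg _) (mul_nonneg (hρ J) (hU J))
    have hκJ := hκ0 J
    calc |Z - W * φ * Y| = |(Z - φ * X) + φ * (X - W * Y)| := by congr 1; ring
      _ ≤ |Z - φ * X| + |φ| * |X - W * Y| := by
          rw [← abs_mul]
          exact abs_add_le _ _
      _ ≤ 2 * κ J * N * (G * (ρ J * U J) * R ^ (J + 1)) +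
          ρ J * U J * (N * G * ∑ j ∈ range J, 2 * κ j * R ^ (j + 1)) :=
          add_le_add (h2.trans (mul_le_mul_of_nonneg_left h3 (by positivity))) h5
      _ = _ := by ring

lemma prod_sub_sum_prod_ite_le {V U e : ℕ → ℝ} (hV : ∀ j, 0 ≤ V j) (hVU : ∀ j, V j ≤ U j)
    (he : ∀ j, U j - V j ≤ e j) (J : ℕ) :
    ∏ j ∈ range J, U j - ∑ j₀ ∈ range J, ∏ j ∈ range J, (if j = j₀ then e j else U j) ≤
      ∏ j ∈ range J, V j := by
  induction J with
  | zero => simp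
  | succ J ih =>
    have h1 : ∏ j ∈ range J, (if j = J then e j else U j) = ∏ j ∈ range J, U j :=
      prod_congr rfl fun j hj => if_neg (mem_range.1 hj).ne
    have h2 : ∀ j₀ ∈ range J, (if J = j₀ then e J else U J) = U J :=
      fun j₀ hj => if_neg (mem_range.1 hj).ne'
    have h3 : ∑ j₀ ∈ range (J + 1), ∏ j ∈ range (J + 1), (if j = j₀ then e j else U j) =
        (∑ j₀ ∈ range J, ∏ j ∈ range J, (if j = j₀ then e j else U j)) * U J +
          (∏ j ∈ range J, U j) * e J := by
      rw [sum_range_succ]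
      simp only [prod_range_succ, h1, if_true, sum_mul]
      congr 1
      exact sum_congr rfl fun j₀ hj => by rw [h2 j₀ hj]
    rw [h3, prod_range_succ, prod_range_succ]
    have h4 : ∏ j ∈ range J, V j ≤ ∏ j ∈ range J, U j :=
      prod_le_prod (fun j _ => hV j) fun j _ => hVU j
    have h5 : 0 ≤ ∏ j ∈ range J, V j := prod_nonneg fun j _ => hV j
    have h6 := mul_le_mul_of_nonneg_right ih ((hV J).trans (hVU J))
    have h7 := mul_le_mul h4 (he J) (sub_nonneg.2 (hVU J)) (h5.trans h4)
    nlinarith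

lemma exists_mem_primesIn_of_mem {w p : ℕ} (J : ℕ) (hp : p ∈ primesIn w (w ^ 2 ^ J)) :
    ∃ j ∈ range J, p ∈ primesIn (w ^ 2 ^ j) (w ^ 2 ^ (j + 1)) := by
  induction J with
  | zero =>
    rw [mem_primesIn] at hp
    simp at hp
    omega
  | succ J ih =>
    rcases le_or_gt p (w ^ 2 ^ J) with h | h
    · obtain ⟨j, hj, hj'⟩ := ih (mem_primesIn.2 ⟨⟨(mem_primesIn.1 hp).1.1, h⟩,
        (mem_primesIn.1 hp).2⟩)
      exact ⟨j, mem_range.2 ((mem_range.1 hj).trans (Nat.lt_succ_self J)), hj'⟩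
    · exact ⟨J, mem_range.2 (Nat.lt_succ_self J), mem_primesIn.2
        ⟨⟨h, (mem_primesIn.1 hp).1.2⟩, (mem_primesIn.1 hp).2⟩⟩

lemma sum_two_pow_mul_le (m J : ℕ) :
    ∑ j ∈ range J, 2 ^ (j + 1) * (2 * (J - 1 - j + m) + 1) + (4 * J + 4 * m + 6) ≤
      2 ^ J * (6 + 4 * m) := by
  induction J with
  | zero => simp; omega
  | succ J ih =>
    rw [sum_range_succ']
    have h1 : ∀ j ∈ range J, 2 ^ (j + 1 + 1) * (2 * (J + 1 - 1 - (j + 1) + m) + 1) =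
        2 * (2 ^ (j + 1) * (2 * (J - 1 - j + m) + 1)) := fun j _ => by
      rw [show J + 1 - 1 - (j + 1) = J - 1 - j by omega]
      ring
    rw [sum_congr rfl h1, ← mul_sum, show J + 1 - 1 - 0 = J by omega]
    have h2 : 2 ^ (J + 1) * (6 + 4 * m) = 2 * (2 ^ J * (6 + 4 * m)) := by ring
    rw [h2, zero_add, pow_one]
    linarith

lemma coeffNorm_bonfCoeff_le {C : ℝ} (hC : 0 ≤ C) (β b : ℕ) :
    coeffNorm C β (bonfCoeff b) ≤ Real.exp (1 + C) := by
  refine le_trans (sum_le_sum fun i _ => ?_) (Real.sum_le_exp_of_nonneg (by linarith) (β + 1))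
  have : |bonfCoeff b i| ≤ 1 := by
    rw [bonfCoeff]
    split_ifs <;> simp
  exact mul_le_of_le_one_left (by positivity) this

lemma coeffNorm_esymmCoeff (C : ℝ) (b : ℕ) :
    coeffNorm C b (esymmCoeff b) = (1 + C) ^ b / b.factorial := by
  rw [coeffNorm, sum_eq_single b]
  · simp [esymmCoeff]
  · intro i _ hi
    simp [esymmCoeff, hi]
  · simp

lemma exists_sum_pow_div_factorial_le (T v : ℝ) :
    ∃ m : ℕ, ∀ J, ∑ j ∈ range J, T ^ (2 * (J - 1 - j + m) + 1) /
      (2 * (J - 1 - j + m) + 1).factorial / v ≤ 1 / 2 := by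
  have h1 : Summable fun i : ℕ => |T| ^ i / i.factorial / |v| :=
    (Real.summable_pow_div_factorial |T|).div_const _
  have h2 : Summable fun i : ℕ => |T| ^ (2 * i + 1) / (2 * i + 1).factorial / |v| :=
    h1.comp_injective (i := fun i : ℕ => 2 * i + 1) fun i j h => by
      simp only at h
      omega
  have h3 := tendsto_sum_nat_add fun i : ℕ => |T| ^ (2 * i + 1) / (2 * i + 1).factorial / |v|
  obtain ⟨m, hm⟩ := (h3.eventually (gt_mem_nhds (by norm_num : (0 : ℝ) < 1 / 2))).exists
  refine ⟨m, fun J => ?_⟩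
  have h4 : Summable fun i : ℕ => |T| ^ (2 * (i + m) + 1) / (2 * (i + m) + 1).factorial / |v| :=
    (summable_nat_add_iff m).2 h2
  have h5 := h4.sum_le_tsum (range J) fun i _ => by positivity
  rw [← sum_range_reflect] at h5
  refine le_trans (sum_le_sum fun j _ => ?_) (h5.trans hm.le)
  refine (le_abs_self _).trans_eq ?_
  rw [abs_div, abs_div, abs_pow, Nat.abs_cast]

lemma sum_pow_succ_le {q : ℝ} (hq0 : 0 ≤ q) (hq : q ≤ 1 / 2) (J : ℕ) :
    ∑ j ∈ range J, q ^ (j + 1) ≤ 2 * q := by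
  simp only [pow_succ]
  rw [← sum_mul]
  refine mul_le_mul_of_nonneg_right ?_ hq0
  calc _ ≤ ∑ j ∈ range J, (1 / 2 : ℝ) ^ j :=
        sum_le_sum fun j _ => pow_le_pow_left₀ hq0 hq j
    _ ≤ ∑' j : ℕ, (1 / 2 : ℝ) ^ j := summable_geometric_two.sum_le_tsum _ fun _ _ => by positivity
    _ = 2 := tsum_geometric_two

lemma rpow_div_pow_two_pow_le {K θ w : ℝ} (hK : 0 ≤ K) (hθ : 0 ≤ θ) (hw : 1 ≤ w) (j : ℕ) :
    (K / w ^ 2 ^ j) ^ θ ≤ K ^ θ / (w ^ θ) ^ (j + 1) := by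
  have h1 : 1 ≤ w ^ θ := Real.one_le_rpow hw hθ
  rw [Real.div_rpow hK (by positivity)]
  have h2 : (w ^ θ) ^ (j + 1) ≤ (w ^ 2 ^ j) ^ θ := by
    have h3 : (w ^ 2 ^ j) ^ θ = (w ^ θ) ^ 2 ^ j := by
      rw [← Real.rpow_natCast w, ← Real.rpow_natCast (w ^ θ), ← Real.rpow_mul (by linarith),
        ← Real.rpow_mul (by linarith), mul_comm]
    rw [h3]
    exact pow_le_pow_right₀ h1 Nat.lt_two_pow_self
  gcongr

/-- A lower bound sieve for averages along progressions. -/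
theorem exists_rough_of_le_sum (k : ℕ) : ∃ B : ℕ, ∀ c : ℝ, 0 < c → ∃ w : ℕ, 2 ≤ w ∧
    ∀ (a : ℕ → ℤ) (J N : ℕ), 3 * (w ^ 2 ^ J) ^ B ≤ N → ∀ F : ℤ → ℝ, IsProgAvg k F →
      (∀ n, 0 ≤ F n) → c * N ≤ ∑ n ∈ Ico (0 : ℤ) N, F n →
      ∃ n ∈ Ico (0 : ℤ) N, 0 < F n ∧ ∀ p ∈ primesIn w (w ^ 2 ^ J), ¬ (p : ℤ) ∣ n - a p := by
  obtain ⟨K, hK, hdisc⟩ := exists_residueDiscrepancyLE k (C := 8) (by norm_num)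
  let E : ℕ := 2 ^ (k + 1) + 1
  let θ : ℝ := 1 / 2 ^ (k + 1)
  have hθ : 0 < θ := by positivity
  let v : ℝ := Real.exp (-(2 * 8))
  have hv : 0 < v := Real.exp_pos _
  let R : ℝ := Real.exp (1 + 8) / v
  have hR : 0 < R := by positivity
  have hRv : R * v = Real.exp (1 + 8) := div_mul_cancel₀ _ hv.ne'
  have hR1 : 1 ≤ R := by
    rw [one_le_div hv]
    exact Real.exp_le_exp.2 (by norm_num)
  obtain ⟨m, hm⟩ := exists_sum_pow_div_factorial_le (1 + 8) v
  refine ⟨6 + 4 * m + E, fun c hc => ?_⟩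
  obtain ⟨w, hw2, hwq, hwc⟩ : ∃ w : ℕ, 2 ≤ w ∧ R / (w : ℝ) ^ θ ≤ 1 / 2 ∧
      4 * K ^ θ * (R / (w : ℝ) ^ θ) ≤ c / 8 := by
    have h1 : Tendsto (fun w : ℕ => R / (w : ℝ) ^ θ) atTop (𝓝 0) :=
      ((tendsto_rpow_atTop hθ).comp tendsto_natCast_atTop_atTop).const_div_atTop R
    have h2 := h1.const_mul (4 * K ^ θ)
    rw [mul_zero] at h2
    have h3 := h1.eventually (ge_mem_nhds (by norm_num : (0 : ℝ) < 1 / 2))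
    have h4 := h2.eventually (ge_mem_nhds (by positivity : 0 < c / 8))
    obtain ⟨w, ⟨h5, h6⟩, h7⟩ := ((h3.and h4).and (eventually_ge_atTop 2)).exists
    exact ⟨w, h7, h5, h6⟩
  refine ⟨w, hw2, fun a J N hN F hF hF0 hFc => ?_⟩
  have hw1 : 1 ≤ w := by omega
  let y : ℕ → ℕ := fun j => w ^ 2 ^ j
  have hysq : ∀ j, y (j + 1) = y j ^ 2 := fun j => by
    simp only [y]
    rw [← pow_mul, pow_succ]
  have hy2 : ∀ j, 2 ≤ y j := fun j => hw2.trans (Nat.le_self_pow (by positivity) w)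
  let I : ℕ → Finset ℕ := fun j => primesIn (y j) (y (j + 1))
  have hIp : ∀ j, ∀ p ∈ I j, p.Prime := fun j p hp => (mem_primesIn.1 hp).2
  have hIy : ∀ j, ∀ p ∈ I j, y j < p := fun j p hp => (mem_primesIn.1 hp).1.1
  have hIP : ∀ j, ∀ p ∈ I j, p ≤ y (j + 1) := fun j p hp => (mem_primesIn.1 hp).1.2
  have hIC : ∀ j, ∑ p ∈ I j, (1 : ℝ) / p ≤ 8 := fun j => by
    simp only [I, hysq]
    exact sum_inv_primesIn_sq_le (hy2 j)
  have hymono : ∀ j, y j ≤ y (j + 1) := fun j => by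
    rw [hysq]
    exact Nat.le_self_pow two_ne_zero _
  let κ : ℕ → ℝ := fun j => (K / y j) ^ θ
  have hκ0 : ∀ j, 0 ≤ κ j := fun j => by positivity
  have hκ : ∀ j, ResidueDiscrepancyLE k (I j) (y (j + 1) ^ E) (κ j) := fun j =>
    hdisc (I j) (y j) (y (j + 1)) (hIp j) (hIC j) (fun p hp => (hIy j p hp).le) (hIP j)
      (by have := hy2 j; omega) (hymono j)
  let b : ℕ → ℕ := fun j => 2 * (J - 1 - j + m)
  have hb : ∀ j, (-1 : ℝ) ^ b j = 1 := fun j => by simp [b, pow_mul]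
  let U : ℕ → ℝ := fun j => symPoly (bonfCoeff (b j)) (fun p : ℕ => 1 / (p : ℝ)) (I j)
  have hinv0 : ∀ p : ℕ, (0 : ℝ) ≤ 1 / p := fun p => by positivity
  have hinv1 : ∀ p : ℕ, (1 : ℝ) / p ≤ 1 := fun p => by
    rw [one_div]
    exact Nat.cast_inv_le_one p
  have hUv : ∀ j, v ≤ U j := fun j => by
    have h1 := (bonferroni hinv0 hinv1 (I j) (b j)).1
    rw [hb, one_mul] at h1
    exact (exp_neg_le_prod_one_sub (hIp j) (hIC j)).trans (sub_nonneg.1 h1)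
  have hU0 : ∀ j, 0 < U j := fun j => hv.trans_le (hUv j)
  let r : ℕ → ℝ := fun j => (1 + 8) ^ (b j + 1) / (b j + 1).factorial / v
  have hr0 : ∀ j, 0 ≤ r j := fun j => by positivity
  have hrsum : ∑ j ∈ range J, r j ≤ 1 / 2 := hm J
  let δ : ℝ := ∑ j ∈ range J, 2 * κ j * R ^ (j + 1)
  have hδ0 : 0 ≤ δ := sum_nonneg fun j _ => mul_nonneg (mul_nonneg zero_le_two (hκ0 j)) (by positivity)
  have hδ : δ ≤ c / 8 := by
    have h1 : ∀ j ∈ range J, 2 * κ j * R ^ (j + 1) ≤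
        2 * K ^ θ * (R / (w : ℝ) ^ θ) ^ (j + 1) := by
      intro j _
      have h2 := rpow_div_pow_two_pow_le hK.le hθ.le
        (by exact_mod_cast hw1 : (1 : ℝ) ≤ w) j
      have h3 : κ j ≤ K ^ θ / ((w : ℝ) ^ θ) ^ (j + 1) := by
        simp only [κ, y]
        push_cast
        exact h2
      calc _ ≤ 2 * (K ^ θ / ((w : ℝ) ^ θ) ^ (j + 1)) * R ^ (j + 1) := by gcongr
        _ = _ := by rw [div_pow]; ring
    refine (sum_le_sum h1).trans ?_
    rw [← mul_sum]
    have h4 := sum_pow_succ_le (by positivity) hwq J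
    calc _ ≤ 2 * K ^ θ * (2 * (R / (w : ℝ) ^ θ)) :=
          mul_le_mul_of_nonneg_left h4 (by positivity)
      _ ≤ c / 8 := by linarith
  have hlevel : 3 * (∏ j ∈ range J, y (j + 1) ^ (b j + 1)) * y J ^ E ≤ N := by
    refine le_trans ?_ hN
    rw [mul_assoc]
    refine Nat.mul_le_mul_left 3 ?_
    have h1 : ∏ j ∈ range J, y (j + 1) ^ (b j + 1) =
        w ^ ∑ j ∈ range J, 2 ^ (j + 1) * (2 * (J - 1 - j + m) + 1) := by
      rw [← prod_pow_eq_pow_sum]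
      exact prod_congr rfl fun j _ => by simp only [y, b]; rw [← pow_mul]
    rw [h1]
    simp only [y]
    rw [← pow_mul, ← pow_mul, ← pow_add]
    refine Nat.pow_le_pow_right hw1 ?_
    have := sum_two_pow_mul_le m J
    rw [mul_add (2 ^ J) (6 + 4 * m) E]
    omega
  -- the main term and the Bonferroni errors
  let X₀ : ℝ := ∑ n ∈ Ico (0 : ℤ) N, F n
  have hX₀0 : 0 ≤ X₀ := sum_nonneg fun n _ => hF0 n
  let W : ℝ := ∏ j ∈ range J, U j
  have hW0 : 0 < W := prod_pos fun j _ => hU0 j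
  have hbonf : ∀ j i, b j + 1 < i → bonfCoeff (b j) i = 0 := fun j i hi =>
    if_neg (by omega)
  have hesymm : ∀ j i, b j + 1 < i → esymmCoeff (b j + 1) i = 0 := fun j i hi =>
    if_neg (by omega)
  have hbn : ∀ j, coeffNorm 8 (b j + 1) (bonfCoeff (b j)) ≤ R * U j := fun j =>
    (coeffNorm_bonfCoeff_le (by norm_num) _ _).trans
      (hRv.symm.le.trans (mul_le_mul_of_nonneg_left (hUv j) hR.le))
  have hrv : ∀ j, (1 + 8 : ℝ) ^ (b j + 1) / (b j + 1).factorial ≤ r j * U j := fun j => by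
    have h1 : (1 + 8 : ℝ) ^ (b j + 1) / (b j + 1).factorial = r j * v :=
      (div_mul_cancel₀ _ hv.ne').symm
    rw [h1]
    exact mul_le_mul_of_nonneg_left (hUv j) (hr0 j)
  have hen : ∀ j, coeffNorm 8 (b j + 1) (esymmCoeff (b j + 1)) ≤ r j * R * U j := fun j => by
    rw [coeffNorm_esymmCoeff, mul_right_comm]
    exact (hrv j).trans (le_mul_of_one_le_right (mul_nonneg (hr0 j) (hU0 j).le) hR1)
  have heφ : ∀ j, |symPoly (esymmCoeff (b j + 1)) (fun p : ℕ => 1 / (p : ℝ)) (I j)| ≤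
      r j * U j := fun j => by
    rw [abs_of_nonneg (symPoly_esymmCoeff_nonneg (fun p _ => hinv0 p) _), symPoly_esymmCoeff_eq]
    refine (sum_powersetCard_prod_le (I j) (fun p _ => hinv0 p) (hIC j) _).trans
      (le_trans ?_ (hrv j))
    gcongr
    norm_num
  have hmain : W * X₀ - N * W * δ ≤
      ∑ n ∈ Ico (0 : ℤ) N, (∏ j ∈ range J,
        symPoly (bonfCoeff (b j)) (fun p => resInd a p n) (I j)) * F n := by
    have h1 := abs_sum_prod_symPoly_sub_le hR.le y (fun j => b j + 1) κ (fun _ => 1) U I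
      (fun j => bonfCoeff (b j)) (fun j => one_le_two.trans (hy2 j)) hymono hκ0 hκ hIp hIy hIP hIC
      hbonf (fun _ => zero_le_one) (fun j => (hU0 j).le)
      (fun j => by rw [one_mul]; exact (abs_of_pos (hU0 j)).le)
      (fun j => by rw [one_mul]; exact hbn j) a J hlevel hF
    simp only [one_mul] at h1
    have h2 := (abs_le.1 h1).1
    simp only [W, X₀, δ, U] at h2 ⊢
    linarith
  have herr : ∀ j₀ ∈ range J, ∑ n ∈ Ico (0 : ℤ) N, (∏ j ∈ range J,
      if j = j₀ then symPoly (esymmCoeff (b j + 1)) (fun p => resInd a p n) (I j)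
        else symPoly (bonfCoeff (b j)) (fun p => resInd a p n) (I j)) * F n ≤
      r j₀ * W * X₀ + N * (r j₀ * W) * δ := by
    intro j₀ hj₀
    let ρ : ℕ → ℝ := fun j => if j = j₀ then r j else 1
    let d : ℕ → ℕ → ℝ := fun j => if j = j₀ then esymmCoeff (b j + 1) else bonfCoeff (b j)
    have hd : ∀ (x : ℕ → ℝ) j, symPoly (d j) x (I j) = if j = j₀ then
        symPoly (esymmCoeff (b j + 1)) x (I j) else symPoly (bonfCoeff (b j)) x (I j) := by
      intro x j
      simp only [d]
      split_ifs <;> rfl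
    have hφ : ∀ j, |symPoly (d j) (fun p : ℕ => 1 / (p : ℝ)) (I j)| ≤ ρ j * U j := by
      intro j
      rw [hd]
      simp only [ρ]
      split_ifs with h
      · exact heφ j
      · rw [one_mul]
        exact (abs_of_pos (hU0 j)).le
    have hρU : ∏ j ∈ range J, ρ j * U j = r j₀ * W := by
      rw [prod_mul_distrib, prod_ite_eq' (range J) j₀, if_pos hj₀]
    have h1 := abs_sum_prod_symPoly_sub_le hR.le y (fun j => b j + 1) κ ρ U I d
      (fun j => one_le_two.trans (hy2 j)) hymono hκ0 hκ hIp hIy hIP hIC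
      (fun j i hi => by
        simp only [d]
        split_ifs
        exacts [hesymm j i hi, hbonf j i hi])
      (fun j => by
        simp only [ρ]
        split_ifs
        exacts [hr0 j, zero_le_one])
      (fun j => (hU0 j).le) hφ
      (fun j => by
        simp only [d, ρ]
        split_ifs
        · exact hen j
        · rw [one_mul]
          exact hbn j) a J hlevel hF
    rw [hρU] at h1
    simp only [hd] at h1
    have h2 := (abs_le.1 h1).2
    have h3 : (∏ j ∈ range J, symPoly (d j) (fun p : ℕ => 1 / (p : ℝ)) (I j)) ≤ r j₀ * W := by
      rw [← hρU]
      refine (le_abs_self _).trans ?_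
      rw [abs_prod]
      exact prod_le_prod (fun _ _ => abs_nonneg _) fun j _ => hφ j
    simp only [hd] at h3
    have h4 := mul_le_mul_of_nonneg_right h3 hX₀0
    simp only [X₀] at h4 ⊢
    linarith
  -- the sifted sum is positive
  have hpos : 0 < ∑ n ∈ Ico (0 : ℤ) N,
      (∏ j ∈ range J, ∏ p ∈ I j, (1 - resInd a p n)) * F n := by
    have h1 : ∑ n ∈ Ico (0 : ℤ) N, (∏ j ∈ range J,
        symPoly (bonfCoeff (b j)) (fun p => resInd a p n) (I j)) * F n -
        ∑ j₀ ∈ range J, ∑ n ∈ Ico (0 : ℤ) N, (∏ j ∈ range J,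
          if j = j₀ then symPoly (esymmCoeff (b j + 1)) (fun p => resInd a p n) (I j)
            else symPoly (bonfCoeff (b j)) (fun p => resInd a p n) (I j)) * F n ≤
        ∑ n ∈ Ico (0 : ℤ) N, (∏ j ∈ range J, ∏ p ∈ I j, (1 - resInd a p n)) * F n := by
      rw [sum_comm, ← sum_sub_distrib]
      refine sum_le_sum fun n _ => ?_
      rw [← sum_mul, ← sub_mul]
      refine mul_le_mul_of_nonneg_right (prod_sub_sum_prod_ite_le
        (fun j => prod_nonneg fun p _ => sub_nonneg.2 (resInd_le_one a p n))
        (fun j => ?_) (fun j => ?_) J) (hF0 n)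
      · have h2 := (bonferroni (fun p => resInd_nonneg a p n) (fun p => resInd_le_one a p n)
          (I j) (b j)).1
        rw [hb, one_mul] at h2
        exact sub_nonneg.1 h2
      · have h2 := (bonferroni (fun p => resInd_nonneg a p n) (fun p => resInd_le_one a p n)
          (I j) (b j)).2
        rwa [hb, one_mul] at h2
    refine lt_of_lt_of_le ?_ h1
    have h2 := sum_le_sum herr
    rw [sum_add_distrib, ← sum_mul, ← sum_mul, ← sum_mul, ← mul_sum, ← sum_mul] at h2
    have hNpos : (0 : ℝ) < N := by
      have : 0 < N := lt_of_lt_of_le (by positivity) hN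
      exact_mod_cast this
    set S := ∑ j ∈ range J, r j
    have hS0 : 0 ≤ S := sum_nonneg fun j _ => hr0 j
    have h3 : 0 < X₀ * (1 - S) - N * δ * (1 + S) := by
      have h4 : X₀ * (1 / 2) ≤ X₀ * (1 - S) := mul_le_mul_of_nonneg_left (by linarith) hX₀0
      have h5 : N * δ * (1 + S) ≤ N * (c / 8) * 2 := by gcongr; linarith
      have h6 : 0 < c * N := by positivity
      have h7 : c * N ≤ X₀ := hFc
      linarith
    have h4 := mul_pos hW0 h3
    nlinarith
  obtain ⟨n, hn, hn0⟩ := exists_ne_zero_of_sum_ne_zero hpos.ne'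
  refine ⟨n, hn, lt_of_le_of_ne (hF0 n) (right_ne_zero_of_mul hn0).symm, fun p hp hdvd => ?_⟩
  obtain ⟨j, hj, hpj⟩ := exists_mem_primesIn_of_mem J hp
  have h1 := prod_ne_zero_iff.1 (prod_ne_zero_iff.1 (left_ne_zero_of_mul hn0) j hj) p hpj
  rw [resInd, if_pos hdvd] at h1
  simp at h1

lemma pow_bigOmega_le {z x : ℕ} (hx : 0 < x) (h : ∀ p, p.Prime → p ∣ x → z ≤ p) :
    z ^ bigOmega x ≤ x := by
  conv_rhs => rw [← Nat.prod_primeFactorsList hx.ne']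
  refine List.pow_card_le_prod _ _ fun p hp => ?_
  exact h p (Nat.prime_of_mem_primeFactorsList hp) (Nat.dvd_of_mem_primeFactorsList hp)

lemma bigOmega_mul {m n : ℕ} (hm : 0 < m) (hn : 0 < n) :
    bigOmega (m * n) = bigOmega m + bigOmega n := by
  rw [bigOmega, (Nat.perm_primeFactorsList_mul hm.ne' hn.ne').length_eq, List.length_append]
  rfl

lemma bigOmega_prime {p : ℕ} (hp : p.Prime) : bigOmega p = 1 := by
  rw [bigOmega, Nat.primeFactorsList_prime hp, List.length_singleton]

lemma bigOmega_two_pow (n : ℕ) : bigOmega (2 ^ n) = n := by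
  rw [bigOmega, Nat.Prime.primeFactorsList_pow Nat.prime_two, List.length_replicate]

lemma exists_dvd_iff_dvd_sub {b Y : ℕ} (hbY : b.Coprime Y) :
    ∃ a : ℕ → ℤ, ∀ p : ℕ, p.Prime → ∀ n : ℤ, ((p : ℤ) ∣ b + Y * n → (p : ℤ) ∣ n - a p) ∧
      (¬ p ∣ Y → (p : ℤ) ∣ n - a p → (p : ℤ) ∣ b + Y * n) := by
  have : ∀ p : ℕ, ∃ t : ℤ, p.Prime → ∀ n : ℤ, ((p : ℤ) ∣ b + Y * n → (p : ℤ) ∣ n - t) ∧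
      (¬ p ∣ Y → (p : ℤ) ∣ n - t → (p : ℤ) ∣ b + Y * n) := by
    intro p
    by_cases hp : p.Prime ∧ ¬ p ∣ Y
    · have hc : IsCoprime (p : ℤ) (Y : ℤ) :=
        Nat.isCoprime_iff_coprime.2 ((Nat.Prime.coprime_iff_not_dvd hp.1).2 hp.2)
      obtain ⟨u, v, huv⟩ := hc
      refine ⟨-(v * b), fun _ n => ⟨fun hn => ?_, fun _ hn => ?_⟩⟩
      · have h1 : n - -(v * b) = v * (b + Y * n) + p * (u * n) := by
          linear_combination (-n) * huv
        rw [h1]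
        exact dvd_add (Dvd.dvd.mul_left hn _) (dvd_mul_right _ _)
      · have h1 : b + Y * n = Y * (n - -(v * b)) + p * (u * b) := by
          linear_combination (-b : ℤ) * huv
        rw [h1]
        exact dvd_add (Dvd.dvd.mul_left hn _) (dvd_mul_right _ _)
    · refine ⟨0, fun hp' n => ⟨fun hn => ?_, fun hpY => absurd ⟨hp', hpY⟩ hp⟩⟩
      have hpY : p ∣ Y := by
        by_contra h
        exact hp ⟨hp', h⟩
      have hpb : (p : ℤ) ∣ b := by
        rwa [dvd_add_left (Dvd.dvd.mul_right (Int.natCast_dvd_natCast.2 hpY) n)] at hn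
      have h1 := Nat.dvd_gcd (Int.natCast_dvd_natCast.1 hpb) hpY
      rw [hbY] at h1
      exact absurd (Nat.dvd_one.1 h1) hp'.one_lt.ne'
  choose a ha using this
  exact ⟨a, ha⟩

/-- Almost primes in progressions with small modulus carry mass of progression averages. -/
theorem exists_bigOmega_le (k : ℕ) : ∃ L : ℕ, ∀ c : ℝ, 0 < c → ∃ w : ℕ, ∀ Y : ℕ, 0 < Y →
    (∀ p : ℕ, p.Prime → p ≤ w → p ∣ Y) → ∃ M₀ : ℕ, ∀ b : ℕ, 0 < b → b ≤ Y → b.Coprime Y →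
    ∀ M : ℕ, M₀ ≤ M → ∀ F : ℤ → ℝ, IsProgAvg k F → (∀ n, 0 ≤ F n) →
      c * M ≤ ∑ n ∈ Ico (0 : ℤ) M, F (b + Y * n) →
      ∃ x : ℕ, 0 < x ∧ x ≤ Y * M ∧ 0 < F x ∧ bigOmega x ≤ L := by
  obtain ⟨B, hB⟩ := exists_rough_of_le_sum k
  refine ⟨2 * (B + 1), fun c hc => ?_⟩
  obtain ⟨w, hw2, hw⟩ := hB c hc
  have hw1 : 1 ≤ w := by omega
  refine ⟨w, fun Y hY hwY => ⟨3 * (3 * Y) ^ (2 * (B + 1)) + 3 * w ^ (B + 1),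
    fun b hb hbY hcop M hM F hF hF0 hsum => ?_⟩⟩
  have hex : ∃ J : ℕ, M < 3 * (w ^ 2 ^ (J + 1)) ^ (B + 1) := by
    refine ⟨M, ?_⟩
    have h1 : M < 2 ^ M := Nat.lt_two_pow_self
    have h2 : 2 ^ (M + 1) < 2 ^ 2 ^ (M + 1) := Nat.lt_two_pow_self
    have h3 : 2 ^ 2 ^ (M + 1) ≤ w ^ 2 ^ (M + 1) := Nat.pow_le_pow_left hw2 _
    have h4 : w ^ 2 ^ (M + 1) ≤ (w ^ 2 ^ (M + 1)) ^ (B + 1) := Nat.le_self_pow (by omega) _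
    have h5 : 2 ^ M ≤ 2 ^ (M + 1) := Nat.pow_le_pow_right two_pos (Nat.le_succ M)
    have h6 := h1.trans_le (h5.trans (h2.le.trans (h3.trans h4)))
    linarith
  obtain ⟨J, hJ, hJ'⟩ : ∃ J : ℕ, 3 * (w ^ 2 ^ J) ^ (B + 1) ≤ M ∧
      M < 3 * (w ^ 2 ^ (J + 1)) ^ (B + 1) := by
    refine ⟨Nat.find hex, ?_, Nat.find_spec hex⟩
    rcases h : Nat.find hex with _ | J
    · simp only [pow_zero, pow_one]
      omega
    · have := Nat.find_min hex (m := J) (by omega)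
      omega
  set z := w ^ 2 ^ J with hz
  have hz1 : 1 ≤ z := Nat.one_le_pow _ _ hw1
  have hz2 : (w ^ 2 ^ (J + 1)) ^ (B + 1) = z ^ (2 * (B + 1)) := by
    rw [hz, ← pow_mul, ← pow_mul]
    congr 1
    ring
  rw [hz2] at hJ'
  have hzY : 3 * Y < z := by
    refine lt_of_pow_lt_pow_left₀ (2 * (B + 1)) (by omega) ?_
    omega
  obtain ⟨a, ha⟩ := exists_dvd_iff_dvd_sub hcop
  obtain ⟨n, hn, hFn, hrough⟩ := hw a J M
    (le_trans (Nat.mul_le_mul_left 3 (Nat.pow_le_pow_right hz1 (Nat.le_succ B))) hJ)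
    _ (hF.comp_affine b Y) (fun _ => hF0 _) hsum
  rw [mem_Ico] at hn
  lift n to ℕ using hn.1
  have hnM : n < M := by exact_mod_cast hn.2
  have hxM : b + Y * n ≤ Y * M := by
    calc b + Y * n ≤ Y + Y * n := by omega
      _ = Y * (n + 1) := by ring
      _ ≤ Y * M := Nat.mul_le_mul_left Y hnM
  refine ⟨b + Y * n, by omega, hxM, by exact_mod_cast hFn, ?_⟩
  have h1 : z ^ bigOmega (b + Y * n) ≤ b + Y * n := by
    refine pow_bigOmega_le (by omega) fun p hp hpx => ?_
    by_contra hpz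
    push Not at hpz
    rcases le_or_gt p w with hpw | hpw
    · have h2 := hwY p hp hpw
      have h3 : p ∣ b := by
        rwa [Nat.dvd_add_left (Dvd.dvd.mul_right h2 n)] at hpx
      have h4 := Nat.dvd_gcd h3 h2
      rw [hcop] at h4
      exact hp.one_lt.ne' (Nat.dvd_one.1 h4)
    · refine hrough p (mem_primesIn.2 ⟨⟨hpw, hpz.le⟩, hp⟩) ((ha p hp n).1 ?_)
      exact_mod_cast hpx
  have h2 : z ^ bigOmega (b + Y * n) < z ^ (2 * (B + 1) + 1) := by
    calc _ ≤ Y * M := h1.trans hxM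
      _ < Y * (3 * z ^ (2 * (B + 1))) := Nat.mul_lt_mul_of_pos_left hJ' hY
      _ = 3 * Y * z ^ (2 * (B + 1)) := by ring
      _ ≤ z * z ^ (2 * (B + 1)) := Nat.mul_le_mul_right _ hzY.le
      _ = _ := by rw [pow_succ, mul_comm]
  have h3 := (pow_lt_pow_iff_right₀ (by omega : 1 < z)).1 h2
  omega

lemma exists_one_le_sum_inv_primesIn (y : ℕ) :
    ∃ z : ℕ, 1 ≤ ∑ p ∈ primesIn y z, (1 : ℝ) / p ∧ ∑ p ∈ primesIn y z, (1 : ℝ) / p ≤ 2 := by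
  have hex : ∃ z : ℕ, 1 ≤ ∑ p ∈ primesIn y z, (1 : ℝ) / p := by
    have h1 := (not_summable_iff_tendsto_nat_atTop_of_nonneg fun n =>
      Set.indicator_nonneg (fun _ _ => by positivity) n).1 not_summable_one_div_on_primes
    obtain ⟨z, hz⟩ := (h1.eventually_ge_atTop
      (1 + ∑ n ∈ range (y + 1), Set.indicator {p : ℕ | p.Prime} (fun n : ℕ => (1 : ℝ) / n) n)).exists
    refine ⟨z, ?_⟩
    have h2 : range z ⊆ range (y + 1) ∪ Ioc y z := fun n hn => by
      rw [mem_union, mem_range, mem_Ioc]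
      rw [mem_range] at hn
      omega
    have h3 : ∑ n ∈ range z, Set.indicator {p : ℕ | p.Prime} (fun n : ℕ => (1 : ℝ) / n) n ≤
        ∑ n ∈ range (y + 1), Set.indicator {p : ℕ | p.Prime} (fun n : ℕ => (1 : ℝ) / n) n +
        ∑ n ∈ Ioc y z, Set.indicator {p : ℕ | p.Prime} (fun n : ℕ => (1 : ℝ) / n) n := by
      refine (sum_le_sum_of_subset_of_nonneg h2 fun n _ _ =>
        Set.indicator_nonneg (fun _ _ => by positivity) n).trans ?_
      rw [← sum_union_inter]
      exact le_add_of_nonneg_right (sum_nonneg fun n _ =>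
        Set.indicator_nonneg (fun _ _ => by positivity) n)
    have h4 : ∑ n ∈ Ioc y z, Set.indicator {p : ℕ | p.Prime} (fun n : ℕ => (1 : ℝ) / n) n =
        ∑ p ∈ primesIn y z, (1 : ℝ) / p := by
      rw [primesIn, sum_filter]
      refine sum_congr rfl fun n _ => ?_
      rw [Set.indicator_apply]
      rfl
    linarith
  refine ⟨Nat.find hex, Nat.find_spec hex, ?_⟩
  rcases h : Nat.find hex with _ | z
  · simp [primesIn]
  · have h1 := Nat.find_min hex (m := z) (by omega)
    push Not at h1
    have h2 : primesIn y (z + 1) ⊆ insert (z + 1) (primesIn y z) := fun p hp => by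
      rw [mem_insert]
      rw [mem_primesIn] at hp ⊢
      rcases eq_or_ne p (z + 1) with h | h
      · exact Or.inl h
      · exact Or.inr ⟨⟨hp.1.1, by omega⟩, hp.2⟩
    refine (sum_le_sum_of_subset_of_nonneg h2 fun _ _ _ => by positivity).trans ?_
    rw [sum_insert (by rw [mem_primesIn]; omega)]
    have h3 : (1 : ℝ) / (z + 1 : ℕ) ≤ 1 := by
      rw [one_div]
      exact Nat.cast_inv_le_one _
    linarith

/-- The version of `exists_bigOmega_le` which prescribes a number `e` of additional prime
factors. -/
theorem exists_bigOmega_mem_Icc (k : ℕ) : ∃ L : ℕ, ∀ (e : ℕ) (c : ℝ), 0 < c → ∃ w : ℕ, ∀ Y : ℕ,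
    0 < Y → (∀ p : ℕ, p.Prime → p ≤ w → p ∣ Y) → ∃ M₀ : ℕ, ∀ b : ℕ, 0 < b → b ≤ Y →
    b.Coprime Y → ∀ M : ℕ, M₀ ≤ M → ∀ F : ℤ → ℝ, IsProgAvg k F → (∀ n, 0 ≤ F n) →
      c * M ≤ ∑ n ∈ Ico (0 : ℤ) M, F (b + Y * n) →
      ∃ x : ℕ, 0 < x ∧ x ≤ 2 ^ e * Y * M ∧ 0 < F x ∧ e ≤ bigOmega x ∧ bigOmega x ≤ e + L := by
  obtain ⟨L, hL⟩ := exists_bigOmega_le k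
  obtain ⟨K, hK, hdisc⟩ := exists_residueDiscrepancyLE k (C := 2) (by norm_num)
  refine ⟨L, fun e => ?_⟩
  induction e with
  | zero => simpa using hL
  | succ e ih =>
    intro c hc
    obtain ⟨w, hw⟩ := ih (c / 4) (by positivity)
    refine ⟨w, fun Y hY hwY => ?_⟩
    obtain ⟨M₁, hM₁⟩ := hw Y hY hwY
    set θ : ℝ := 1 / 2 ^ (k + 1) with hθ
    have hθ0 : 0 < θ := by positivity
    obtain ⟨y, hyY, hyκ⟩ : ∃ y : ℕ, Y < y ∧ (K / (y : ℝ)) ^ θ < c / 2 := by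
      have h1 : Tendsto (fun y : ℕ => (K / (y : ℝ)) ^ θ) atTop (𝓝 0) := by
        have h2 := (tendsto_const_div_atTop_nhds_zero_nat K).rpow_const (p := θ) (Or.inr hθ0.le)
        rwa [Real.zero_rpow hθ0.ne'] at h2
      obtain ⟨y, h3, h4⟩ := ((h1.eventually (gt_mem_nhds (by positivity : 0 < c / 2))).and
        (eventually_gt_atTop Y)).exists
      exact ⟨y, h4, h3⟩
    obtain ⟨P, hP1, hP2⟩ := exists_one_le_sum_inv_primesIn y
    have hyP : y ≤ P := by
      by_contra h
      have : primesIn y P = ∅ := by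
        rw [primesIn, Ioc_eq_empty (by omega), filter_empty]
      rw [this, sum_empty] at hP1
      norm_num at hP1
    have hd := hdisc (primesIn y P) y P (fun p hp => (mem_primesIn.1 hp).2) hP2
      (fun p hp => (mem_primesIn.1 hp).1.1.le) (fun p hp => (mem_primesIn.1 hp).1.2)
      (by omega) hyP
    refine ⟨P ^ (2 ^ (k + 1) + 1) + P * (M₁ + 3), fun b hb hbY hcop M hM F hF hF0 hsum => ?_⟩
    obtain ⟨a, ha⟩ := exists_dvd_iff_dvd_sub hcop
    set G : ℤ → ℝ := fun n => F (b + Y * n) with hG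
    have hMpos : (0 : ℝ) < M := by
      have : 0 < M := lt_of_lt_of_le (Nat.add_pos_left (Nat.pow_pos (by omega)) _) hM
      exact_mod_cast this
    obtain ⟨p, hp, hpG⟩ : ∃ p ∈ primesIn y P, c / 2 * (1 / p * M) ≤
        ∑ n ∈ Ico (0 : ℤ) M, resInd a p n * G n := by
      by_contra! hcon
      have h1 := hd a M G (hF.comp_affine b Y) (by omega)
      have h2 : ∑ p ∈ primesIn y P, c / 2 * (1 / (p : ℝ) * M) ≤
          ∑ p ∈ primesIn y P, |∑ n ∈ Ico (0 : ℤ) M, resInd a p n * G n -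
            1 / p * ∑ n ∈ Ico (0 : ℤ) M, G n| := by
        refine sum_le_sum fun p hp => ?_
        rw [abs_sub_comm]
        refine le_trans ?_ (le_abs_self _)
        have h3 := hcon p hp
        have h4 : (1 : ℝ) / p * (c * M) ≤ 1 / p * ∑ n ∈ Ico (0 : ℤ) M, G n := by gcongr
        have h5 : (1 : ℝ) / p * (c * M) = 2 * (c / 2 * (1 / p * M)) := by ring
        linarith
      rw [← mul_sum, ← sum_mul] at h2
      have h6 : c / 2 * (1 * M) ≤ c / 2 * ((∑ p ∈ primesIn y P, (1 : ℝ) / p) * M) := by gcongr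
      have h7 : (K / (y : ℝ)) ^ θ * M < c / 2 * M := by gcongr
      linarith
    obtain ⟨⟨hyp, hpP⟩, hpp⟩ := mem_primesIn.1 hp
    have hpY : ¬ p ∣ Y := fun h => by
      have := Nat.le_of_dvd hY h
      omega
    have hp0 : 0 < p := hpp.pos
    have hpR : (0 : ℝ) < p := by exact_mod_cast hp0
    obtain ⟨N', a', r, hsum', hN', -, hr0, hrp, hra⟩ := sum_resInd_mul_eq a hpp M
    rw [abs_le] at hN'
    lift r to ℕ using hr0
    have hrp' : r < p := by exact_mod_cast hrp
    obtain ⟨b', hb'⟩ : p ∣ b + Y * r := by exact_mod_cast (ha p hpp r).2 hpY hra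
    have hb'0 : 0 < b' := Nat.pos_of_ne_zero fun h => by
      rw [h, mul_zero] at hb'
      omega
    have hb'Y : b' ≤ Y := by
      refine Nat.le_of_mul_le_mul_left ?_ hp0
      calc p * b' ≤ Y + Y * r := by omega
        _ = (r + 1) * Y := by ring
        _ ≤ p * Y := Nat.mul_le_mul_right Y hrp'
    have hcop' : b'.Coprime Y := by
      refine Nat.Coprime.coprime_dvd_left (dvd_mul_left b' p) ?_
      rw [← hb']
      exact (Nat.coprime_add_mul_left_left b Y r).2 hcop
    have hMp : (p : ℝ) * (M₁ + 3) ≤ M := by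
      have : p * (M₁ + 3) ≤ P * (M₁ + 3) := Nat.mul_le_mul_right _ hpP
      exact_mod_cast this.trans ((Nat.le_add_left _ _).trans hM)
    have hMp' : (M₁ : ℝ) + 3 ≤ M / p := by
      rw [le_div_iff₀ hpR]
      linarith
    have hM₁0 : (0 : ℝ) ≤ M₁ := Nat.cast_nonneg _
    have hM₁N' : M₁ ≤ N' := by
      have : (M₁ : ℝ) ≤ N' := by linarith
      exact_mod_cast this
    obtain ⟨x, hx0, hxN, hFx, hx1, hx2⟩ := hM₁ b' hb'0 hb'Y hcop' N' hM₁N'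
      (fun n => F (0 + p * n)) (hF.comp_affine 0 p) (fun _ => hF0 _) (by
        have h1 : ∑ n ∈ Ico (0 : ℤ) N', F (0 + p * (b' + Y * n)) =
            ∑ m ∈ Ico (0 : ℤ) N', G (r + p * m) := by
          refine sum_congr rfl fun n _ => ?_
          have h2 : (b : ℤ) + Y * r = p * b' := by exact_mod_cast hb'
          rw [hG]
          congr 1
          linear_combination -h2
        rw [h1, ← hsum']
        refine le_trans ?_ hpG
        have h3 : (1 : ℝ) / p * M = M / p := by ring
        rw [h3]
        have h4 : c * (N' : ℝ) ≤ c * (2 * (M / p)) := by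
          gcongr
          linarith
        linarith)
    refine ⟨p * x, Nat.mul_pos hp0 hx0, ?_, by simpa using hFx, ?_, ?_⟩
    · have h1 : p * N' ≤ 2 * M := by
        have h2 : (N' : ℝ) ≤ 2 * (M / p) := by linarith
        have h3 : (p : ℝ) * N' ≤ p * (2 * (M / p)) := by gcongr
        rw [show (p : ℝ) * (2 * (M / p)) = 2 * M by field_simp] at h3
        exact_mod_cast h3
      calc p * x ≤ p * (2 ^ e * Y * N') := Nat.mul_le_mul_left p hxN
        _ = 2 ^ e * Y * (p * N') := by ring
        _ ≤ 2 ^ e * Y * (2 * M) := Nat.mul_le_mul_left _ h1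
        _ = _ := by ring
    · rw [bigOmega_mul hp0 hx0, bigOmega_prime hpp]
      omega
    · rw [bigOmega_mul hp0 hx0, bigOmega_prime hpp]
      omega

lemma dens_eq_card_filter_div {X : Type*} [Fintype X] (S : Set X) [DecidablePred (· ∈ S)] :
    dens S = (univ.filter (· ∈ S)).card / Fintype.card X := by
  rw [dens_eq_card_div]
  congr!

lemma dens_forall_mem {X η : Type*} [Fintype X] [Fintype η] (S : Set X) :
    dens {u : η → X | ∀ i, u i ∈ S} = dens S ^ Fintype.card η := by
  have h1 : univ.filter (· ∈ {u : η → X | ∀ i, u i ∈ S}) =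
      Fintype.piFinset fun _ : η => univ.filter (· ∈ S) := by
    ext u
    simp
  rw [dens_eq_card_filter_div, dens_eq_card_filter_div, h1, Fintype.card_piFinset, Fintype.card_fun, prod_const,
    card_univ, div_pow]
  push_cast
  rfl

lemma bigOmega_le_self {n : ℕ} (hn : 0 < n) : bigOmega n ≤ n := by
  have h1 : 2 ^ bigOmega n ≤ n := pow_bigOmega_le hn fun p hp _ => hp.two_le
  exact (Nat.lt_two_pow_self.trans_le h1).le

/-- A dense subset of an interval of length `N`, seen in `ZMod (2 * N)`. -/
lemma exists_dense_zmod {N M : ℕ} [NeZero (2 * N)] (hN : 0 < N) {B : Finset ℕ}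
    (hB : B ⊆ Ioc M (M + N)) {δ : ℝ} (hδ : δ * N ≤ B.card) :
    δ / 2 ≤ dens {u : ZMod (2 * N) | M + 1 + u.val ∈ B} := by
  have h1 : B.card ≤ (univ.filter (· ∈ {u : ZMod (2 * N) | M + 1 + u.val ∈ B})).card := by
    have hval : ∀ b ∈ B, (((b - (M + 1) : ℕ) : ZMod (2 * N))).val = b - (M + 1) := fun b hb => by
      have := mem_Ioc.1 (hB hb)
      exact ZMod.val_cast_of_lt (by omega)
    refine card_le_card_of_injOn (fun b => ((b - (M + 1) : ℕ) : ZMod (2 * N))) ?_ ?_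
    · intro b hb
      have h2 := mem_Ioc.1 (hB hb)
      rw [mem_coe, mem_filter, Set.mem_ofPred_eq, hval b hb]
      refine ⟨mem_univ _, ?_⟩
      rwa [show M + 1 + (b - (M + 1)) = b by omega]
    · intro b hb b' hb' h
      have h2 := mem_Ioc.1 (hB hb)
      have h3 := mem_Ioc.1 (hB hb')
      have h4 := congrArg ZMod.val h
      simp only [hval b hb, hval b' hb'] at h4
      omega
  have h2 : (B.card : ℝ) ≤ (univ.filter (· ∈ {u : ZMod (2 * N) | M + 1 + u.val ∈ B})).card := by
    exact_mod_cast h1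
  have hN' : (0 : ℝ) < N := by exact_mod_cast hN
  rw [dens_eq_card_filter_div, ZMod.card, le_div_iff₀ (by push_cast; positivity)]
  push_cast
  linarith

lemma val_add_natCast_of_add_mem {N M k d : ℕ} [NeZero (2 * N)] {B : Finset ℕ}
    (hB : B ⊆ Ioc M (M + N)) (hd : k * d < N) {u : ZMod (2 * N)} (hu : M + 1 + u.val ∈ B)
    {i : ℕ} (hi : i ≤ k) : (u + ((i * d : ℕ) : ZMod (2 * N))).val = u.val + i * d := by
  have h1 := mem_Ioc.1 (hB hu)
  have h2 : i * d ≤ k * d := Nat.mul_le_mul_right d hi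
  have h3 : ((i * d : ℕ) : ZMod (2 * N)).val = i * d := ZMod.val_cast_of_lt (by omega)
  rw [ZMod.val_add_of_lt (by omega), h3]

/-- Szemerédi's theorem for common differences with exactly `j` prime factors, where `j` is
sufficiently large. -/
theorem exists_progression_bigOmega_eq (k : ℕ) {δ : ℝ} (hδ : 0 < δ) : ∃ J₀ : ℕ, 1 ≤ J₀ ∧
    ∀ j ≥ J₀, ∃ N₀ : ℕ, ∀ N ≥ N₀, ∀ (M : ℕ) (B : Finset ℕ), B ⊆ Ioc M (M + N) →
      δ * N ≤ B.card → ∃ a d : ℕ, 0 < d ∧ bigOmega d = j ∧ ∀ i ≤ k, a + i * d ∈ B := by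
  obtain ⟨L, hL⟩ := exists_bigOmega_mem_Icc k
  obtain ⟨ℓ, c, hc, hprog⟩ :=
    exists_dense_progressions k (α := (δ / 2) ^ (L + 1)) (by positivity)
  have hc' : 0 < c / (ℓ + 1) := by positivity
  choose W hW using fun e => hL e _ hc'
  set Y : ℕ := (∑ e ∈ range (ℓ + 1), W e).factorial with hY
  have hY0 : 0 < Y := Nat.factorial_pos _
  have hdvd : ∀ e ≤ ℓ, ∀ p : ℕ, p.Prime → p ≤ W e → p ∣ Y := fun e he p hp hpW =>
    (hp.dvd_factorial).2 (hpW.trans (single_le_sum (f := W) (fun _ _ => Nat.zero_le _)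
      (mem_range.2 (by omega))))
  have hM₀ : ∃ M₀ : ℕ, 0 < M₀ ∧ ∀ e ≤ ℓ, ∀ F : ℤ → ℝ, IsProgAvg k F → (∀ n, 0 ≤ F n) →
      c / (ℓ + 1) * M₀ ≤ ∑ n ∈ Ico (0 : ℤ) M₀, F (1 + Y * n) →
      ∃ x : ℕ, 0 < x ∧ x ≤ 2 ^ e * Y * M₀ ∧ 0 < F x ∧ e ≤ bigOmega x ∧ bigOmega x ≤ e + L := by
    have h1 : ∀ e, ∃ M₁ : ℕ, e ≤ ℓ → ∀ M ≥ M₁, ∀ F : ℤ → ℝ, IsProgAvg k F → (∀ n, 0 ≤ F n) →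
        c / (ℓ + 1) * M ≤ ∑ n ∈ Ico (0 : ℤ) M, F (1 + Y * n) →
        ∃ x : ℕ, 0 < x ∧ x ≤ 2 ^ e * Y * M ∧ 0 < F x ∧ e ≤ bigOmega x ∧ bigOmega x ≤ e + L := by
      intro e
      by_cases he : e ≤ ℓ
      · obtain ⟨M₁, hM₁⟩ := hW e Y hY0 (hdvd e he)
        refine ⟨M₁, fun _ M hM F hF hF0 hsum => ?_⟩
        refine hM₁ 1 one_pos hY0 (Nat.coprime_one_left Y) M hM F hF hF0 ?_
        exact_mod_cast hsum
      · exact ⟨0, fun h => absurd h he⟩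
    choose M₁ hM₁ using h1
    refine ⟨∑ e ∈ range (ℓ + 1), M₁ e + 1, by omega, fun e he F hF hF0 hsum => ?_⟩
    refine hM₁ e he _ ?_ F hF hF0 hsum
    exact (single_le_sum (f := M₁) (fun _ _ => Nat.zero_le _)
      (mem_range.2 (by omega))).trans (Nat.le_succ _)
  obtain ⟨M₀, hM₀, hx⟩ := hM₀
  refine ⟨L + ℓ + 1, by omega, fun j hj => ?_⟩
  obtain ⟨s, rfl⟩ : ∃ s, j = s + ℓ := ⟨j - ℓ, by omega⟩
  refine ⟨k * (2 ^ s * (ℓ * (2 ^ ℓ * Y * M₀))) + 1, fun N hN M B hB hBN => ?_⟩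
  have hN0 : 0 < N := by omega
  have : NeZero (2 * N) := ⟨by omega⟩
  obtain ⟨η, _, ν, hν, hη⟩ : ∃ (η : Type) (_ : Fintype η) (ν : η → ℕ),
      (∀ w ≤ L, ∃ i, ν i = w) ∧ Fintype.card η = L + 1 :=
    ⟨Fin (L + 1), inferInstance, fun i => i, fun w hw => ⟨⟨w, by omega⟩, rfl⟩, by simp⟩
  set S : Set (ZMod (2 * N)) := {u | M + 1 + u.val ∈ B} with hS
  set E : Set (η → ZMod (2 * N)) := {u | ∀ i, u i ∈ S} with hE
  have hdE : (δ / 2) ^ (L + 1) ≤ dens E := by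
    rw [hE, dens_forall_mem, hη]
    exact pow_le_pow_left₀ (by positivity) (exists_dense_zmod hN0 hB hBN) _
  set v : η → ZMod (2 * N) := fun i => ((2 ^ (s - ν i) : ℕ) : ZMod (2 * N)) with hv
  set Φ : ℤ → ℝ := progAvg k (fun _ => E.indicator 1) v with hΦ
  have hΦavg : IsProgAvg k Φ := by
    refine ⟨_, inferInstance, inferInstance, _, v, fun i u => ?_, rfl⟩
    rw [Set.indicator_apply]
    split_ifs <;> simp
  have hΦ0 : ∀ n, 0 ≤ Φ n := fun n => expect_nonneg fun u _ => prod_nonneg fun i _ =>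
    Set.indicator_nonneg (fun _ _ => zero_le_one) _
  have hΦsum : ∀ x : ℕ, c ≤ ∑ t ∈ Icc 1 ℓ, Φ (t * x) := fun x => by
    refine (hprog _ E (x • v) hdE).trans (le_of_eq ?_)
    refine sum_congr rfl fun t _ => ?_
    rw [hΦ, progAvg]
    refine expect_congr rfl fun u _ => prod_congr rfl fun i _ => ?_
    congr 2
    rw [smul_smul, ← natCast_zsmul]
    congr 1
    push_cast
    ring
  have hM₀R : (0 : ℝ) < M₀ := by exact_mod_cast hM₀
  obtain ⟨t, ht, hmean⟩ : ∃ t ∈ Icc 1 ℓ,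
      c / (ℓ + 1) * M₀ ≤ ∑ n ∈ Ico (0 : ℤ) M₀, Φ (0 + t * (1 + Y * n)) := by
    by_contra! hcon
    have h1 : c * M₀ ≤ ∑ n ∈ Ico (0 : ℤ) M₀, ∑ t ∈ Icc 1 ℓ, Φ (0 + t * (1 + Y * n)) := by
      have h2 : ∑ n ∈ Ico (0 : ℤ) M₀, c = c * M₀ := by
        rw [sum_const, Int.card_Ico, nsmul_eq_mul, sub_zero, Int.toNat_natCast, mul_comm]
      rw [← h2]
      refine sum_le_sum fun n hn => ?_
      rw [mem_Ico] at hn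
      lift n to ℕ using hn.1
      refine (hΦsum (1 + Y * n)).trans (le_of_eq (sum_congr rfl fun t _ => ?_))
      push_cast
      rw [zero_add]
    rw [sum_comm] at h1
    have h2 := h1.trans (sum_le_sum fun t ht => (hcon t ht).le)
    rw [sum_const, Nat.card_Icc, nsmul_eq_mul, Nat.add_sub_cancel] at h2
    have h3 : (ℓ : ℝ) * (c / (ℓ + 1) * M₀) = c * M₀ - c / (ℓ + 1) * M₀ := by
      field_simp
      ring
    have h4 : 0 < c / (ℓ + 1) * M₀ := by positivity
    linarith
  rw [mem_Icc] at ht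
  have hΩt := bigOmega_le_self ht.1
  obtain ⟨x, hx0, hxle, hFx, hx1, hx2⟩ := hx (ℓ - bigOmega t) (Nat.sub_le _ _)
    (fun n => Φ (0 + t * n)) (hΦavg.comp_affine 0 t) (fun _ => hΦ0 _) hmean
  obtain ⟨u, hu⟩ : ∃ u : η → ZMod (2 * N), ∀ i ≤ k, u + ((i : ℤ) * (t * x : ℤ)) • v ∈ E := by
    by_contra! hcon
    rw [zero_add, hΦ, progAvg] at hFx
    refine hFx.ne' (expect_eq_zero fun u _ => ?_)
    obtain ⟨i, hi, hiE⟩ := hcon u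
    exact prod_eq_zero (mem_range.2 (by omega : i < k + 1)) (Set.indicator_of_notMem hiE _)
  obtain ⟨w, hw⟩ : ∃ w, bigOmega x = ℓ - bigOmega t + w := ⟨_, (Nat.add_sub_cancel' hx1).symm⟩
  obtain ⟨i₀, hi₀⟩ := hν w (by omega)
  set d : ℕ := 2 ^ (s - w) * (t * x) with hd
  have htx : 0 < t * x := Nat.mul_pos ht.1 hx0
  have hcoord : ∀ i ≤ k, u i₀ + ((i * d : ℕ) : ZMod (2 * N)) ∈ S := fun i hi => by
    have h1 := hu i hi i₀
    rw [Pi.add_apply, Pi.smul_apply, hv, zsmul_eq_mul] at h1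
    simp only [hi₀] at h1
    convert h1 using 2
    rw [hd]
    push_cast
    ring
  have hu₀ : M + 1 + (u i₀).val ∈ B := by
    have h1 := hcoord 0 (Nat.zero_le k)
    rwa [zero_mul, Nat.cast_zero, add_zero] at h1
  have hkd : k * d < N := by
    have h1 : d ≤ 2 ^ s * (ℓ * (2 ^ ℓ * Y * M₀)) := by
      refine Nat.mul_le_mul (Nat.pow_le_pow_right two_pos (Nat.sub_le _ _))
        (Nat.mul_le_mul ht.2 (hxle.trans ?_))
      gcongr
      · exact one_le_two
      · exact Nat.sub_le _ _
    have := Nat.mul_le_mul_left k h1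
    omega
  refine ⟨M + 1 + (u i₀).val, d, Nat.mul_pos (Nat.pow_pos two_pos) htx, ?_, fun i hi => ?_⟩
  · rw [hd, bigOmega_mul (Nat.pow_pos two_pos) htx, bigOmega_mul ht.1 hx0, bigOmega_two_pow]
    omega
  · have h1 := hcoord i hi
    rw [hS, Set.mem_ofPred_eq, val_add_natCast_of_add_mem hB hkd hu₀ hi] at h1
    rwa [add_assoc]

/-- Among the translates of a dense subset of an interval by multiples of `J`, two have a large
intersection. -/
lemma exists_card_filter_add_mem {M N J r : ℕ} {s : Finset ℕ} (hs : s ⊆ Ioc M (M + N))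
    (hN : 0 < N) (hr : r * J ≤ N) (hcard : 4 * N ≤ r * s.card) :
    ∃ i, 1 ≤ i ∧ i < r ∧ N ≤ r ^ 2 * (s.filter (· + i * J ∈ s)).card := by
  by_contra! hcon
  set R := Ioc M (M + N + r * J) with hR
  set g : ℕ → ℕ → ℝ := fun i y => if i * J ≤ y ∧ y - i * J ∈ s then 1 else 0 with hg
  have hr0 : 0 < r := Nat.pos_of_ne_zero fun h => by
    rw [h, zero_mul] at hcard
    omega
  have hrR : (0 : ℝ) < r := by exact_mod_cast hr0
  have hsum : ∀ i < r, ∑ y ∈ R, g i y = s.card := by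
    intro i hi
    rw [hg, ← sum_filter, sum_const, nsmul_eq_mul, mul_one, Nat.cast_inj]
    refine card_nbij' (· - i * J) (· + i * J) ?_ ?_ ?_ ?_
    · intro y hy
      exact (mem_filter.1 hy).2.2
    · intro a ha
      have h1 := mem_Ioc.1 (hs ha)
      have h2 : i * J ≤ r * J := Nat.mul_le_mul_right J hi.le
      simp only [mem_coe, mem_filter, hR, mem_Ioc, Nat.add_sub_cancel]
      exact ⟨⟨by omega, by omega⟩, by omega, ha⟩
    · intro y hy
      exact Nat.sub_add_cancel (mem_filter.1 hy).2.1
    · intro a _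
      exact Nat.add_sub_cancel a (i * J)
  have hlt : ∀ i i', i < i' → i' < r → ∑ y ∈ R, g i y * g i' y ≤ N / r ^ 2 := by
    intro i i' hii hi'
    have h1 := hcon (i' - i) (by omega) (by omega)
    have h2 : (r : ℝ) ^ 2 * (s.filter (· + (i' - i) * J ∈ s)).card ≤ N := by
      exact_mod_cast h1.le
    rw [le_div_iff₀ (by positivity), mul_comm]
    refine le_trans ?_ h2
    gcongr
    have h3 : ∀ y, g i y * g i' y = if (i * J ≤ y ∧ y - i * J ∈ s) ∧ i' * J ≤ y ∧ y - i' * J ∈ s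
        then 1 else 0 := fun y => by
      rw [hg]
      by_cases h4 : i * J ≤ y ∧ y - i * J ∈ s <;> simp [h4]
    rw [sum_congr rfl fun y _ => h3 y, ← sum_filter, sum_const, nsmul_eq_mul, mul_one, Nat.cast_le]
    refine card_le_card_of_injOn (· - i' * J) ?_ ?_
    · intro y hy
      obtain ⟨-, ⟨h4, h5⟩, h6, h7⟩ := mem_filter.1 hy
      rw [mem_coe, mem_filter]
      refine ⟨h7, ?_⟩
      have h8 : (i' - i) * J + i * J = i' * J := by
        rw [← add_mul, Nat.sub_add_cancel hii.le]
      rwa [show y - i' * J + (i' - i) * J = y - i * J by omega]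
    · intro y hy y' hy' h
      obtain ⟨-, -, h4, -⟩ := mem_filter.1 hy
      obtain ⟨-, -, h5, -⟩ := mem_filter.1 hy'
      simp only at h
      omega
  have hpair : ∀ i < r, ∀ i' < r,
      ∑ y ∈ R, g i y * g i' y ≤ (if i = i' then (s.card : ℝ) else 0) + N / r ^ 2 := by
    intro i hi i' hi'
    have hN0 : (0 : ℝ) ≤ N / r ^ 2 := by positivity
    rcases lt_trichotomy i i' with h | rfl | h
    · rw [if_neg h.ne, zero_add]
      exact hlt i i' h hi'
    · rw [if_pos rfl, ← hsum i hi]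
      have h1 : ∀ y, g i y * g i y = g i y := fun y => by
        simp only [hg]
        split_ifs <;> simp
      rw [sum_congr rfl fun y _ => h1 y]
      linarith
    · rw [if_neg h.ne', zero_add]
      simp only [mul_comm (g i _)]
      exact hlt i' i h hi
  have hsq : ∑ y ∈ R, (∑ i ∈ range r, g i y) ^ 2 ≤ r * s.card + N := by
    have h1 : ∑ y ∈ R, (∑ i ∈ range r, g i y) ^ 2 =
        ∑ i ∈ range r, ∑ i' ∈ range r, ∑ y ∈ R, g i y * g i' y := by
      simp only [sq, sum_mul_sum]
      rw [sum_comm]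
      exact sum_congr rfl fun i _ => sum_comm
    rw [h1]
    refine (sum_le_sum fun i hi => sum_le_sum fun i' hi' =>
      hpair i (mem_range.1 hi) i' (mem_range.1 hi')).trans (le_of_eq ?_)
    have h2 : ∀ i ∈ range r, ∑ i' ∈ range r, ((if i = i' then (s.card : ℝ) else 0) + N / r ^ 2) =
        s.card + N / r := fun i hi => by
      rw [sum_add_distrib, sum_ite_eq, if_pos hi, sum_const, card_range, nsmul_eq_mul]
      congr 1
      field_simp
    rw [sum_congr rfl h2, sum_const, card_range, nsmul_eq_mul]
    field_simp
  have hlin : ∑ y ∈ R, ∑ i ∈ range r, g i y = r * s.card := by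
    rw [sum_comm, sum_congr rfl fun i hi => hsum i (mem_range.1 hi), sum_const, card_range,
      nsmul_eq_mul]
  have hRc : (R.card : ℝ) ≤ 2 * N := by
    rw [hR, Nat.card_Ioc]
    exact_mod_cast (by omega : M + N + r * J - M ≤ 2 * N)
  have h1 : 0 ≤ ∑ y ∈ R, (∑ i ∈ range r, g i y - 1) ^ 2 := sum_nonneg fun _ _ => sq_nonneg _
  have h2 : ∑ y ∈ R, (∑ i ∈ range r, g i y - 1) ^ 2 =
      ∑ y ∈ R, (∑ i ∈ range r, g i y) ^ 2 - 2 * ∑ y ∈ R, ∑ i ∈ range r, g i y + R.card := by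
    simp only [sub_sq, sum_add_distrib, sum_sub_distrib, ← mul_sum, mul_one, one_pow, sum_const,
      nsmul_eq_mul]
  have h3 : (4 : ℝ) * N ≤ r * s.card := by exact_mod_cast hcard
  have h4 : (0 : ℝ) < N := by exact_mod_cast hN
  rw [h2, hlin] at h1
  linarith

lemma exists_dense_window {A : Set ℕ} {σ : ℝ} (hσ : σ < upperBanachDensity A) (N₀ : ℕ) :
    ∃ N ≥ N₀, ∃ M : ℕ, σ * N ≤ ((Ioc M (M + N)).filter (· ∈ A)).card := by
  have hfreq : ∃ᶠ N : ℕ in atTop,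
      σ < ⨆ M : ℕ, (((Ioc M (M + N)).filter (· ∈ A)).card : ℝ) / N := by
    refine frequently_lt_of_lt_limsup ?_ hσ
    refine IsBoundedUnder.isCoboundedUnder_le ⟨0, eventually_map.2 (Eventually.of_forall fun N => ?_)⟩
    exact Real.iSup_nonneg fun M => by positivity
  obtain ⟨N, hσN, hN⟩ := (hfreq.and_eventually (eventually_ge_atTop (max N₀ 1))).exists
  have hN0 : (0 : ℝ) < N := by exact_mod_cast (le_max_right N₀ 1).trans hN
  obtain ⟨M, hM⟩ := exists_lt_of_lt_ciSup hσN
  exact ⟨N, (le_max_left N₀ 1).trans hN, M, ((lt_div_iff₀ hN0).1 hM).le⟩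

end DensityHJ


theorem stmt16 (k : ℕ) (hk : 0 < k) (A : Set ℕ) (hA : 0 < upperBanachDensity A) :
    ∃ a d : ℕ, 0 < a ∧ 0 < d ∧ (∀ i : ℕ, i ≤ k → a + i * d ∈ A) ∧ a + bigOmega d ∈ A := by
  set σ : ℝ := upperBanachDensity A / 2 with hσ
  have hσ0 : 0 < σ := by positivity
  obtain ⟨r, hr⟩ := exists_nat_ge (4 / σ)
  rw [div_le_iff₀ hσ0] at hr
  have hr0 : (0 : ℝ) < r := by
    by_contra! h
    nlinarith
  obtain ⟨J₀, hJ₀, hprog⟩ := DensityHJ.exists_progression_bigOmega_eq k (δ := 1 / (r : ℝ) ^ 2) (by positivity)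
  have hN₀ : ∀ i, ∃ N₀ : ℕ, 1 ≤ i → ∀ N ≥ N₀, ∀ (M : ℕ) (B : Finset ℕ),
      B ⊆ Finset.Ioc M (M + N) → 1 / (r : ℝ) ^ 2 * N ≤ B.card →
      ∃ a d : ℕ, 0 < d ∧ bigOmega d = i * J₀ ∧ ∀ m ≤ k, a + m * d ∈ B := fun i => by
    by_cases hi : 1 ≤ i
    · obtain ⟨N₀, h⟩ := hprog (i * J₀) (Nat.le_mul_of_pos_left J₀ hi)
      exact ⟨N₀, fun _ => h⟩
    · exact ⟨0, fun h => absurd h hi⟩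
  choose N₀ hN₀ using hN₀
  obtain ⟨N, hN, M, hM⟩ := DensityHJ.exists_dense_window (half_lt_self hA)
    (∑ i ∈ Finset.range r, N₀ i + r * J₀ + 1)
  set s := (Finset.Ioc M (M + N)).filter (· ∈ A) with hs
  obtain ⟨i, hi1, hir, hcard⟩ := DensityHJ.exists_card_filter_add_mem (J := J₀) (r := r)
    (Finset.filter_subset (· ∈ A) (Finset.Ioc M (M + N))) (by omega) (by omega) (by
      have h1 : (4 : ℝ) * N ≤ r * σ * N := by gcongr
      have h2 : (r : ℝ) * (σ * N) ≤ r * s.card := by gcongr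
      have h3 : (4 : ℝ) * N ≤ r * s.card := by linarith
      exact_mod_cast h3)
  have hNi : N₀ i ≤ N := by
    have := Finset.single_le_sum (f := N₀) (fun _ _ => Nat.zero_le _) (Finset.mem_range.2 hir)
    omega
  obtain ⟨a, d, hd, hΩ, ha⟩ := hN₀ i hi1 N hNi M (s.filter (· + i * J₀ ∈ s))
    ((Finset.filter_subset _ _).trans (Finset.filter_subset _ _)) (by
      rw [one_div_mul_eq_div, div_le_iff₀ (by positivity), mul_comm]
      exact_mod_cast hcard)
  have hmem : ∀ m ≤ k, a + m * d ∈ s := fun m hm => (Finset.mem_filter.1 (ha m hm)).1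
  have h0 := Finset.mem_filter.1 (ha 0 (Nat.zero_le k))
  rw [zero_mul, add_zero] at h0
  refine ⟨a, d, ?_, hd, fun m hm => (Finset.mem_filter.1 (hmem m hm)).2, ?_⟩
  · have := (Finset.mem_Ioc.1 (Finset.mem_filter.1 h0.1).1).1
    omega
  · rw [hΩ]
    exact (Finset.mem_filter.1 h0.2).2
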